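/- Let G be a hyperbolic Poincaré duality group and let QI(G) denote the group of boundary values of quasi-isometries of G acting on the Gromov boundary ∂G, with the uniform topology. Then QI(G) cannot have arbitrarily small torsion elements. -/

import Mathlib

noncomputable section
open scoped NNReal ENNReal

/-- A `(K, ε)`-quasi-isometry between two (pseudo)distance functions: coarsely bi-Lipschitz
with `ε`-dense image. -/
def IsQuasiIsometryDist {α β : Type*} (d₁ : α → α → ℝ) (d₂ : β → β → ℝ) (K ε : ℝ)
    (f : α → β) : Prop :=
  (∀ x y, d₁ x y / K - ε ≤ d₂ (f x) (f y) ∧ d₂ (f x) (f y) ≤ K * d₁ x y + ε) ∧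
    ∀ z, ∃ x, d₂ z (f x) ≤ ε

/-- Two self maps are at bounded distance from each other. -/
def BoundedDistEquiv {α : Type*} (d : α → α → ℝ) (f g : α → α) : Prop :=
  ∃ C : ℝ, ∀ x, d (f x) (g x) ≤ C

/-- The Gromov product of `x` and `y` with respect to the basepoint `b`. -/
def gromovProd {α : Type*} (d : α → α → ℝ) (x y b : α) : ℝ := (d x b + d y b - d x y) / 2

/-- Gromov hyperbolicity (four-point condition) of a distance function. -/
def IsGromovHyperbolicDist {α : Type*} (d : α → α → ℝ) (δ : ℝ) : Prop :=
  ∀ x y z b, min (gromovProd d x z b) (gromovProd d z y b) - δ ≤ gromovProd d x y b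

/-- The Cayley graph of a group with respect to a generating set `S`. -/
def cayleyGraph (G : Type*) [Group G] (S : Set G) : SimpleGraph G :=
  SimpleGraph.fromRel (fun g h => g⁻¹ * h ∈ S)

/-- The word metric on a group `G` with respect to a generating set `S`, as a real valued
distance function (the graph metric of the Cayley graph). -/
noncomputable def wordDist (G : Type*) [Group G] (S : Set G) (g h : G) : ℝ :=
  ((cayleyGraph G S).dist g h : ℝ)
/-- A sequence converging at infinity in a hyperbolic space: the Gromov products
`(u m | u n)` tend to infinity. -/
def ConvergesAtInfinity {α : Type*} (d : α → α → ℝ) (b : α) (u : ℕ → α) : Prop :=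
  Filter.Tendsto (fun p : ℕ × ℕ => gromovProd d (u p.1) (u p.2) b) Filter.atTop Filter.atTop

/-- A sequence together with the fact that it converges at infinity. -/
structure BoundarySeq {α : Type*} (d : α → α → ℝ) (b : α) where
  seq : ℕ → α
  conv : ConvergesAtInfinity d b seq

/-- Two sequences converging at infinity represent the same boundary point. -/
def boundaryRel {α : Type*} (d : α → α → ℝ) (b : α) (u v : BoundarySeq d b) : Prop :=
  Filter.Tendsto (fun p : ℕ × ℕ => gromovProd d (u.seq p.1) (v.seq p.2) b)
    Filter.atTop Filter.atTop

/-- The Gromov boundary: sequences converging at infinity modulo mutual convergence. -/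
def GromovBoundary {α : Type*} (d : α → α → ℝ) (b : α) := Quot (boundaryRel d b)

/-- The Gromov product of two boundary sequences. -/
noncomputable def bSeqProd {α : Type*} (d : α → α → ℝ) (b : α) (u v : BoundarySeq d b) : ℝ :=
  Filter.liminf (fun p : ℕ × ℕ => gromovProd d (u.seq p.1) (v.seq p.2) b) Filter.atTop

/-- The bijection `e` identifies the metric space `Z` with the Gromov boundary, and the metric
of `Z` is a visual metric with parameters `a` and `C`. -/
def IsVisualMetric {α Z : Type*} [MetricSpace Z] (d : α → α → ℝ) (b : α)
    (e : GromovBoundary d b ≃ Z) (a C : ℝ) : Prop :=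
  1 < a ∧ 1 ≤ C ∧ ∀ u v : BoundarySeq d b, ¬ boundaryRel d b u v →
    C⁻¹ * a ^ (-(bSeqProd d b u v)) ≤ dist (e (Quot.mk _ u)) (e (Quot.mk _ v)) ∧
      dist (e (Quot.mk _ u)) (e (Quot.mk _ v)) ≤ C * a ^ (-(bSeqProd d b u v))

/-- `h : Z₁ → Z₂` is the boundary extension of the map `φ : α → β`, where `Z₁, Z₂` are
identified with the Gromov boundaries via `e₁, e₂`. -/
def BoundaryMapExtends {α β Z₁ Z₂ : Type*} (d₁ : α → α → ℝ) (b₁ : α) (d₂ : β → β → ℝ) (b₂ : β)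
    (e₁ : GromovBoundary d₁ b₁ ≃ Z₁) (e₂ : GromovBoundary d₂ b₂ ≃ Z₂)
    (h : Z₁ → Z₂) (φ : α → β) : Prop :=
  ∀ u : BoundarySeq d₁ b₁, ∃ v : BoundarySeq d₂ b₂,
    (∀ n, v.seq n = φ (u.seq n)) ∧ h (e₁ (Quot.mk _ u)) = e₂ (Quot.mk _ v)

/-- The limit set of a subset `A`, inside the Gromov boundary. -/
def limitSet {α : Type*} (d : α → α → ℝ) (b : α) (A : Set α) : Set (GromovBoundary d b) :=
  {ξ | ∃ u : BoundarySeq d b, (∀ n, u.seq n ∈ A) ∧ ξ = Quot.mk _ u}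

/-- A discrete geodesic segment of length `n`. -/
def IsGeodesicSegment {α : Type*} (d : α → α → ℝ) (n : ℕ) (γ : ℕ → α) : Prop :=
  ∀ i j : ℕ, i ≤ n → j ≤ n → d (γ i) (γ j) = |(i : ℝ) - (j : ℝ)|

/-- Quasiconvexity of a subset with constant `D`: every discrete geodesic with endpoints in the
subset stays within distance `D` of it. -/
def IsQuasiconvexWith {α : Type*} (d : α → α → ℝ) (D : ℝ) (A : Set α) : Prop :=
  ∀ (n : ℕ) (γ : ℕ → α), IsGeodesicSegment d n γ → γ 0 ∈ A → γ n ∈ A →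
    ∀ i ≤ n, ∃ a ∈ A, d (γ i) a ≤ D

/-- Quasiconvexity of a subset. -/
def IsQuasiconvex {α : Type*} (d : α → α → ℝ) (A : Set α) : Prop :=
  ∃ D : ℝ, 0 ≤ D ∧ IsQuasiconvexWith d D A
/-- The self-homeomorphism group of a topological space. -/
instance homeoGroup (Z : Type*) [TopologicalSpace Z] : Group (Z ≃ₜ Z) where
  mul f g := g.trans f
  one := Homeomorph.refl Z
  inv := Homeomorph.symm
  mul_assoc f g h := Homeomorph.ext fun _ => rfl
  one_mul f := Homeomorph.ext fun _ => rfl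
  mul_one f := Homeomorph.ext fun _ => rfl
  inv_mul_cancel f := Homeomorph.ext fun x => f.symm_apply_apply x

/-- The topology of uniform convergence on the self-homeomorphism group of a metric space. -/
instance homeoUniformTopology (Z : Type*) [MetricSpace Z] : TopologicalSpace (Z ≃ₜ Z) :=
  TopologicalSpace.induced (fun f => UniformFun.ofFun (f : Z → Z)) inferInstance
/-- `G` is a Poincaré duality group of dimension `n`: the group cohomology of `G` with
coefficients in the group ring `ℤ[G]` is `ℤ` in degree `n` and trivial elsewhere. -/
def IsPDGroup (G : Type) [Group G] (n : ℕ) : Prop :=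
  (∀ k : ℕ, k ≠ n → Subsingleton (groupCohomology (Rep.ofMulAction ℤ G G) k)) ∧
    Nonempty ((groupCohomology (Rep.ofMulAction ℤ G G) n) ≃ₗ[ℤ] ℤ)
/-- A topological group has arbitrarily small torsion elements. -/
def HasArbitrarilySmallTorsion (Γ : Type*) [Group Γ] [TopologicalSpace Γ] : Prop :=
  ∀ U ∈ nhds (1 : Γ), ∃ g : Γ, g ∈ U ∧ g ≠ 1 ∧ (∃ n : ℕ, 0 < n ∧ g ^ n = 1) ∧
    ∀ m : ℕ, 0 < m → g ^ m ∈ U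

namespace NW

/-- Coboundary of a function on lists (augmented ordered cochains, all degrees at once). -/
def cob {V : Type*} : (List V → ℤ) → List V → ℤ
  | _, [] => 0
  | f, a :: l => f l - cob (fun l' => f (a :: l')) l

/-- Ordered chains. -/
abbrev Ch (V : Type*) := List V →₀ ℤ

/-- The basis chain of a list. -/
abbrev sg {V : Type*} (l : List V) : Ch V := Finsupp.single l 1

/-- Coning with a vertex. -/
def cone {V : Type*} (a : V) : Ch V →ₗ[ℤ] Ch V := Finsupp.lmapDomain ℤ ℤ (List.cons a)

/-- Linear extension. -/
def lin {V W : Type*} (T : List V → Ch W) : Ch V →ₗ[ℤ] Ch W := Finsupp.linearCombination ℤ T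

/-- Evaluation of a cochain on a chain. -/
def ev {V : Type*} (f : List V → ℤ) : Ch V →ₗ[ℤ] ℤ := Finsupp.linearCombination ℤ f

/-- Boundary of a list. -/
def bd {V : Type*} : List V → Ch V
  | [] => 0
  | a :: l => sg l - cone a (bd l)

/-- Boundary operator. -/
def B {V : Type*} : Ch V →ₗ[ℤ] Ch V := lin bd

/-- Supported chains. -/
abbrev Sup {V : Type*} (P : List V → Prop) : Submodule ℤ (Ch V) :=
  Finsupp.supported ℤ ℤ {l | P l}

section
variable {V W U : Type*}

@[simp] theorem cone_sg (a : V) (l : List V) : cone a (sg l) = sg (a :: l) := by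
  simp [cone, sg]

@[simp] theorem lin_sg (T : List V → Ch W) (l : List V) : lin T (sg l) = T l := by
  simp [lin, sg]

@[simp] theorem ev_sg (f : List V → ℤ) (l : List V) : ev f (sg l) = f l := by
  simp [ev, sg]

@[simp] theorem B_sg (l : List V) : B (sg l) = bd l := by simp [B]

theorem lhom_ext {M : Type*} [AddCommGroup M] {φ ψ : Ch V →ₗ[ℤ] M}
    (h : ∀ l, φ (sg l) = ψ (sg l)) : φ = ψ := by
  apply Finsupp.lhom_ext'
  intro l
  ext
  simpa using h l

theorem lhom_ext_apply {M : Type*} [AddCommGroup M] (φ ψ : Ch V →ₗ[ℤ] M)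
    (h : ∀ l, φ (sg l) = ψ (sg l)) (z : Ch V) : φ z = ψ z := by
  rw [lhom_ext h]

theorem B_cone (a : V) (z : Ch V) : B (cone a z) = z - cone a (B z) := by
  have := lhom_ext_apply (B ∘ₗ cone a) (LinearMap.id - cone a ∘ₗ B) (fun l => by simp [bd]) z
  simpa using this

theorem B_bd (l : List V) : B (bd l) = 0 := by
  induction l with
  | nil => simp [bd]
  | cons a l ih => simp [bd, B_cone, ih]

theorem B_B (z : Ch V) : B (B z) = 0 := by
  have := lhom_ext_apply (B ∘ₗ B) (0 : Ch V →ₗ[ℤ] Ch V) (fun l => by simp [B_bd]) z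
  simpa using this

theorem ev_cone (f : List V → ℤ) (a : V) (z : Ch V) :
    ev f (cone a z) = ev (fun l => f (a :: l)) z := by
  have := lhom_ext_apply (ev f ∘ₗ cone a) (ev (fun l => f (a :: l))) (fun l => by simp) z
  simpa using this

theorem cob_eq_ev (f : List V → ℤ) (l : List V) : cob f l = ev f (bd l) := by
  induction l generalizing f with
  | nil => simp [cob, bd]
  | cons a l ih => simp [cob, bd, ih, ev_cone]

theorem ev_B (f : List V → ℤ) (z : Ch V) : ev f (B z) = ev (cob f) z := by
  have := lhom_ext_apply (ev f ∘ₗ B) (ev (cob f)) (fun l => by simp [cob_eq_ev]) z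
  simpa using this

theorem ev_lin (f : List W → ℤ) (T : List V → Ch W) (z : Ch V) :
    ev f (lin T z) = ev (fun l => ev f (T l)) z := by
  have := lhom_ext_apply (ev f ∘ₗ lin T) (ev (fun l => ev f (T l))) (fun l => by simp) z
  simpa using this

theorem cob_pull (f : List W → ℤ) (T : List V → Ch W) (l : List V) :
    cob (fun l => ev f (T l)) l = ev f (lin T (bd l)) := by
  rw [cob_eq_ev, ev_lin]

theorem cob_cob (f : List V → ℤ) (l : List V) : cob (cob f) l = 0 := by
  rw [cob_eq_ev, ← ev_B, B_bd]; simp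

theorem ev_add (f g : List V → ℤ) (z : Ch V) : ev (fun l => f l + g l) z = ev f z + ev g z := by
  have := lhom_ext_apply (ev (fun l => f l + g l)) (ev f + ev g) (fun l => by simp) z
  simpa using this

theorem ev_sub (f g : List V → ℤ) (z : Ch V) : ev (fun l => f l - g l) z = ev f z - ev g z := by
  have := lhom_ext_apply (ev (fun l => f l - g l)) (ev f - ev g) (fun l => by simp) z
  simpa using this

theorem ev_mul (k : ℤ) (g : List V → ℤ) (z : Ch V) : ev (fun l => k * g l) z = k * ev g z := by
  have := lhom_ext_apply (ev (fun l => k * g l)) (k • ev g) (fun l => by simp) z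
  simpa using this

theorem ev_sum {ι : Type*} (s : Finset ι) (g : ι → List V → ℤ) (z : Ch V) :
    ev (fun l => ∑ i ∈ s, g i l) z = ∑ i ∈ s, ev (g i) z := by
  have := lhom_ext_apply (ev (fun l => ∑ i ∈ s, g i l)) (∑ i ∈ s, ev (g i)) (fun l => by simp) z
  simpa using this

theorem cob_add (f g : List V → ℤ) (l : List V) :
    cob (fun l => f l + g l) l = cob f l + cob g l := by
  simp only [cob_eq_ev, ev_add]

theorem cob_sub (f g : List V → ℤ) (l : List V) :
    cob (fun l => f l - g l) l = cob f l - cob g l := by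
  simp only [cob_eq_ev, ev_sub]

theorem cob_mul (k : ℤ) (g : List V → ℤ) (l : List V) :
    cob (fun l => k * g l) l = k * cob g l := by
  simp only [cob_eq_ev, ev_mul]

theorem cob_sum {ι : Type*} (s : Finset ι) (g : ι → List V → ℤ) (l : List V) :
    cob (fun l => ∑ i ∈ s, g i l) l = ∑ i ∈ s, cob (g i) l := by
  simp only [cob_eq_ev, ev_sum]

theorem cob_zero (l : List V) : cob (fun _ => 0) l = 0 := by
  simpa using cob_mul 0 (fun _ => 0) l

theorem cob_map (f : List W → ℤ) (p : V → W) (l : List V) :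
    cob (fun l => f (l.map p)) l = cob f (l.map p) := by
  induction l generalizing f with
  | nil => simp [cob]
  | cons a l ih =>
    simp only [cob, List.map_cons]
    rw [ih (fun l' => f (p a :: l'))]

/-! ### supports -/

theorem sg_mem {P : List V → Prop} {l : List V} (h : P l) : sg l ∈ Sup P :=
  Finsupp.single_mem_supported ℤ 1 h

theorem Sup_mono {P Q : List V → Prop} (h : ∀ l, P l → Q l) : Sup P ≤ Sup Q :=
  Finsupp.supported_mono h

theorem Sup_induct {P : List V → Prop} {M : Type*} [AddCommGroup M] (φ : Ch V →ₗ[ℤ] M)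
    (N : Submodule ℤ M) (h : ∀ l, P l → φ (sg l) ∈ N) {z : Ch V} (hz : z ∈ Sup P) : φ z ∈ N := by
  have hz : z ∈ Submodule.span ℤ ((fun i => Finsupp.single i (1 : ℤ)) '' {l | P l}) := by
    rw [← Finsupp.supported_eq_span_single]; exact hz
  have : Submodule.span ℤ ((fun i => Finsupp.single i (1 : ℤ)) '' {l | P l}) ≤ N.comap φ := by
    rw [Submodule.span_le]
    rintro _ ⟨l, hl, rfl⟩
    exact h l hl
  exact this hz

theorem Sup_eq {P : List V → Prop} {M : Type*} [AddCommGroup M] (φ ψ : Ch V →ₗ[ℤ] M)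
    (h : ∀ l, P l → φ (sg l) = ψ (sg l)) {z : Ch V} (hz : z ∈ Sup P) : φ z = ψ z := by
  have := Sup_induct (φ - ψ) ⊥ (fun l hl => by simp [h l hl]) hz
  simpa [sub_eq_zero] using this

theorem ev_zero_of_Sup {P : List V → Prop} (f : List V → ℤ) (h : ∀ l, P l → f l = 0)
    {z : Ch V} (hz : z ∈ Sup P) : ev f z = 0 := by
  have := Sup_eq (ev f) 0 (fun l hl => by simp [h l hl]) hz
  simpa using this

theorem ev_congr_of_Sup {P : List V → Prop} (f g : List V → ℤ) (h : ∀ l, P l → f l = g l)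
    {z : Ch V} (hz : z ∈ Sup P) : ev f z = ev g z :=
  Sup_eq (ev f) (ev g) (fun l hl => by simp [h l hl]) hz

theorem cone_mem {P Q : List V → Prop} (a : V) (h : ∀ l, P l → Q (a :: l)) {z : Ch V}
    (hz : z ∈ Sup P) : cone a z ∈ Sup Q :=
  Sup_induct (cone a) _ (fun l hl => by rw [cone_sg]; exact sg_mem (h l hl)) hz

theorem bd_mem (l : List V) : bd l ∈ Sup (fun l' => l'.Sublist l ∧ l'.length + 1 = l.length) := by
  induction l with
  | nil => simp [bd]
  | cons a l ih =>
    refine Submodule.sub_mem _ (sg_mem ⟨by simp, by simp⟩) ?_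
    exact cone_mem a (fun l' hl' => ⟨hl'.1.cons_cons a, by simp [hl'.2]⟩) ih

/-- coboundary depends only on faces -/
theorem cob_congr (f g : List V → ℤ) (l : List V)
    (h : ∀ l', l'.Sublist l → l'.length + 1 = l.length → f l' = g l') : cob f l = cob g l := by
  rw [cob_eq_ev, cob_eq_ev]
  exact ev_congr_of_Sup f g (fun l' hl' => h l' hl'.1 hl'.2) (bd_mem l)

theorem cob_eq_zero (f : List V → ℤ) (l : List V)
    (h : ∀ l', l'.Sublist l → l'.length + 1 = l.length → f l' = 0) : cob f l = 0 := by
  rw [cob_congr f (fun _ => 0) l h, cob_zero]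

/-! ### prism -/

/-- The prism between two vertex maps. -/
def pr (p q : V → W) : List V → Ch W
  | [] => 0
  | a :: l => sg (p a :: q a :: l.map q) - cone (p a) (pr p q l)

theorem lin_cone (p q : V → W) (a : V) (z : Ch V) :
    lin (pr p q) (cone a z) =
      lin (fun l => sg (p a :: q a :: l.map q)) z - cone (p a) (lin (pr p q) z) := by
  have := lhom_ext_apply (lin (pr p q) ∘ₗ cone a)
    (lin (fun l => sg (p a :: q a :: l.map q)) - cone (p a) ∘ₗ lin (pr p q))
    (fun l => by simp [pr]) z
  simpa using this

theorem bd_map (q : V → W) (l : List V) : bd (l.map q) = lin (fun l => sg (l.map q)) (bd l) := by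
  induction l with
  | nil => simp [bd]
  | cons a l ih =>
    simp only [List.map_cons, bd, map_sub, lin_sg, ih]
    congr 1
    exact lhom_ext_apply (cone (q a) ∘ₗ lin fun l => sg (l.map q))
      ((lin fun l => sg (l.map q)) ∘ₗ cone a) (fun l => by simp) _

theorem prism (p q : V → W) (l : List V) :
    B (pr p q l) + lin (pr p q) (bd l) = sg (l.map q) - sg (l.map p) := by
  induction l with
  | nil => simp [pr, bd]
  | cons a l ih =>
    have h1 : (lin (fun l => sg (p a :: q a :: l.map q)) : Ch V →ₗ[ℤ] Ch W) (bd l)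
        = cone (p a) (cone (q a) (bd (l.map q))) := by
      rw [bd_map]
      exact lhom_ext_apply (lin (fun l => sg (p a :: q a :: l.map q)))
        (cone (p a) ∘ₗ cone (q a) ∘ₗ lin fun l => sg (l.map q)) (fun l => by simp) _
    have h2 := congrArg (cone (p a)) ih
    simp only [map_add, map_sub, cone_sg] at h2
    simp only [pr, bd, map_sub, B_sg, B_cone, lin_cone, lin_sg, h1, List.map_cons, cone_sg]
    rw [eq_sub_iff_add_eq] at h2
    rw [← eq_sub_iff_add_eq] at h2
    rw [eq_sub_of_add_eq' h2]
    abel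

theorem pr_mem (p q : V → W) (l : List V) :
    pr p q l ∈ Sup (fun l' => l'.length = l.length + 1 ∧
      ∀ x ∈ l', (∃ y ∈ l, x = p y) ∨ (∃ y ∈ l, x = q y)) := by
  induction l with
  | nil => simp [pr]
  | cons a l ih =>
    refine Submodule.sub_mem _ (sg_mem ⟨by simp, ?_⟩) ?_
    · intro x hx
      simp only [List.mem_cons, List.mem_map] at hx
      grind
    · refine cone_mem (p a) (fun l' hl' => ⟨by simp [hl'.1], ?_⟩) ih
      intro x hx
      have := hl'.2 x
      grind

/-- Prism operator on cochains. -/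
def prh (p q : V → W) (f : List W → ℤ) : List V → ℤ := fun l => ev f (pr p q l)

theorem prh_formula (p q : V → W) (f : List W → ℤ) (l : List V) :
    f (l.map q) - f (l.map p) = cob (prh p q f) l + prh p q (cob f) l := by
  have h := congrArg (ev f) (prism p q l)
  simp only [map_add, map_sub, ev_sg, ev_B] at h
  rw [← h]
  unfold prh
  rw [cob_pull]
  ring

theorem prh_zero (p q : V → W) (f : List W → ℤ) (l : List V)
    (h : ∀ l', l'.length = l.length + 1 →
      (∀ x ∈ l', (∃ y ∈ l, x = p y) ∨ (∃ y ∈ l, x = q y)) → f l' = 0) : prh p q f l = 0 :=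
  ev_zero_of_Sup f (fun l' hl' => h l' hl'.1 hl'.2) (pr_mem p q l)

theorem prh_congr (p q : V → W) (f g : List W → ℤ) (l : List V)
    (h : ∀ l', l'.length = l.length + 1 →
      (∀ x ∈ l', (∃ y ∈ l, x = p y) ∨ (∃ y ∈ l, x = q y)) → f l' = g l') :
    prh p q f l = prh p q g l :=
  ev_congr_of_Sup f g (fun l' hl' => h l' hl'.1 hl'.2) (pr_mem p q l)

/-- Formula for the coboundary as a sum over faces. -/
theorem cob_eq_sum (f : List V → ℤ) (l : List V) :
    cob f l = ∑ i ∈ Finset.range l.length, (-1 : ℤ) ^ i * f (l.eraseIdx i) := by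
  induction l generalizing f with
  | nil => simp [cob]
  | cons a l ih =>
    rw [cob, ih, List.length_cons, Finset.sum_range_succ']
    simp [pow_succ, Finset.sum_neg_distrib]
    ring

end

end NW

namespace NW

section newman
variable {X : Type*} [MetricSpace X]

/-- Small lists. -/
def Sm (ε : ℝ) (l : List X) : Prop := ∀ x ∈ l, ∀ y ∈ l, dist x y < ε

/-- Vanishing on small lists of length `k` in `A`. -/
def Van (A : Set X) (ε : ℝ) (k : ℕ) (f : List X → ℤ) : Prop :=
  ∀ l : List X, l.length = k → (∀ x ∈ l, x ∈ A) → Sm ε l → f l = 0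

/-- Cohomologically trivial at small scale. -/
def Tr (N : ℕ) (A : Set X) (f : List X → ℤ) : Prop :=
  ∃ ν : List X → ℤ, ∃ ε > 0, Van A ε N (fun l => f l - cob ν l)

theorem Sm.mono {ε ε' : ℝ} {l : List X} (h : Sm ε l) (he : ε ≤ ε') : Sm ε' l :=
  fun x hx y hy => (h x hx y hy).trans_le he

theorem Sm.sub {ε : ℝ} {l l' : List X} (h : Sm ε l) (hs : l'.Sublist l) : Sm ε l' :=
  fun x hx y hy => h x (hs.subset hx) y (hs.subset hy)

theorem Van.mono {A : Set X} {ε ε' : ℝ} {k : ℕ} {f : List X → ℤ} (h : Van A ε k f)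
    (he : ε' ≤ ε) : Van A ε' k f := fun l h1 h2 h3 => h l h1 h2 (h3.mono he)

theorem Tr.of_van {N : ℕ} {A : Set X} {f : List X → ℤ} {ε : ℝ} (he : 0 < ε) (h : Van A ε N f) :
    Tr N A f := ⟨fun _ => 0, ε, he, fun l h1 h2 h3 => by simp [cob_zero, h l h1 h2 h3]⟩

theorem Tr.of_cob (N : ℕ) (A : Set X) (f : List X → ℤ) : Tr N A (cob f) :=
  ⟨f, 1, one_pos, fun l _ _ _ => by simp⟩

theorem Tr.congr {N : ℕ} {A : Set X} {f g : List X → ℤ} (hf : Tr N A f) {ε : ℝ} (he : 0 < ε)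
    (h : Van A ε N (fun l => f l - g l)) : Tr N A g := by
  obtain ⟨ν, e1, h1, hv⟩ := hf
  refine ⟨ν, min e1 ε, lt_min h1 he, fun l hl1 hl2 hl3 => ?_⟩
  have a := hv l hl1 hl2 (hl3.mono (min_le_left _ _))
  have b := h l hl1 hl2 (hl3.mono (min_le_right _ _))
  simp only at a b ⊢
  linarith

theorem Tr.add {N : ℕ} {A : Set X} {f g : List X → ℤ} (hf : Tr N A f) (hg : Tr N A g) :
    Tr N A (fun l => f l + g l) := by
  obtain ⟨ν, e1, h1, hv⟩ := hf
  obtain ⟨μ, e2, h2, hw⟩ := hg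
  refine ⟨fun l => ν l + μ l, min e1 e2, lt_min h1 h2, fun l hl1 hl2 hl3 => ?_⟩
  have a := hv l hl1 hl2 (hl3.mono (min_le_left _ _))
  have b := hw l hl1 hl2 (hl3.mono (min_le_right _ _))
  simp only [cob_add] at a b ⊢
  linarith

theorem Tr.mul {N : ℕ} {A : Set X} {f : List X → ℤ} (k : ℤ) (hf : Tr N A f) :
    Tr N A (fun l => k * f l) := by
  obtain ⟨ν, e1, h1, hv⟩ := hf
  refine ⟨fun l => k * ν l, e1, h1, fun l hl1 hl2 hl3 => ?_⟩
  have a := hv l hl1 hl2 hl3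
  simp only [cob_mul] at a ⊢
  rw [← mul_sub, a, mul_zero]

theorem Tr.sub {N : ℕ} {A : Set X} {f g : List X → ℤ} (hf : Tr N A f) (hg : Tr N A g) :
    Tr N A (fun l => f l - g l) := by
  simpa [sub_eq_add_neg] using hf.add (hg.mul (-1))

theorem Tr.sum {N : ℕ} {A : Set X} {ι : Type*} (s : Finset ι) (f : ι → List X → ℤ)
    (h : ∀ i, Tr N A (f i)) : Tr N A (fun l => ∑ i ∈ s, f i l) := by
  classical
  induction s using Finset.induction_on with
  | empty => exact Tr.of_van one_pos (fun l _ _ _ => by simp)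
  | insert a s ha ih => simpa [Finset.sum_insert ha] using (h a).add ih

/-- The cohomological input for the Newman type argument. -/
structure PP (X : Type*) [MetricSpace X] (N : ℕ) (α : List X → ℤ) (ε0 : ℝ) : Prop where
  pos : 0 < ε0
  hN : 1 ≤ N
  P1 : Van Set.univ ε0 (N + 1) (cob α)
  P2 : ∀ (γ : List X → ℤ) (ε : ℝ), 0 < ε → Van Set.univ ε (N + 1) (cob γ) →
    ∃ k : ℤ, Tr N Set.univ (fun l => γ l - k * α l)
  P3 : ∀ j : ℤ, Tr N Set.univ (fun l => j * α l) → j = 0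
  P4 : ∀ (A : Set X), ¬ Dense A → ∀ (f : List X → ℤ) (ε : ℝ), 0 < ε → Van A ε (N + 1) (cob f) →
    Tr N A f

theorem pr_map_right {V W U : Type*} (p q : W → U) (s : V → W) (l : List V) :
    pr p q (l.map s) = pr (p ∘ s) (q ∘ s) l := by
  induction l with
  | nil => simp [pr]
  | cons a l ih => simp [pr, ih]

theorem prh_map_right {V W U : Type*} (p q : W → U) (s : V → W) (f : List U → ℤ) (l : List V) :
    prh p q f (l.map s) = prh (p ∘ s) (q ∘ s) f l := by
  simp [prh, pr_map_right]

theorem sm_cast {ε : ℝ} {e : ℝ} {p q : X → X} {A : Set X} {l : List X} (hl : Sm ε l)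
    (hA : ∀ x ∈ l, x ∈ A)
    (hp : ∀ x ∈ A, dist (p x) x < e) (hq : ∀ x ∈ A, dist (q x) x < e) {l' : List X}
    (h : ∀ x ∈ l', (∃ y ∈ l, x = p y) ∨ (∃ y ∈ l, x = q y)) : Sm (ε + 2 * e) l' := by
  have key : ∀ x ∈ l', ∃ y ∈ l, dist x y < e := by
    intro x hx
    rcases h x hx with ⟨y, hy, rfl⟩ | ⟨y, hy, rfl⟩
    · exact ⟨y, hy, hp y (hA y hy)⟩
    · exact ⟨y, hy, hq y (hA y hy)⟩
  intro x hx y hy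
  obtain ⟨x', hx', h1⟩ := key x hx
  obtain ⟨y', hy', h2⟩ := key y hy
  have h3 := hl x' hx' y' hy'
  rw [dist_comm] at h2
  have := dist_triangle4 x x' y' y
  linarith

variable {N : ℕ} {α : List X → ℤ} {ε0 : ℝ}

theorem PP.near_cocycle (H : PP X N α ε0) (q : X → X) (hq : ∀ x, dist (q x) x < ε0 / 4) :
    Van Set.univ (ε0 / 4) (N + 1) (cob (fun l => α (l.map q))) := by
  intro l h1 h2 h3
  rw [cob_map]
  refine H.P1 _ (by simpa using h1) (by simp) ?_
  refine (sm_cast (p := q) (q := q) (A := Set.univ) h3 h2 (e := ε0 / 4) (fun x _ => hq x)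
    (fun x _ => hq x) ?_).mono (by linarith [H.pos])
  intro x hx
  simp only [List.mem_map] at hx
  obtain ⟨y, hy, rfl⟩ := hx
  exact Or.inl ⟨y, hy, rfl⟩

theorem PP.near_tr (H : PP X N α ε0) (q : X → X) (hq : ∀ x, dist (q x) x < ε0 / 4) :
    Tr N Set.univ (fun l => α (l.map q) - α l) := by
  refine ⟨prh id q α, ε0 / 4, by linarith [H.pos], fun l h1 h2 h3 => ?_⟩
  have := prh_formula id q α l
  simp only [List.map_id_fun, id] at this
  simp only
  rw [this]
  have hz : prh id q (cob α) l = 0 := by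
    apply prh_zero
    intro l' hl' hx
    refine H.P1 l' (by omega) (by simp) ?_
    refine (sm_cast (A := Set.univ) h3 h2 (e := ε0 / 4) (fun x _ => ?_)
      (fun x _ => hq x) hx).mono (by linarith [H.pos])
    simpa using by linarith [H.pos]
  rw [hz]; ring

end newman
end NW

namespace NW

section newman2
variable {X : Type*} [MetricSpace X] {N : ℕ} {α : List X → ℤ} {ε0 : ℝ}
variable {T : X → X} {p : ℕ}

theorem iter_dvd (hTp : ∀ x, T^[p] x = x) {i : ℕ} (h : p ∣ i) (x : X) : T^[i] x = x := by
  obtain ⟨k, rfl⟩ := h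
  have : Function.IsPeriodicPt T p x := hTp x
  exact this.mul_const k

theorem iter_inv (hTp : ∀ x, T^[p] x = x) (hp : 0 < p) (i : ℕ) :
    ∃ j, ∀ x, T^[j] (T^[i] x) = x := by
  refine ⟨p * i - i, fun x => ?_⟩
  rw [← Function.iterate_add_apply, Nat.sub_add_cancel (Nat.le_mul_of_pos_left i hp)]
  exact iter_dvd hTp (dvd_mul_right _ _) x

theorem fix_of (hTp : ∀ x, T^[p] x = x) (hp : p.Prime) {i : ℕ} (hi : ¬ p ∣ i) {x : X}
    (hx : T^[i] x = x) : T x = x := by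
  have h1 : Function.IsPeriodicPt T p x := hTp x
  have h2 : Function.IsPeriodicPt T i x := hx
  rcases (Nat.dvd_prime hp).1 h1.minimalPeriod_dvd with h | h
  · exact Function.minimalPeriod_eq_one_iff_isFixedPt.1 h
  · exact absurd (h ▸ h2.minimalPeriod_dvd) hi

theorem unif [CompactSpace X] (hTc : Continuous T) (hTp : ∀ x, T^[p] x = x) (hp : 0 < p)
    {e : ℝ} (he : 0 < e) :
    ∃ d > 0, d ≤ e ∧ ∀ i x y, dist x y < d → dist (T^[i] x) (T^[i] y) < e := by
  have h1 : ∀ n : ℕ, ∃ d > 0, d ≤ e ∧ ∀ i < n, ∀ x y, dist x y < d →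
      dist (T^[i] x) (T^[i] y) < e := by
    intro n
    induction n with
    | zero => exact ⟨e, he, le_rfl, by simp⟩
    | succ n ih =>
      obtain ⟨d, hd, hde, h⟩ := ih
      have hu := CompactSpace.uniformContinuous_of_continuous (hTc.iterate n)
      obtain ⟨d', hd', h'⟩ := Metric.uniformContinuous_iff.1 hu e he
      refine ⟨min d d', lt_min hd hd', (min_le_left _ _).trans hde, fun i hi x y hxy => ?_⟩
      rcases Nat.lt_succ_iff_lt_or_eq.1 hi with hi | rfl
      · exact h i hi x y (hxy.trans_le (min_le_left _ _))
      · exact h' (hxy.trans_le (min_le_right _ _))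
  obtain ⟨d, hd, hde, h⟩ := h1 p
  refine ⟨d, hd, hde, fun i x y hxy => ?_⟩
  have hh : ∀ z, T^[i] z = T^[i % p] z := fun z => by
    conv_lhs => rw [← Nat.mod_add_div i p, Function.iterate_add_apply,
      iter_dvd hTp (dvd_mul_right _ _)]
  rw [hh, hh]
  exact h _ (Nat.mod_lt _ hp) x y hxy

theorem Sm.map_iter {e d : ℝ} (h : ∀ i x y, dist x y < d → dist (T^[i] x) (T^[i] y) < e)
    {l : List X} (hl : Sm d l) (i : ℕ) : Sm e (l.map T^[i]) := by
  intro x hx y hy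
  simp only [List.mem_map] at hx hy
  obtain ⟨x, hx, rfl⟩ := hx
  obtain ⟨y, hy, rfl⟩ := hy
  exact h i x y (hl x hx y hy)

theorem Tr.comp [CompactSpace X] (hTc : Continuous T) (hTp : ∀ x, T^[p] x = x) (hp : 0 < p)
    {f : List X → ℤ} (h : Tr N Set.univ f) (i : ℕ) :
    Tr N Set.univ (fun l => f (l.map T^[i])) := by
  obtain ⟨ν, e, he, hv⟩ := h
  obtain ⟨d, hd, -, hu⟩ := unif hTc hTp hp he
  refine ⟨fun l => ν (l.map T^[i]), d, hd, fun l h1 h2 h3 => ?_⟩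
  simp only [cob_map]
  exact hv _ (by simpa using h1) (by simp) (h3.map_iter hu i)

theorem inv_iter {f : List X → ℤ} (h : ∀ l, f (l.map T) = f l) (i : ℕ) (l : List X) :
    f (l.map T^[i]) = f l := by
  induction i with
  | zero => simp
  | succ i ih =>
    rw [Function.iterate_succ', ← List.map_map, h, ih]

theorem step [CompactSpace X] (H : PP X N α ε0) (hTc : Continuous T) (hp : p.Prime)
    (hTp : ∀ x, T^[p] x = x) (hcl : ∀ i x, dist (T^[i] x) x < ε0 / 4)
    {σ ρ η2 : ℝ} (hσ : 0 < σ) (hρ : ρ < 2 * σ) (hη2 : 0 < η2) (x0 : X)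
    (hsep : ∀ i, ¬ p ∣ i → ∀ x y, dist x x0 < 4 * σ → dist y x0 < 4 * σ → η2 ≤ dist (T^[i] x) y)
    (β : List X → ℤ) (hinv : ∀ l, β (l.map T) = β l) (OW : Set X) (hOW : IsOpen OW)
    (hOWinv : ∀ i x, T^[i] x ∈ OW → x ∈ OW)
    {ε : ℝ} (hε : 0 < ε) (hcob : Van Set.univ ε (N + 1) (cob β))
    (hsup : ∀ l : List X, l.length = N → Sm ε l → β l ≠ 0 →
      ∀ x ∈ l, (∃ i, dist (T^[i] x) x0 < ρ) ∨ x ∈ OW) :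
    ∃ (k : ℤ) (γ : List X → ℤ) (ε' : ℝ), 0 < ε' ∧ Tr N Set.univ (fun l => γ l - p * k * α l) ∧
      Van Set.univ ε' (N + 1) (cob γ) ∧ (∀ l, γ (l.map T) = γ l) ∧
      ∀ l : List X, l.length = N → Sm ε' l → β l - γ l ≠ 0 → ∃ w ∈ l, w ∈ OW := by
  classical
  have hN := H.hN
  set β1 : List X → ℤ := fun l => if ∀ x ∈ l, dist x x0 < ρ then β l else 0 with hβ1
  set A : Set X := {x | x ∈ OW → ¬ dist x x0 < 3 * σ} with hA
  set ε1 := min ε σ with hε1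
  have hε1pos : 0 < ε1 := lt_min hε hσ
  have hV : ∀ i x, dist x x0 < 4 * σ → dist (T^[i] x) x0 < 4 * σ → T^[i] x = x := by
    intro i x h1 h2
    by_cases hd : p ∣ i
    · exact iter_dvd hTp hd x
    · have := hsep i hd x _ h1 h2
      rw [dist_self] at this
      linarith
  have hcob1 : Van A ε1 (N + 1) (cob β1) := by
    intro l hl1 hl2 hl3
    by_cases hv : ∃ v ∈ l, dist v x0 < ρ
    · obtain ⟨v, hv, hvx⟩ := hv
      have hl3σ : ∀ x ∈ l, dist x x0 < 3 * σ := fun x hx => by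
        have h1 := hl3 x hx v hv
        have h2 : ε1 ≤ σ := min_le_right _ _
        have := dist_triangle x v x0
        linarith
      rw [cob_congr β1 β l]
      · exact hcob l hl1 (by simp) (hl3.mono (min_le_left _ _))
      · intro l' hs hlen
        simp only [hβ1]
        split_ifs with hc
        · rfl
        · by_contra hne
          apply hc
          intro x hx
          rcases hsup l' (by omega) ((hl3.mono (min_le_left _ _)).sub hs) (Ne.symm hne) x hx with
            ⟨i, hi⟩ | hw
          · have := hV i x (by linarith [hl3σ x (hs.subset hx)]) (by linarith)
            rwa [this] at hi
          · exact absurd (hl3σ x (hs.subset hx)) (hl2 x (hs.subset hx) hw)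
    · apply cob_eq_zero
      intro l' hs hlen
      simp only [hβ1]
      rw [if_neg]
      intro hc
      obtain ⟨x, hx⟩ : ∃ x, x ∈ l' := List.exists_mem_of_length_pos (by omega)
      exact hv ⟨x, hs.subset hx, hc x hx⟩
  obtain ⟨γ, ε2, hε2, hε21, hγ1, hγ2, hγ3⟩ : ∃ (γ : List X → ℤ) (ε2 : ℝ), 0 < ε2 ∧ ε2 ≤ ε1 ∧
      Van Set.univ ε2 (N + 1) (cob γ) ∧
      (∀ l : List X, l.length = N → (∀ x ∈ l, x ∈ A) → Sm ε2 l → γ l = β1 l) ∧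
      (∀ l : List X, l.length = N → Sm ε2 l → γ l ≠ 0 → ∀ x ∈ l, dist x x0 < 4 * σ) := by
    have hβ1V : ∀ l, β1 l ≠ 0 → ∀ x ∈ l, dist x x0 < 4 * σ := by
      intro l hl x hx
      simp only [hβ1] at hl
      split_ifs at hl with hc
      · linarith [hc x hx]
      · exact absurd rfl hl
    by_cases hE : ∃ x ∈ OW, dist x x0 < 3 * σ
    · have hnd : ¬ Dense A := by
        intro hd
        have hopen : IsOpen (OW ∩ Metric.ball x0 (3 * σ)) := hOW.inter Metric.isOpen_ball
        obtain ⟨x, hx1, hx2⟩ := hE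
        obtain ⟨y, hy, hyA⟩ := hd.inter_open_nonempty _ hopen ⟨x, hx1, hx2⟩
        exact hyA hy.1 hy.2
      obtain ⟨ν, ε3, hε3, hν⟩ := H.P4 A hnd β1 ε1 hε1pos hcob1
      set ν1 : List X → ℤ := fun l => if ∀ x ∈ l, x ∈ A then ν l else 0 with hν1
      have hagree : ∀ l : List X, l.length = N → (∀ x ∈ l, x ∈ A) → Sm (min ε1 ε3) l →
          cob ν1 l = β1 l := by
        intro l h1 h2 h3
        rw [cob_congr ν1 ν l]
        · have := hν l h1 h2 (h3.mono (min_le_right _ _))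
          simp only at this
          linarith
        · intro l' hs _
          simp only [hν1]
          rw [if_pos (fun x hx => h2 x (hs.subset hx))]
      refine ⟨cob ν1, min ε1 ε3, lt_min hε1pos hε3, min_le_left _ _,
        fun l _ _ _ => cob_cob _ _, hagree, ?_⟩
      intro l h1 h3 hne
      by_cases hlA : ∀ x ∈ l, x ∈ A
      · rw [hagree l h1 hlA h3] at hne
        exact hβ1V l hne
      · push Not at hlA
        obtain ⟨y, hy, hyA⟩ := hlA
        simp only [hA, Set.mem_ofPred_eq, Classical.not_imp, not_not] at hyA
        intro x hx
        have h4 := h3 x hx y hy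
        have h5 : min ε1 ε3 ≤ σ := (min_le_left _ _).trans (min_le_right _ _)
        have := dist_triangle x y x0
        linarith [hyA.2]
    · have hAu : ∀ x, x ∈ A := fun x hx hd => hE ⟨x, hx, hd⟩
      exact ⟨β1, ε1, hε1pos, le_rfl, fun l h1 _ h3 => hcob1 l h1 (fun x _ => hAu x) h3,
        fun _ _ _ _ => rfl, fun l _ _ h => hβ1V l h⟩
  obtain ⟨ε3, hε3, hε32, hu⟩ := unif hTc hTp hp.pos hε2
  obtain ⟨k, hk⟩ := H.P2 γ ε2 hε2 hγ1
  set γ' : List X → ℤ := fun l => ∑ i ∈ Finset.range p, γ (l.map T^[i]) with hγ'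
  have hγ'inv : ∀ l, γ' (l.map T) = γ' l := by
    intro l
    simp only [hγ', List.map_map, ← Function.iterate_succ]
    obtain ⟨q, rfl⟩ : ∃ q, p = q + 1 := ⟨p - 1, by have := hp.pos; omega⟩
    rw [Finset.sum_range_succ, Finset.sum_range_succ']
    congr 2
    apply List.map_congr_left
    intro x _
    rw [hTp]; rfl
  refine ⟨k, γ', ε3, hε3, ?_, ?_, hγ'inv, ?_⟩
  · have h1 : ∀ i, Tr N Set.univ (fun l => γ (l.map T^[i]) - k * α l) := by
      intro i
      have a := hk.comp hTc hTp hp.pos i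
      have b := (H.near_tr (T^[i]) (hcl i)).mul k
      refine (a.add b).congr one_pos (fun l _ _ _ => ?_)
      simp only
      ring
    have h2 := Tr.sum (Finset.range p) _ h1
    refine h2.congr one_pos (fun l _ _ _ => ?_)
    simp only [hγ', Finset.sum_sub_distrib, Finset.sum_const, Finset.card_range]
    simp
    ring
  · intro l h1 h2 h3
    rw [cob_sum]
    apply Finset.sum_eq_zero
    intro i _
    rw [cob_map]
    exact hγ1 _ (by simpa using h1) (by simp) (h3.map_iter hu i)
  · intro l h1 h3 hne
    by_contra hW
    push Not at hW
    apply hne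
    rw [sub_eq_zero]
    obtain ⟨x1, hx1⟩ : ∃ x, x ∈ l := List.exists_mem_of_length_pos (by omega)
    by_cases hI : ∃ i, ∀ x ∈ l, dist (T^[i] x) x0 < 4 * σ
    · obtain ⟨i, hi⟩ := hI
      rw [← inv_iter hinv i l, ← inv_iter hγ'inv i l]
      set l1 := l.map T^[i] with hl1
      have hl1mem : ∀ x ∈ l1, dist x x0 < 4 * σ ∧ x ∉ OW := by
        intro x hx
        simp only [hl1, List.mem_map] at hx
        obtain ⟨y, hy, rfl⟩ := hx
        exact ⟨hi y hy, fun h => hW y hy (hOWinv i y h)⟩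
      have hl1len : l1.length = N := by simpa [hl1] using h1
      have hl1sm : Sm ε2 l1 := h3.map_iter hu i
      have hx1' : T^[i] x1 ∈ l1 := List.mem_map_of_mem hx1
      have e1 : γ' l1 = γ l1 := by
        simp only [hγ']
        rw [Finset.sum_eq_single 0]
        · simp
        · intro j hj hj0
          by_contra hne'
          have hsm : Sm ε2 (l1.map T^[j]) := by
            rw [hl1, List.map_map, ← Function.iterate_add]
            exact h3.map_iter hu _
          have h5 := hγ3 _ (by simpa using hl1len) hsm hne' (T^[j] (T^[i] x1))
            (List.mem_map_of_mem hx1')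
          have hnd : ¬ p ∣ j := fun hd => by
            have := Nat.le_of_dvd (Nat.pos_of_ne_zero hj0) hd
            simp at hj; omega
          have := hsep j hnd _ _ (hl1mem _ hx1').1 h5
          rw [dist_self] at this
          linarith
        · intro h; simp at h; exact absurd h hp.ne_zero
      rw [e1, hγ2 l1 hl1len (fun x hx hxW => absurd hxW (hl1mem x hx).2) hl1sm]
      simp only [hβ1]
      split_ifs with hc
      · rfl
      · by_contra hne'
        apply hc
        intro x hx
        rcases hsup l1 hl1len (hl1sm.mono (hε21.trans (min_le_left _ _))) hne' x hx with
          ⟨j, hj⟩ | hw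
        · have := hV j x (hl1mem x hx).1 (by linarith)
          rwa [this] at hj
        · exact absurd hw (hl1mem x hx).2
    · push Not at hI
      have e1 : γ' l = 0 := by
        simp only [hγ']
        apply Finset.sum_eq_zero
        intro i _
        by_contra hne'
        obtain ⟨x, hx, hx2⟩ := hI i
        have := hγ3 _ (by simpa using h1) (h3.map_iter hu i) hne' (T^[i] x)
          (List.mem_map_of_mem hx)
        linarith
      rw [e1]
      by_contra hne'
      rcases hsup l h1 (h3.mono ((hε32.trans hε21).trans (min_le_left _ _))) hne' x1 hx1 with
        ⟨i, hi⟩ | hw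
      · obtain ⟨x, hx, hx2⟩ := hI i
        have h4 := hu i x x1 (h3 x hx x1 hx1)
        have h5 : ε2 ≤ σ := hε21.trans (min_le_right _ _)
        have := dist_triangle (T^[i] x) (T^[i] x1) x0
        linarith
      · exact hW x1 hx1 hw

end newman2
end NW

namespace NW

section newman3
variable {X : Type*} [MetricSpace X] {N : ℕ} {α : List X → ℤ} {ε0 : ℝ}
variable {T : X → X} {p : ℕ}

theorem induct [CompactSpace X] (H : PP X N α ε0) (hTc : Continuous T) (hp : p.Prime)
    (hTp : ∀ x, T^[p] x = x) (hcl : ∀ i x, dist (T^[i] x) x < ε0 / 4)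
    {σ η2 : ℝ} (hσ : 0 < σ) (hη2 : 0 < η2) (J : Finset X)
    (hsep : ∀ c ∈ J, ∀ i, ¬ p ∣ i → ∀ x y, dist x c < 4 * σ → dist y c < 4 * σ →
      η2 ≤ dist (T^[i] x) y) :
    ∀ (ρ : ℝ), ρ < 2 * σ → ∀ (β : List X → ℤ), (∀ l, β (l.map T) = β l) →
      ∀ ε : ℝ, 0 < ε → Van Set.univ ε (N + 1) (cob β) →
      (∀ l : List X, l.length = N → Sm ε l → β l ≠ 0 →
        ∀ x ∈ l, ∃ c ∈ J, ∃ i, dist (T^[i] x) c < ρ) →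
      ∃ k : ℤ, Tr N Set.univ (fun l => β l - p * k * α l) := by
  classical
  induction J using Finset.induction_on with
  | empty =>
    intro ρ _ β _ ε hε _ hsup
    refine ⟨0, Tr.of_van hε (fun l h1 h2 h3 => ?_)⟩
    have hN := H.hN
    obtain ⟨x1, hx1⟩ : ∃ x, x ∈ l := List.exists_mem_of_length_pos (by omega)
    by_contra hne
    obtain ⟨c, hc, -⟩ := hsup l h1 h3 (by simpa using hne) x1 hx1
    simp at hc
  | insert a J ha ih =>
    intro ρ hρ β hinv ε hε hcob hsup
    set OW : Set X := {x | ∃ c ∈ J, ∃ i, dist (T^[i] x) c < ρ} with hOW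
    have hopen : IsOpen OW := by
      have : OW = ⋃ c ∈ J, ⋃ i, {x | dist (T^[i] x) c < ρ} := by
        ext x; simp [hOW]
      rw [this]
      refine isOpen_biUnion fun c _ => isOpen_iUnion fun i => ?_
      exact isOpen_lt ((hTc.iterate i).dist continuous_const) continuous_const
    obtain ⟨k, γ, ε', hε', htr, hc', hi', hs'⟩ := step H hTc hp hTp hcl hσ hρ hη2 a
      (hsep a (by simp)) β hinv OW hopen (by
        rintro i x ⟨c, hc, j, hj⟩
        exact ⟨c, hc, j + i, by rwa [Function.iterate_add_apply]⟩) hε hcob (by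
        intro l h1 h2 h3 x hx
        obtain ⟨c, hc, i, hi⟩ := hsup l h1 h2 h3 x hx
        rcases Finset.mem_insert.1 hc with rfl | hc
        · exact Or.inl ⟨i, hi⟩
        · exact Or.inr ⟨c, hc, i, hi⟩)
    obtain ⟨d, hd, hde, hu⟩ := unif hTc hTp hp.pos (e := (2 * σ - ρ) / 2) (by linarith)
    obtain ⟨k', hk'⟩ := ih (fun c hc => hsep c (by simp [hc])) ((ρ + 2 * σ) / 2) (by linarith)
      (fun l => β l - γ l) (fun l => by simp only [hinv, hi'])
      (min (min ε ε') d) (lt_min (lt_min hε hε') hd) (by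
        intro l h1 h2 h3
        rw [cob_sub, hcob l h1 h2 (h3.mono ((min_le_left _ _).trans (min_le_left _ _))),
          hc' l h1 h2 (h3.mono ((min_le_left _ _).trans (min_le_right _ _)))]
        rfl) (by
        intro l h1 h3 hne x hx
        obtain ⟨w, hw, c, hc, i, hi⟩ := hs' l h1
          (h3.mono ((min_le_left _ _).trans (min_le_right _ _))) hne
        refine ⟨c, hc, i, ?_⟩
        have := hu i x w ((h3 x hx w hw).trans_le (min_le_right _ _))
        have := dist_triangle (T^[i] x) (T^[i] w) c
        linarith)
    refine ⟨k + k', (htr.add hk').congr one_pos (fun l _ _ _ => ?_)⟩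
    simp only
    ring

theorem prh_map_left {V W U : Type*} (p q : V → W) (s : W → U) (f : List U → ℤ) (l : List V) :
    prh p q (fun l => f (l.map s)) l = prh (s ∘ p) (s ∘ q) f l := by
  induction l generalizing f with
  | nil => simp [prh, pr]
  | cons a l ih =>
    have := ih (fun l' => f (s (p a) :: l'))
    simp only [prh] at this
    simp only [prh, pr, map_sub, ev_sg, ev_cone, List.map_cons, List.map_map, this]
    rfl

theorem newman [CompactSpace X] (H : PP X N α ε0) (hTc : Continuous T) (hp : p.Prime)
    (hTp : ∀ x, T^[p] x = x) (hcl : ∀ i x, dist (T^[i] x) x < ε0 / 4) (hne : ∃ x, T x ≠ x) :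
    False := by
  classical
  have hε0 := H.pos
  obtain ⟨s, hsT, hs⟩ : ∃ s : X → X, (∀ x, s (T x) = s x) ∧ ∀ x, ∃ i, T^[i] x = s x := by
    let S : Setoid X := ⟨fun x y => ∃ i, T^[i] x = y, ⟨fun x => ⟨0, rfl⟩, by
      rintro x y ⟨i, rfl⟩
      obtain ⟨j, hj⟩ := iter_inv hTp hp.pos i
      exact ⟨j, hj x⟩, by
      rintro x y z ⟨i, rfl⟩ ⟨j, rfl⟩
      exact ⟨j + i, by rw [Function.iterate_add_apply]⟩⟩⟩
    refine ⟨fun x => (Quotient.mk S x).out, fun x => ?_, fun x => ?_⟩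
    · refine congrArg Quotient.out ?_
      exact Quotient.sound (s := S) (S.symm (⟨1, rfl⟩ : ∃ i, T^[i] x = T x))
    · exact S.symm (Quotient.mk_out (s := S) x)
  have hscl : ∀ x, dist (s x) x < ε0 / 4 := fun x => by
    obtain ⟨i, hi⟩ := hs x
    rw [← hi]; exact hcl i x
  set F : Set X := {x | T x = x} with hF
  have hFi : ∀ f ∈ F, ∀ i, T^[i] f = f := fun f hf i => Function.iterate_fixed hf i
  have hFc : IsClosed F := isClosed_eq hTc continuous_id
  have hFd : ¬ Dense F := by
    intro hd
    have := hFc.closure_eq ▸ hd.closure_eq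
    obtain ⟨x, hx⟩ := hne
    exact hx (this.symm ▸ Set.mem_univ x : x ∈ F)
  set β : List X → ℤ := fun l => α (l.map s) with hβ
  have hβc := H.near_cocycle s hscl
  have hβα := H.near_tr s hscl
  have hβT : ∀ l, β (l.map T) = β l := fun l => by
    simp only [hβ, List.map_map]
    congr 1
    exact List.map_congr_left (fun x _ => hsT x)
  obtain ⟨ν0, εF, hεF, hν0⟩ := H.P4 F hFd β (ε0 / 4) (by linarith)
    (fun l h1 h2 h3 => hβc l h1 (by simp) h3)
  set e1 := min εF (ε0 / 4) / 4 with he1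
  have he1pos : 0 < e1 := by have := lt_min hεF (by linarith : 0 < ε0 / 4); linarith
  have he1a : 4 * e1 ≤ εF := by have := min_le_left εF (ε0 / 4); linarith
  have he1b : 4 * e1 ≤ ε0 / 4 := by have := min_le_right εF (ε0 / 4); linarith
  obtain ⟨θ, hθ, hθe, hu1⟩ := unif hTc hTp hp.pos he1pos
  obtain ⟨θ', hθ', hθθ', hu2⟩ := unif hTc hTp hp.pos hθ
  set Ns : Set X := {x | ∃ f ∈ F, dist (s x) f < θ} with hNs
  obtain ⟨r, hr⟩ : ∃ r : X → X, ∀ y, (∃ f ∈ F, dist y f < θ) → r y ∈ F ∧ dist y (r y) < θ := by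
    have : ∀ y, ∃ f, (∃ f ∈ F, dist y f < θ) → f ∈ F ∧ dist y f < θ := by
      intro y
      by_cases h : ∃ f ∈ F, dist y f < θ
      · obtain ⟨f, hf⟩ := h
        exact ⟨f, fun _ => hf⟩
      · exact ⟨y, fun h' => absurd h' h⟩
    exact ⟨fun y => (this y).choose, fun y => (this y).choose_spec⟩
  set ρ : X → X := fun x => r (s x) with hρ
  have hρT : ∀ x, ρ (T x) = ρ x := fun x => by simp only [hρ, hsT]
  have hNT : ∀ x, T x ∈ Ns ↔ x ∈ Ns := fun x => by
    simp only [hNs, Set.mem_ofPred_eq, hsT]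
  have hρF : ∀ x ∈ Ns, ρ x ∈ F := fun x hx => (hr _ hx).1
  have hρd : ∀ x ∈ Ns, dist (ρ x) x < e1 := fun x hx => by
    obtain ⟨i, hi⟩ := hs x
    obtain ⟨j, hj⟩ := iter_inv hTp hp.pos i
    have h1 := hu1 j _ _ (hr _ hx).2
    rw [hFi _ (hr _ hx).1, ← hi, hj, hi, dist_comm] at h1
    exact h1
  set ω0 : List X → ℤ := fun l => ν0 (l.map ρ) - prh id ρ β l with hω0
  set ω : List X → ℤ := fun l => if ∀ x ∈ l, x ∈ Ns then ω0 l else 0 with hω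
  have hω0T : ∀ l, ω0 (l.map T) = ω0 l := by
    intro l
    simp only [hω0, List.map_map]
    have h1 : ρ ∘ T = ρ := funext hρT
    have h2 : s ∘ T = s := funext hsT
    rw [h1, prh_map_right, hβ, prh_map_left, prh_map_left, h1]
    simp only [Function.comp_id, Function.id_comp, h2]
  have hωT : ∀ l, ω (l.map T) = ω l := by
    intro l
    simp only [hω, hω0T, List.mem_map, forall_exists_index, and_imp, forall_apply_eq_imp_iff₂, hNT]
  set β1 : List X → ℤ := fun l => β l - cob ω l with hβ1
  have hβ1T : ∀ l, β1 (l.map T) = β1 l := by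
    intro l
    simp only [hβ1, hβT]
    rw [← cob_map]
    simp only [hωT]
  have hβ1c : Van Set.univ (ε0 / 4) (N + 1) (cob β1) := by
    intro l h1 h2 h3
    simp only [hβ1]
    rw [cob_sub, cob_cob, hβc l h1 h2 h3]; rfl
  have hβ1N : Van Ns e1 N β1 := by
    intro l h1 h2 h3
    have hsm : ∀ l' : List X, (∀ x ∈ l', (∃ y ∈ l, x = id y) ∨ (∃ y ∈ l, x = ρ y)) →
        Sm (4 * e1) l' := by
      intro l' hl'
      refine (sm_cast (A := Ns) h3 h2 (e := e1) (fun x _ => ?_) hρd hl').mono (by linarith)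
      simpa using he1pos
    have e : cob ω l = cob ω0 l := by
      apply cob_congr
      intro l' hs' _
      simp only [hω]
      rw [if_pos (fun x hx => h2 x (hs'.subset hx))]
    simp only [hβ1]
    rw [e]
    simp only [hω0]
    rw [cob_sub, cob_map]
    have a := prh_formula id ρ β l
    have b : prh id ρ (cob β) l = 0 := by
      apply prh_zero
      intro l' hl' hx
      exact hβc l' (by omega) (by simp) ((hsm l' hx).mono he1b)
    have c := hν0 (l.map ρ) (by simpa using h1) (by
      intro x hx
      simp only [List.mem_map] at hx
      obtain ⟨y, hy, rfl⟩ := hx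
      exact hρF y (h2 y hy)) ((hsm (l.map ρ) (by
        intro x hx
        simp only [List.mem_map] at hx
        obtain ⟨y, hy, rfl⟩ := hx
        exact Or.inr ⟨y, hy, rfl⟩)).mono he1a)
    simp only [List.map_id_fun, id] at a
    simp only at c
    rw [b] at a
    linarith
  set O : Set X := {x | ∀ f ∈ F, θ' / 2 ≤ dist x f} with hO
  have hOc : IsCompact O := by
    apply IsClosed.isCompact
    have : O = ⋂ f ∈ F, {x | θ' / 2 ≤ dist x f} := by ext x; simp [hO]
    rw [this]
    exact isClosed_biInter fun f _ => isClosed_le continuous_const (continuous_id.dist continuous_const)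
  obtain ⟨η1, hη1, hdis⟩ : ∃ η1 > 0, ∀ i, ¬ p ∣ i → ∀ x ∈ O, η1 ≤ dist (T^[i] x) x := by
    have h1 : ∀ n : ℕ, ∃ η1 > 0, ∀ i < n, ¬ p ∣ i → ∀ x ∈ O, η1 ≤ dist (T^[i] x) x := by
      intro n
      induction n with
      | zero => exact ⟨1, one_pos, by simp⟩
      | succ n ih =>
        obtain ⟨d, hd, h⟩ := ih
        by_cases hpn : p ∣ n
        · refine ⟨d, hd, fun i hi hpi => ?_⟩
          rcases Nat.lt_succ_iff_lt_or_eq.1 hi with hi | rfl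
          · exact h i hi hpi
          · exact absurd hpn hpi
        · obtain ⟨d', hd', h'⟩ := hOc.exists_forall_le' (a := 0) (f := fun x => dist (T^[n] x) x)
            ((hTc.iterate n).dist continuous_id).continuousOn (by
              intro x hx
              rw [dist_pos]
              intro hfix
              have := hx x (fix_of hTp hp hpn hfix)
              rw [dist_self] at this
              linarith)
          refine ⟨min d d', lt_min hd hd', fun i hi hpi x hx => ?_⟩
          rcases Nat.lt_succ_iff_lt_or_eq.1 hi with hi | rfl
          · exact (min_le_left _ _).trans (h i hi hpi x hx)
          · exact (min_le_right _ _).trans (h' x hx)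
    obtain ⟨d, hd, h⟩ := h1 p
    refine ⟨d, hd, fun i hi x hx => ?_⟩
    have hh : ∀ z, T^[i] z = T^[i % p] z := fun z => by
      conv_lhs => rw [← Nat.mod_add_div i p, Function.iterate_add_apply,
        iter_dvd hTp (dvd_mul_right _ _)]
    rw [hh]
    refine h _ (Nat.mod_lt _ hp.pos) (fun hd => hi ?_) x hx
    exact (Nat.dvd_mod_iff dvd_rfl).1 hd
  obtain ⟨d, hd, hdη, hu3⟩ := unif hTc hTp hp.pos (e := η1 / 4) (by linarith)
  obtain ⟨t, htO, htf, htc⟩ := hOc.finite_cover_balls (e := d / 4) (by linarith)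
  obtain ⟨k, hk⟩ := induct H hTc hp hTp hcl (σ := d / 4) (η2 := η1 / 2) (by linarith) (by linarith)
    htf.toFinset (by
      intro c hc i hi x y hx hy
      have hcO := htO (htf.mem_toFinset.1 hc)
      have a1 := hdis i hi c hcO
      have a2 := hu3 i x c (by linarith)
      have := dist_triangle4 (T^[i] c) (T^[i] x) y c
      rw [dist_comm (T^[i] c) (T^[i] x)] at this
      linarith) (d / 4) (by linarith) β1 hβ1T (min (ε0 / 4) (min e1 (θ' / 2)))
      (lt_min (by linarith) (lt_min he1pos (by linarith))) (hβ1c.mono (min_le_left _ _)) (by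
      intro l h1 h3 hne' x hx
      have hxO : x ∈ O := by
        by_contra hxO
        simp only [hO, Set.mem_ofPred_eq, not_forall, not_le] at hxO
        obtain ⟨f, hf, hxf⟩ := hxO
        apply hne'
        refine hβ1N l h1 (fun y hy => ?_)
          (h3.mono ((min_le_right _ _).trans (min_le_left _ _)))
        have h4 : dist y x < θ' / 2 :=
          (h3 y hy x hx).trans_le ((min_le_right _ _).trans (min_le_right _ _))
        have h5 : dist y f < θ' := by
          have := dist_triangle y x f
          linarith
        obtain ⟨i, hi⟩ := hs y
        have h6 := hu2 i y f h5
        rw [hi, hFi f hf] at h6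
        exact ⟨f, hf, h6⟩
      have := htc hxO
      simp only [Set.mem_iUnion] at this
      obtain ⟨c, hc, hxc⟩ := this
      exact ⟨c, htf.mem_toFinset.2 hc, 0, hxc⟩)
  have hfin : Tr N Set.univ (fun l => (1 - p * k) * α l) := by
    refine ((hk.add (Tr.of_cob N Set.univ ω)).sub hβα).congr one_pos (fun l _ _ _ => ?_)
    simp only [hβ1, hβ]
    ring
  have := H.P3 _ hfin
  have h1 : (p : ℤ) ∣ 1 := ⟨k, by linarith⟩
  exact hp.one_lt.ne' (by exact_mod_cast Int.natAbs_dvd_natAbs.2 h1 |> Nat.dvd_one.1)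

end newman3
end NW

namespace NW

section chains
variable {V W : Type*}

/-- Induced map on chains. -/
def tr (q : V → W) : Ch V →ₗ[ℤ] Ch W := lin (fun l => sg (l.map q))

@[simp] theorem tr_sg (q : V → W) (l : List V) : tr q (sg l) = sg (l.map q) := by simp [tr]

theorem B_tr (q : V → W) (z : Ch V) : B (tr q z) = tr q (B z) :=
  lhom_ext_apply (B ∘ₗ tr q) (tr q ∘ₗ B) (fun l => by simp [bd_map, tr]) z

theorem tr_mem {P : List V → Prop} {Q : List W → Prop} (q : V → W)
    (h : ∀ l, P l → Q (l.map q)) {z : Ch V} (hz : z ∈ Sup P) : tr q z ∈ Sup Q :=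
  Sup_induct (tr q) _ (fun l hl => by rw [tr_sg]; exact sg_mem (h l hl)) hz

theorem tr_id (z : Ch V) : tr id z = z :=
  lhom_ext_apply (tr id) LinearMap.id (fun l => by simp) z

theorem tr_tr {U : Type*} (q : V → W) (r : W → U) (z : Ch V) : tr r (tr q z) = tr (r ∘ q) z :=
  lhom_ext_apply (tr r ∘ₗ tr q) (tr (r ∘ q)) (fun l => by simp) z

theorem prism_lin (p q : V → W) (z : Ch V) :
    B (lin (pr p q) z) + lin (pr p q) (B z) = tr q z - tr p z :=
  lhom_ext_apply (B ∘ₗ lin (pr p q) + lin (pr p q) ∘ₗ B) (tr q - tr p)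
    (fun l => by simp [prism]) z

theorem lin_mem {P : List V → Prop} {Q : List W → Prop} (T : List V → Ch W)
    (h : ∀ l, P l → T l ∈ Sup Q) {z : Ch V} (hz : z ∈ Sup P) : lin T z ∈ Sup Q :=
  Sup_induct (lin T) _ (fun l hl => by rw [lin_sg]; exact h l hl) hz

theorem Sup_inter {P Q : List V → Prop} {z : Ch V} (h1 : z ∈ Sup P) (h2 : z ∈ Sup Q) :
    z ∈ Sup (fun l => P l ∧ Q l) := by
  rw [Finsupp.mem_supported] at *
  intro l hl
  exact ⟨h1 hl, h2 hl⟩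

theorem B_mem {P : List V → Prop} {Q : List V → Prop}
    (h : ∀ l, P l → ∀ l', l'.Sublist l → l'.length + 1 = l.length → Q l')
    {z : Ch V} (hz : z ∈ Sup P) : B z ∈ Sup Q :=
  Sup_induct B _ (fun l hl => by
    rw [B_sg]; exact Sup_mono (fun l' hl' => h l hl l' hl'.1 hl'.2) (bd_mem l)) hz

/-- Recursive choice of chain-valued functions. -/
theorem exists_chain_rec (S : List V → Ch W → Ch W → Prop) :
    ∃ T : List V → Ch W, ∀ l, (∃ w, S l (lin T (bd l)) w) → S l (lin T (bd l)) (T l) := by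
  classical
  let Fx : ∀ l : List V, (∀ l' : List V, l'.length < l.length → Ch W) → Ch W := fun l rec =>
    Classical.epsilon (S l (lin (fun l' => if h : l'.length < l.length then rec l' h else 0) (bd l)))
  let T : List V → Ch W := WellFounded.fix (measure (List.length (α := V))).wf Fx
  have hT : ∀ l, T l = Fx l (fun l' _ => T l') := fun l =>
    WellFounded.fix_eq (measure (List.length (α := V))).wf Fx l
  refine ⟨T, fun l hex => ?_⟩
  have e : lin (fun l' => if h : l'.length < l.length then T l' else 0) (bd l)
      = lin T (bd l) := by
    refine Sup_eq _ _ (fun l' hl' => ?_) (bd_mem l)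
    rw [lin_sg, lin_sg, dif_pos (by omega)]
  rw [hT l]
  simp only [Fx]
  rw [e]
  exact Classical.epsilon_spec hex

end chains

/-- Hyperbolic group data. -/
structure Geo (G : Type*) [Group G] where
  D : G → G → ℕ
  δ : ℕ
  self : ∀ x, D x x = 0
  eq_of : ∀ x y, D x y = 0 → x = y
  symm : ∀ x y, D x y = D y x
  tri : ∀ x y z, D x z ≤ D x y + D y z
  inv : ∀ h x y, D (h * x) (h * y) = D x y
  fin : ∀ r, {g | D 1 g ≤ r}.Finite
  hyp : ∀ x y z w, D x y + D z w ≤ max (D x z + D y w) (D x w + D y z) + 2 * δ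
  par : G → G
  par_one : par 1 = 1
  par_len : ∀ g, g ≠ 1 → D 1 (par g) + 1 = D 1 g
  par_adj : ∀ g, g ≠ 1 → D (par g) g = 1

namespace Geo
variable {G : Type*} [Group G] (Γ : Geo G)

/-- Word length. -/
def nm (g : G) : ℕ := Γ.D 1 g

theorem nm_one : Γ.nm 1 = 0 := Γ.self 1

theorem nm_par (g : G) : Γ.nm (Γ.par g) = Γ.nm g - 1 := by
  by_cases h : g = 1
  · rw [h, Γ.par_one, nm_one]
  · have := Γ.par_len g h
    unfold nm; omega

theorem nm_anc (i : ℕ) (g : G) : Γ.nm (Γ.par^[i] g) = Γ.nm g - i := by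
  induction i with
  | zero => simp
  | succ i ih => rw [Function.iterate_succ_apply', nm_par, ih]; omega

theorem D_par (g : G) : Γ.D (Γ.par g) g ≤ 1 := by
  by_cases h : g = 1
  · rw [h, Γ.par_one, Γ.self]; omega
  · rw [Γ.par_adj g h]

theorem D_anc (i : ℕ) (g : G) : Γ.D (Γ.par^[i] g) g ≤ i := by
  induction i with
  | zero => simp [Γ.self]
  | succ i ih =>
    rw [Function.iterate_succ_apply']
    have := Γ.tri (Γ.par (Γ.par^[i] g)) (Γ.par^[i] g) g
    have := Γ.D_par (Γ.par^[i] g)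
    omega

theorem nm_le (x y : G) : Γ.nm x ≤ Γ.nm y + Γ.D x y := by
  have := Γ.tri 1 y x
  rw [Γ.symm y x] at this
  exact this

theorem push (i : ℕ) (v w : G) (hi : i ≤ Γ.nm v) :
    Γ.D (Γ.par^[i] v) w + Γ.nm v ≤ max (i + Γ.nm w) (Γ.nm v - i + Γ.D v w) + 2 * Γ.δ := by
  have h := Γ.hyp (Γ.par^[i] v) w v 1
  have h1 := Γ.D_anc i v
  have h2 := Γ.nm_anc i v
  have h3 := Γ.symm 1 (Γ.par^[i] v)
  have h4 := Γ.symm 1 v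
  have h5 := Γ.symm 1 w
  have h6 := Γ.symm v w
  unfold nm at *
  omega

/-- Simplices of the Rips complex with vertices in `Y`. -/
def PD (d : ℕ) (Y : Set G) (k : ℕ) (l : List G) : Prop :=
  l.length = k ∧ (∀ x ∈ l, x ∈ Y) ∧ ∀ x ∈ l, ∀ y ∈ l, Γ.D x y ≤ d

/-- Parent closed sets. -/
def Cl (Y : Set G) : Prop := (1 : G) ∈ Y ∧ ∀ y ∈ Y, Γ.par y ∈ Y

theorem Cl.anc {Γ : Geo G} {Y : Set G} (h : Γ.Cl Y) (i : ℕ) {y : G} (hy : y ∈ Y) :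
    Γ.par^[i] y ∈ Y := by
  induction i with
  | zero => exact hy
  | succ i ih => rw [Function.iterate_succ_apply']; exact h.2 _ ih

theorem Cl.ball {Γ : Geo G} {Y : Set G} (h : Γ.Cl Y) (R : ℕ) :
    Γ.Cl {y | y ∈ Y ∧ Γ.nm y ≤ R} := by
  refine ⟨⟨h.1, by rw [nm_one]; omega⟩, fun y hy => ⟨h.2 y hy.1, ?_⟩⟩
  rw [nm_par]; have := hy.2; omega

theorem PD.sub {Γ : Geo G} {d k : ℕ} {Y : Set G} {l l' : List G} (h : Γ.PD d Y k l)
    (hs : l'.Sublist l) : Γ.PD d Y l'.length l' :=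
  ⟨rfl, fun x hx => h.2.1 x (hs.subset hx),
    fun x hx y hy => h.2.2 x (hs.subset hx) y (hs.subset hy)⟩

theorem acyc_aux {d : ℕ} (hd : 4 * Γ.δ + 2 ≤ d) (k : ℕ) (R : ℕ) : ∀ (Y : Set G), Γ.Cl Y →
    (∀ y ∈ Y, Γ.nm y ≤ R) → ∀ z ∈ Sup (Γ.PD d Y k), B z = 0 →
    ∃ w ∈ Sup (Γ.PD d Y (k + 1)), B w = z := by
  classical
  induction R with
  | zero =>
    intro Y hY hR z hz hB
    refine ⟨cone 1 z, cone_mem 1 (fun l hl => ⟨by simp [hl.1], ?_, ?_⟩) hz, by simp [B_cone, hB]⟩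
    · simpa using ⟨hY.1, hl.2.1⟩
    · have h0 : ∀ x ∈ (1 :: l), x = 1 := by
        intro x hx
        have : x ∈ Y := by
          rcases List.mem_cons.1 hx with rfl | hx
          · exact hY.1
          · exact hl.2.1 x hx
        exact (Γ.eq_of _ _ (Nat.le_zero.1 (hR x this))).symm
      intro x hx y hy
      rw [h0 x hx, h0 y hy, Γ.self]; omega
  | succ R ih =>
    intro Y hY hR z hz hB
    by_cases hRd : R + 1 ≤ d
    · refine ⟨cone 1 z, cone_mem 1 (fun l hl => ⟨by simp [hl.1], ?_, ?_⟩) hz, by simp [B_cone, hB]⟩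
      · simpa using ⟨hY.1, hl.2.1⟩
      · intro x hx y hy
        have h1 : ∀ x ∈ l, Γ.D 1 x ≤ d := fun x hx => (hR x (hl.2.1 x hx)).trans hRd
        rcases List.mem_cons.1 hx with rfl | hx
        · rcases List.mem_cons.1 hy with rfl | hy
          · rw [Γ.self]; omega
          · exact h1 y hy
        · rcases List.mem_cons.1 hy with rfl | hy
          · rw [Γ.symm]; exact h1 x hx
          · exact hl.2.2 x hx y hy
    · set q : G → G := fun v => if Γ.nm v = R + 1 then Γ.par^[2 * Γ.δ + 1] v else v with hq
      have hqY : ∀ y ∈ Y, q y ∈ Y := by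
        intro y hy
        simp only [hq]
        split_ifs
        · exact hY.anc _ hy
        · exact hy
      have hqR : ∀ y ∈ Y, Γ.nm (q y) ≤ R := by
        intro y hy
        simp only [hq]
        have := hR y hy
        split_ifs
        · rw [nm_anc]; omega
        · omega
      have hd1 : ∀ x ∈ Y, ∀ y ∈ Y, Γ.D x y ≤ d → Γ.D (q x) y ≤ d := by
        intro x hx y hy hxy
        simp only [hq]
        split_ifs with h
        · have := Γ.push (2 * Γ.δ + 1) x y (by omega)
          have := hR y hy
          omega
        · exact hxy
      have hd2 : ∀ x ∈ Y, ∀ y ∈ Y, Γ.D x y ≤ d → Γ.D (q x) (q y) ≤ d := by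
        intro x hx y hy hxy
        have h1 := hd1 x hx y hy hxy
        rw [Γ.symm] at h1 ⊢
        exact hd1 y hy (q x) (hqY x hx) h1
      have hz' : tr q z ∈ Sup (Γ.PD d {y | y ∈ Y ∧ Γ.nm y ≤ R} k) := by
        refine tr_mem q (fun l hl => ⟨by simp [hl.1], ?_, ?_⟩) hz
        · intro x hx
          simp only [List.mem_map] at hx
          obtain ⟨x, hx, rfl⟩ := hx
          exact ⟨hqY x (hl.2.1 x hx), hqR x (hl.2.1 x hx)⟩
        · intro x hx y hy
          simp only [List.mem_map] at hx hy
          obtain ⟨x, hx, rfl⟩ := hx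
          obtain ⟨y, hy, rfl⟩ := hy
          exact hd2 x (hl.2.1 x hx) y (hl.2.1 y hy) (hl.2.2 x hx y hy)
      obtain ⟨w, hw, hBw⟩ := ih _ (hY.ball R) (fun y hy => hy.2) (tr q z) hz'
        (by rw [B_tr, hB, map_zero])
      refine ⟨w - lin (pr id q) z, Submodule.sub_mem _
        (Sup_mono (fun l hl => ⟨hl.1, fun x hx => (hl.2.1 x hx).1, hl.2.2⟩) hw) ?_, ?_⟩
      · refine lin_mem _ (fun l hl => ?_) hz
        refine Sup_mono (fun l' hl' => ⟨by rw [hl'.1, hl.1], ?_, ?_⟩) (pr_mem id q l)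
        · intro x hx
          rcases hl'.2 x hx with ⟨y, hy, h⟩ | ⟨y, hy, h⟩ <;> rw [h]
          · exact hl.2.1 y hy
          · exact hqY y (hl.2.1 y hy)
        · intro x hx y hy
          rcases hl'.2 x hx with ⟨u, hu, hxu⟩ | ⟨u, hu, hxu⟩ <;>
          rcases hl'.2 y hy with ⟨v, hv, hyv⟩ | ⟨v, hv, hyv⟩ <;> rw [hxu, hyv]
          · exact hl.2.2 u hu v hv
          · rw [Γ.symm]
            exact hd1 v (hl.2.1 v hv) u (hl.2.1 u hu) (hl.2.2 v hv u hu)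
          · exact hd1 u (hl.2.1 u hu) v (hl.2.1 v hv) (hl.2.2 u hu v hv)
          · exact hd2 u (hl.2.1 u hu) v (hl.2.1 v hv) (hl.2.2 u hu v hv)
      · have := prism_lin id q z
        rw [hB, map_zero, add_zero, tr_id] at this
        rw [map_sub, hBw, this]
        abel

theorem exists_R {P : List G → Prop} {z : Ch G} (hz : z ∈ Sup P) :
    ∃ R, z ∈ Sup (fun l => P l ∧ ∀ x ∈ l, Γ.nm x ≤ R) := by
  classical
  rw [Finsupp.mem_supported] at hz
  have hf : {x | ∃ l ∈ z.support, x ∈ l}.Finite := by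
    have : {x | ∃ l ∈ z.support, x ∈ l} = ⋃ l ∈ z.support, {x | x ∈ l} := by ext x; simp
    rw [this]
    exact z.support.finite_toSet.biUnion (fun l _ => List.finite_toSet l)
  obtain ⟨R, hR⟩ := (hf.image Γ.nm).bddAbove
  refine ⟨R, ?_⟩
  rw [Finsupp.mem_supported]
  intro l hl
  exact ⟨hz hl, fun x hx => hR ⟨x, ⟨l, hl, hx⟩, rfl⟩⟩

theorem acyc {d : ℕ} (hd : 4 * Γ.δ + 2 ≤ d) (k : ℕ) {Y : Set G} (hY : Γ.Cl Y) {z : Ch G}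
    (hz : z ∈ Sup (Γ.PD d Y k)) (hB : B z = 0) :
    ∃ w ∈ Sup (Γ.PD d Y (k + 1)), B w = z := by
  obtain ⟨R, hR⟩ := Γ.exists_R hz
  obtain ⟨w, hw, h⟩ := Γ.acyc_aux hd k R _ (hY.ball R) (fun y hy => hy.2) z
    (Sup_mono (fun l hl => ⟨hl.1.1, fun x hx => ⟨hl.1.2.1 x hx, hl.2 x hx⟩, hl.1.2.2⟩) hR) hB
  exact ⟨w, Sup_mono (fun l hl => ⟨hl.1, fun x hx => (hl.2.1 x hx).1, hl.2.2⟩) hw, h⟩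

theorem acyc_ball {d : ℕ} (hd : 4 * Γ.δ + 2 ≤ d) (k : ℕ) (h : G) (R : ℕ) {z : Ch G}
    (hz : z ∈ Sup (Γ.PD d {y | Γ.D h y ≤ R} k)) (hB : B z = 0) :
    ∃ w ∈ Sup (Γ.PD d {y | Γ.D h y ≤ R} (k + 1)), B w = z := by
  have hu : Γ.Cl Set.univ := ⟨trivial, fun _ _ => trivial⟩
  obtain ⟨w, hw, hBw⟩ := Γ.acyc hd k (hu.ball R) (z := tr (h⁻¹ * ·) z)
    (tr_mem _ (fun l hl => ⟨by simp [hl.1], by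
      intro x hx
      simp only [List.mem_map] at hx
      obtain ⟨x, hx, rfl⟩ := hx
      refine ⟨trivial, ?_⟩
      have := Γ.inv h⁻¹ h x
      rw [inv_mul_cancel] at this
      rw [nm, this]; exact hl.2.1 x hx, by
      intro x hx y hy
      simp only [List.mem_map] at hx hy
      obtain ⟨x, hx, rfl⟩ := hx
      obtain ⟨y, hy, rfl⟩ := hy
      rw [Γ.inv]; exact hl.2.2 x hx y hy⟩) hz) (by rw [B_tr, hB, map_zero])
  refine ⟨tr (h * ·) w, tr_mem _ (fun l hl => ⟨by simp [hl.1], by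
      intro x hx
      simp only [List.mem_map] at hx
      obtain ⟨x, hx, rfl⟩ := hx
      have := Γ.inv h 1 x
      rw [mul_one] at this
      show Γ.D h (h * x) ≤ R
      rw [this]; exact (hl.2.1 x hx).2, by
      intro x hx y hy
      simp only [List.mem_map] at hx hy
      obtain ⟨x, hx, rfl⟩ := hx
      obtain ⟨y, hy, rfl⟩ := hy
      rw [Γ.inv]; exact hl.2.2 x hx y hy⟩) hw, ?_⟩
  rw [B_tr, hBw, tr_tr]
  have : ((h * ·) ∘ (h⁻¹ * ·) : G → G) = id := by ext x; simp
  rw [this, tr_id]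

end Geo
end NW

namespace NW

theorem lists_finite {V : Type*} {S : Set V} (hS : S.Finite) (N : ℕ) :
    {l : List V | l.length = N ∧ ∀ x ∈ l, x ∈ S}.Finite := by
  induction N with
  | zero =>
    refine (Set.finite_singleton []).subset ?_
    rintro l ⟨h, -⟩
    exact List.eq_nil_of_length_eq_zero h
  | succ N ih =>
    refine ((hS.prod ih).image (fun p => p.1 :: p.2)).subset ?_
    rintro l ⟨h, h2⟩
    cases l with
    | nil => simp at h
    | cons a l =>
      refine ⟨(a, l), ⟨h2 a (by simp), by simpa using h, fun x hx => h2 x (by simp [hx])⟩, rfl⟩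

theorem ev_ne {V : Type*} {P : List V → Prop} (f : List V → ℤ) {z : Ch V} (hz : z ∈ Sup P)
    (h : ev f z ≠ 0) : ∃ l, P l ∧ f l ≠ 0 := by
  by_contra hc
  push Not at hc
  exact h (ev_zero_of_Sup f hc hz)

namespace Geo
variable {G : Type*} [Group G] (Γ : Geo G)

/-- Lists of diameter at most `r`. -/
def Dm (r : ℕ) (l : List G) : Prop := ∀ x ∈ l, ∀ y ∈ l, Γ.D x y ≤ r

theorem Dm.mono {Γ : Geo G} {r r' : ℕ} (h : r ≤ r') {l : List G} (hl : Γ.Dm r l) : Γ.Dm r' l :=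
  fun x hx y hy => (hl x hx y hy).trans h

theorem Dm.sub {Γ : Geo G} {r : ℕ} {l l' : List G} (hl : Γ.Dm r l) (hs : l'.Sublist l) :
    Γ.Dm r l' := fun x hx y hy => hl x (hs.subset hx) y (hs.subset hy)

theorem exists_Dm (l : List G) : ∃ r, Γ.Dm r l ∧ ∀ r', Γ.Dm r' l → r ≤ r' := by
  classical
  have h : ∃ r, Γ.Dm r l := by
    have hf : {p : G × G | p.1 ∈ l ∧ p.2 ∈ l}.Finite :=
      (List.finite_toSet l).prod (List.finite_toSet l)
    obtain ⟨R, hR⟩ := (hf.image (fun p => Γ.D p.1 p.2)).bddAbove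
    exact ⟨R, fun x hx y hy => hR ⟨(x, y), ⟨hx, hy⟩, rfl⟩⟩
  exact ⟨Nat.find h, Nat.find_spec h, fun r' hr' => Nat.find_min' h hr'⟩

theorem fill_cocycle {d : ℕ} (hd : 4 * Γ.δ + 2 ≤ d) {Y : Set G} (hY : Γ.Cl Y) (k : ℕ)
    (f : List G → ℤ) (hf : ∀ l, Γ.PD d Y (k + 1) l → cob f l = 0) :
    ∃ g : List G → ℤ, ∀ l, Γ.PD d Y k l → f l = cob g l := by
  obtain ⟨W, hW⟩ := exists_chain_rec (V := G) (W := G) (fun l c w =>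
    w ∈ Sup (Γ.PD d Y (l.length + 1)) ∧ B w = sg l - c)
  have key : ∀ n, ∀ l, Γ.PD d Y n l →
      W l ∈ Sup (Γ.PD d Y (l.length + 1)) ∧ B (W l) = sg l - lin W (bd l) := by
    intro n
    induction n with
    | zero =>
      intro l hl
      apply hW
      apply Γ.acyc hd l.length hY
      · rw [List.eq_nil_of_length_eq_zero hl.1]
        simp only [bd, map_zero, sub_zero]
        exact sg_mem ⟨rfl, by simp, by simp⟩
      · rw [List.eq_nil_of_length_eq_zero hl.1]
        simp [bd]
    | succ n ih =>
      intro l hl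
      apply hW
      have hbd : bd l ∈ Sup (Γ.PD d Y n) := by
        refine Sup_mono (fun l' hl' => ?_) (bd_mem l)
        have := hl.sub hl'.1
        have e : l'.length = n := by have := hl.1; omega
        rwa [e] at this
      apply Γ.acyc hd l.length hY
      · refine Submodule.sub_mem _ (sg_mem ⟨rfl, hl.2⟩) (lin_mem _ (fun l' hl' => ?_) hbd)
        have := (ih l' hl').1
        have e : l'.length + 1 = l.length := by have := hl.1; have := hl'.1; omega
        rwa [e] at this
      · have h2 : (B ∘ₗ lin W) (bd l) = (LinearMap.id - lin W ∘ₗ B : Ch G →ₗ[ℤ] Ch G) (bd l) :=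
          Sup_eq _ _ (fun l' hl' => by simp [(ih l' hl').2]) hbd
        simp only [LinearMap.comp_apply, LinearMap.sub_apply, LinearMap.id_apply, B_bd,
          map_zero, sub_zero] at h2
        rw [map_sub, h2, B_sg, sub_self]
  refine ⟨fun l => ev f (W l), fun l hl => ?_⟩
  obtain ⟨h1, h2⟩ := key k l hl
  rw [cob_pull]
  have h3 : lin W (bd l) = sg l - B (W l) := by rw [h2]; abel
  rw [h3, map_sub, ev_sg, ev_B, ev_zero_of_Sup (cob f) _ h1]
  · ring
  · intro l' hl'
    rw [hl.1] at hl'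
    exact hf l' hl'

theorem exists_Psi {d : ℕ} (hd : 4 * Γ.δ + 2 ≤ d) : ∃ Ψ : List G → Ch G,
    (∀ l, Γ.Dm d l → Ψ l = sg l) ∧ (∀ l, B (Ψ l) = lin Ψ (bd l)) ∧
    (∀ l r, Γ.Dm r l → ∀ a ∈ l.head?, Ψ l ∈ Sup (Γ.PD d {y | Γ.D a y ≤ l.length * r} l.length)) := by
  classical
  obtain ⟨Ψ, hΨ⟩ := exists_chain_rec (V := G) (W := G) (fun l c w =>
    (Γ.Dm d l → w = sg l) ∧ B w = c ∧ ∀ r, Γ.Dm r l → ∀ a ∈ l.head?,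
      w ∈ Sup (Γ.PD d {y | Γ.D a y ≤ l.length * r} l.length))
  have key : ∀ n, ∀ l : List G, l.length = n → (Γ.Dm d l → Ψ l = sg l) ∧ B (Ψ l) = lin Ψ (bd l) ∧
      ∀ r, Γ.Dm r l → ∀ a ∈ l.head?,
      Ψ l ∈ Sup (Γ.PD d {y | Γ.D a y ≤ l.length * r} l.length) := by
    intro n
    induction n with
    | zero =>
      intro l hl
      obtain rfl := List.eq_nil_of_length_eq_zero hl
      apply hΨ
      exact ⟨sg [], fun _ => rfl, by simp [bd], by simp⟩
    | succ n ih =>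
      intro l hl
      apply hΨ
      by_cases hdm : Γ.Dm d l
      · refine ⟨sg l, fun _ => rfl, ?_, ?_⟩
        · rw [B_sg]
          refine Sup_eq LinearMap.id _ (fun l' hl' => ?_) (bd_mem l)
          rw [lin_sg, (ih l' (by omega)).1 (hdm.sub hl'.1)]
          rfl
        · intro r hr a ha
          refine sg_mem ⟨rfl, fun x hx => ?_, hdm⟩
          have := hr a (List.mem_of_mem_head? ha) x hx
          show Γ.D a x ≤ l.length * r
          rw [hl]
          exact this.trans (Nat.le_mul_of_pos_left r (by omega))
      · obtain ⟨r, hr, hrmin⟩ := Γ.exists_Dm l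
        cases l with
        | nil => simp at hl
        | cons a l =>
        simp only [List.length_cons, Nat.add_right_cancel_iff] at hl
        have hnpos : 1 ≤ n := by
          by_contra hn
          have : l = [] := List.eq_nil_of_length_eq_zero (by omega)
          subst this
          exact hdm (fun x hx y hy => by
            simp only [List.mem_singleton] at hx hy
            rw [hx, hy, Γ.self]; omega)
        have hz : lin Ψ (bd (a :: l)) ∈ Sup (Γ.PD d {y | Γ.D a y ≤ (a :: l).length * r} n) := by
          refine lin_mem _ (fun l' hl' => ?_) (bd_mem (a :: l))
          have hlen : l'.length = n := by have := hl'.2; simp at this; omega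
          cases l' with
          | nil => simp at hlen; omega
          | cons b l' =>
          have := (ih (b :: l') hlen).2.2 r (hr.sub hl'.1) b (by simp)
          rw [hlen] at this
          refine Sup_mono (fun l'' hl'' => ⟨hl''.1, fun x hx => ?_, hl''.2.2⟩) this
          have h1 := hl''.2.1 x hx
          have h2 := hr a (by simp) b (hl'.1.subset (by simp))
          have h3 := Γ.tri a b x
          simp only [List.length_cons, Set.mem_ofPred_eq] at h1 ⊢
          rw [hl]
          calc Γ.D a x ≤ r + n * r := by omega
            _ = (n + 1) * r := by ring
        have hB : B (lin Ψ (bd (a :: l))) = 0 := by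
          have h2 : (B ∘ₗ lin Ψ) (bd (a :: l)) = (lin Ψ ∘ₗ B) (bd (a :: l)) :=
            Sup_eq _ _ (fun l' hl' => by
              simp [(ih l' (by have := hl'.2; simp at this; omega)).2.1]) (bd_mem (a :: l))
          simpa [B_bd] using h2
        obtain ⟨w, hw, hBw⟩ := Γ.acyc_ball hd n a _ hz hB
        refine ⟨w, fun h => absurd h hdm, hBw, ?_⟩
        intro r' hr' b hb
        simp only [List.head?_cons, Option.mem_def, Option.some.injEq] at hb
        subst hb
        refine Sup_mono (fun l' hl' => ⟨by simp [hl'.1, hl], fun x hx => ?_, hl'.2.2⟩) hw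
        exact (hl'.2.1 x hx).trans (Nat.mul_le_mul_left _ (hrmin r' hr'))
  exact ⟨Ψ, fun l => (key _ l rfl).1, fun l => (key _ l rfl).2.1, fun l => (key _ l rfl).2.2⟩

/-- A cone homotopy from any augmentation preserving chain map to the identity. -/
theorem exists_E (Ψ : List G → Ch G) (h0 : Ψ [] = sg []) (hB : ∀ l, B (Ψ l) = lin Ψ (bd l))
    (hs : ∀ l r, Γ.Dm r l → ∀ a ∈ l.head?, Ψ l ∈ Sup (fun l' => l'.length = l.length ∧
      ∀ y ∈ l', Γ.D a y ≤ l.length * r)) :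
    ∃ E : List G → Ch G, (∀ l, B (E l) = sg l - Ψ l - lin E (bd l)) ∧
      (∀ l r, Γ.Dm r l → ∀ a ∈ l.head?, E l ∈ Sup (fun l' => l'.length = l.length + 1 ∧
      ∀ y ∈ l', Γ.D a y ≤ l.length * r)) := by
  obtain ⟨E, hE⟩ := exists_chain_rec (V := G) (W := G) (fun l c w =>
    (l = [] → w = 0) ∧ ∀ a ∈ l.head?, w = cone a (sg l - Ψ l - c))
  have hE' : ∀ l, (l = [] → E l = 0) ∧ ∀ a ∈ l.head?, E l = cone a (sg l - Ψ l - lin E (bd l)) := by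
    intro l
    apply hE
    cases l with
    | nil => exact ⟨0, by simp⟩
    | cons a l => exact ⟨cone a (sg (a :: l) - Ψ (a :: l) - lin E (bd (a :: l))), by simp⟩
  refine ⟨E, ?_, ?_⟩
  · have key : ∀ n, ∀ l : List G, l.length = n → B (E l) = sg l - Ψ l - lin E (bd l) := by
      intro n
      induction n with
      | zero =>
        intro l hl
        obtain rfl := List.eq_nil_of_length_eq_zero hl
        rw [(hE' []).1 rfl, h0]
        simp [bd]
      | succ n ih =>
        intro l hl
        cases l with
        | nil => simp at hl
        | cons a l =>
        rw [(hE' (a :: l)).2 a (by simp), B_cone]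
        have h2 : (B ∘ₗ lin E) (bd (a :: l)) =
            (LinearMap.id - lin Ψ - lin E ∘ₗ B : Ch G →ₗ[ℤ] Ch G) (bd (a :: l)) :=
          Sup_eq _ _ (fun l' hl' => by
            simp [ih l' (by have := hl'.2; simp at this hl; omega)]) (bd_mem (a :: l))
        simp only [LinearMap.comp_apply, LinearMap.sub_apply, LinearMap.id_apply, B_bd,
          map_zero, sub_zero] at h2
        simp only [map_sub, B_sg, hB, h2]
        simp
    exact fun l => key _ l rfl
  · have key : ∀ n, ∀ l : List G, l.length = n → ∀ r, Γ.Dm r l → ∀ a ∈ l.head?,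
        E l ∈ Sup (fun l' => l'.length = l.length + 1 ∧ ∀ y ∈ l', Γ.D a y ≤ l.length * r) := by
      intro n
      induction n with
      | zero =>
        intro l hl
        obtain rfl := List.eq_nil_of_length_eq_zero hl
        simp
      | succ n ih =>
        intro l hl r hr a ha
        rw [(hE' l).2 a ha]
        refine cone_mem (P := fun l' => l'.length = l.length ∧ ∀ y ∈ l', Γ.D a y ≤ l.length * r) a
          (fun l' hl' => ⟨by simp [hl'.1], fun y hy => (List.mem_cons.1 hy).elim
            (fun h => by rw [h, Γ.self]; omega) (fun h => hl'.2 y h)⟩) ?_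
        · refine Submodule.sub_mem _ (Submodule.sub_mem _ (sg_mem ⟨rfl, ?_⟩) (hs l r hr a ha)) ?_
          · intro y hy
            have := hr a (List.mem_of_mem_head? ha) y hy
            rw [hl]
            exact this.trans (Nat.le_mul_of_pos_left r (by omega))
          · refine lin_mem _ (fun l' hl' => ?_) (bd_mem l)
            have hlen : l'.length = n := by omega
            cases l' with
            | nil => rw [(hE' []).1 rfl]; exact Submodule.zero_mem _
            | cons b l' =>
            have h1 := ih (b :: l') hlen r (hr.sub hl'.1) b (by simp)
            rw [hlen] at h1
            refine Sup_mono (fun l'' hl'' => ⟨by omega, fun x hx => ?_⟩) h1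
            have h4 := hl''.2 x hx
            have h2 := hr a (List.mem_of_mem_head? ha) b (hl'.1.subset (by simp))
            have h3 := Γ.tri a b x
            rw [hl]
            calc Γ.D a x ≤ r + n * r := by omega
              _ = (n + 1) * r := by ring
    exact fun l => key _ l rfl

/-- Finite support at every scale. -/
def SF (c : List G → ℤ) (N : ℕ) : Prop :=
  ∀ r, {l : List G | l.length = N ∧ Γ.Dm r l ∧ c l ≠ 0}.Finite

theorem ball_finite (a : G) (r : ℕ) : {g | Γ.D a g ≤ r}.Finite := by
  refine ((Γ.fin r).image (a * ·)).subset ?_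
  intro g hg
  refine ⟨a⁻¹ * g, ?_, by simp⟩
  have := Γ.inv a 1 (a⁻¹ * g)
  rw [mul_one, mul_inv_cancel_left] at this
  show Γ.D 1 (a⁻¹ * g) ≤ r
  rw [← this]; exact hg

theorem nbhd_finite {S : Set G} (hS : S.Finite) (r : ℕ) : {g | ∃ a ∈ S, Γ.D a g ≤ r}.Finite := by
  have : {g | ∃ a ∈ S, Γ.D a g ≤ r} = ⋃ a ∈ S, {g | Γ.D a g ≤ r} := by ext; simp
  rw [this]
  exact hS.biUnion fun a _ => Γ.ball_finite a r

theorem verts_finite {S : Set (List G)} (hS : S.Finite) : {g : G | ∃ l ∈ S, g ∈ l}.Finite := by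
  have : {g : G | ∃ l ∈ S, g ∈ l} = ⋃ l ∈ S, {g | g ∈ l} := by ext; simp
  rw [this]
  exact hS.biUnion fun l _ => List.finite_toSet l

theorem pull_finite {S : Set (List G)} (hS : S.Finite) (N r ρ : ℕ) :
    {l : List G | l.length = N ∧ Γ.Dm r l ∧ ∃ a ∈ l, ∃ l' ∈ S, ∃ b ∈ l', Γ.D a b ≤ ρ}.Finite := by
  refine (lists_finite (Γ.nbhd_finite (verts_finite hS) (ρ + r)) N).subset ?_
  rintro l ⟨h1, h2, a, ha, l', hl', b, hb, hab⟩
  refine ⟨h1, fun x hx => ⟨b, ⟨l', hl', hb⟩, ?_⟩⟩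
  have := h2 a ha x hx
  have := Γ.tri b a x
  rw [Γ.symm b a] at this
  omega

theorem SF_pull {c : List G → ℤ} {N M : ℕ} (hN : 1 ≤ N) (hM : 1 ≤ M) (hc : Γ.SF c M)
    (T : List G → Ch G) (ρ : ℕ → ℕ)
    (hT : ∀ l r, l.length = N → Γ.Dm r l → ∀ a ∈ l.head?, T l ∈ Sup (fun l' => l'.length = M ∧
      ∀ y ∈ l', Γ.D a y ≤ ρ r)) : Γ.SF (fun l => ev c (T l)) N := by
  intro r
  refine (Γ.pull_finite (hc (2 * ρ r)) N r (ρ r)).subset ?_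
  rintro l ⟨h1, h2, h3⟩
  refine ⟨h1, h2, ?_⟩
  cases l with
  | nil => simp at h1; omega
  | cons a l =>
  obtain ⟨l', hl', hne⟩ := ev_ne c (hT (a :: l) r h1 h2 a (by simp)) h3
  obtain ⟨b, hb⟩ : ∃ b, b ∈ l' := List.exists_mem_of_length_pos (by omega)
  refine ⟨a, by simp, l', ⟨hl'.1, fun x hx y hy => ?_, hne⟩, b, hb, hl'.2 b hb⟩
  have h4 := hl'.2 x hx
  have h5 := hl'.2 y hy
  have := Γ.tri x a y
  rw [Γ.symm x a] at this
  omega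

end Geo
end NW

namespace NW

/-- A cone homotopy from any augmentation preserving chain map to the identity, carried by
vertices. -/
theorem exists_Dhom {V : Type*} (Ψ : List V → Ch V) (h0 : Ψ [] = sg [])
    (hB : ∀ l, B (Ψ l) = lin Ψ (bd l))
    (hs : ∀ l, Ψ l ∈ Sup (fun l' => l'.length = l.length ∧ ∀ y ∈ l', y ∈ l)) :
    ∃ E : List V → Ch V, (∀ l, B (E l) = sg l - Ψ l - lin E (bd l)) ∧
      (∀ l, E l ∈ Sup (fun l' => l'.length = l.length + 1 ∧ ∀ y ∈ l', y ∈ l)) := by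
  obtain ⟨E, hE⟩ := exists_chain_rec (V := V) (W := V) (fun l c w =>
    (l = [] → w = 0) ∧ ∀ a ∈ l.head?, w = cone a (sg l - Ψ l - c))
  have hE' : ∀ l, (l = [] → E l = 0) ∧ ∀ a ∈ l.head?, E l = cone a (sg l - Ψ l - lin E (bd l)) := by
    intro l
    apply hE
    cases l with
    | nil => exact ⟨0, by simp⟩
    | cons a l => exact ⟨cone a (sg (a :: l) - Ψ (a :: l) - lin E (bd (a :: l))), by simp⟩
  refine ⟨E, ?_, ?_⟩
  · have key : ∀ n, ∀ l : List V, l.length = n → B (E l) = sg l - Ψ l - lin E (bd l) := by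
      intro n
      induction n with
      | zero =>
        intro l hl
        obtain rfl := List.eq_nil_of_length_eq_zero hl
        rw [(hE' []).1 rfl, h0]
        simp [bd]
      | succ n ih =>
        intro l hl
        cases l with
        | nil => simp at hl
        | cons a l =>
        rw [(hE' (a :: l)).2 a (by simp), B_cone]
        have h2 : (B ∘ₗ lin E) (bd (a :: l)) =
            (LinearMap.id - lin Ψ - lin E ∘ₗ B : Ch V →ₗ[ℤ] Ch V) (bd (a :: l)) :=
          Sup_eq _ _ (fun l' hl' => by
            simp [ih l' (by have := hl'.2; simp at this hl; omega)]) (bd_mem (a :: l))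
        simp only [LinearMap.comp_apply, LinearMap.sub_apply, LinearMap.id_apply, B_bd,
          map_zero, sub_zero] at h2
        simp only [map_sub, B_sg, hB, h2]
        simp
    exact fun l => key _ l rfl
  · have key : ∀ n, ∀ l : List V, l.length = n → 
        E l ∈ Sup (fun l' => l'.length = l.length + 1 ∧ ∀ y ∈ l', y ∈ l) := by
      intro n
      induction n with
      | zero =>
        intro l hl
        obtain rfl := List.eq_nil_of_length_eq_zero hl
        rw [(hE' []).1 rfl]
        exact Submodule.zero_mem _
      | succ n ih =>
        intro l hl
        cases l with
        | nil => simp at hl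
        | cons a l =>
        rw [(hE' (a :: l)).2 a (by simp)]
        refine cone_mem (P := fun l' => l'.length = (a :: l).length ∧ ∀ y ∈ l', y ∈ a :: l) a
          (fun l' hl' => ⟨by simp [hl'.1], fun y hy => (List.mem_cons.1 hy).elim
            (fun h => by simp [h]) (fun h => hl'.2 y h)⟩) ?_
        refine Submodule.sub_mem _ (Submodule.sub_mem _ (sg_mem ⟨rfl, fun y hy => hy⟩)
          (hs (a :: l))) ?_
        refine lin_mem _ (fun l' hl' => ?_) (bd_mem (a :: l))
        refine Sup_mono (fun l'' hl'' => ⟨by omega, fun x hx => hl'.1.subset (hl''.2 x hx)⟩)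
          (ih l' (by have := hl'.2; omega))
    exact fun l => key _ l rfl

/-- strict cone -/
def sc {V : Type*} [DecidableEq V] (m : V) : List V → Ch V :=
  fun l => if l.head? = some m then 0 else sg (m :: l)

theorem sc_cone {V : Type*} [DecidableEq V] (m : V) (z : Ch V) : lin (sc m) (cone m z) = 0 := by
  have := lhom_ext_apply (lin (sc m) ∘ₗ cone m) (0 : Ch V →ₗ[ℤ] Ch V) (fun l => by simp [sc]) z
  simpa using this

theorem B_sc {V : Type*} [DecidableEq V] (m : V) (l : List V)
    (h : m ∈ l → l.head? = some m) (hn : l.Nodup) : B (sc m l) = sg l - lin (sc m) (bd l) := by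
  by_cases hm : l.head? = some m
  · cases l with
    | nil => simp at hm
    | cons a l =>
    simp only [List.head?_cons, Option.some.injEq] at hm
    subst hm
    have hnot : l.head? ≠ some a := fun h' => by
      have := List.mem_of_mem_head? h'
      simp_all
    simp [sc, bd, sc_cone, hnot]
  · have hml : m ∉ l := fun h' => hm (h h')
    have : lin (sc m) (bd l) = cone m (bd l) :=
      Sup_eq (lin (sc m)) (cone m) (fun l' hl' => by
        have : l'.head? ≠ some m := fun h' => hml (hl'.1.subset (List.mem_of_mem_head? h'))
        simp [sc, this]) (bd_mem l)
    rw [this]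
    simp [sc, hm, bd]

theorem sc_mem {V : Type*} [LinearOrder V] (m : V) (S : Set V) (hm : m ∈ S)
    (hmin : ∀ x ∈ S, m ≤ x) (n : ℕ) (l : List V) (h : l.length = n ∧ l.Pairwise (· < ·) ∧ ∀ y ∈ l, y ∈ S) :
    sc m l ∈ Sup (fun l' : List V => l'.length = n + 1 ∧ l'.Pairwise (· < ·) ∧ ∀ y ∈ l', y ∈ S) := by
  by_cases hh : l.head? = some m
  · simp [sc, hh]
  · rw [sc, if_neg hh]
    refine sg_mem ⟨by simp [h.1], List.pairwise_cons.2 ⟨fun x hx => ?_, h.2.1⟩, ?_⟩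
    · refine lt_of_le_of_ne (hmin x (h.2.2 x hx)) ?_
      rintro rfl
      cases l with
      | nil => simp at hx
      | cons a l =>
      have h1 := hmin a (h.2.2 a (by simp))
      rcases List.mem_cons.1 hx with h3 | h3
      · exact hh (by simp [h3])
      · have := (List.pairwise_cons.1 h.2.1).1 m h3
        exact absurd this (not_lt.2 h1)
    · intro y hy
      rcases List.mem_cons.1 hy with h' | h'
      · rw [h']; exact hm
      · exact h.2.2 y h'

theorem head_of_min {V : Type*} [LinearOrder V] {m : V} {l : List V}
    (hl : l.Pairwise (· < ·)) (hmin : ∀ x ∈ l, m ≤ x) (hm : m ∈ l) : l.head? = some m := by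
  cases l with
  | nil => simp at hm
  | cons a l =>
  rcases List.mem_cons.1 hm with h | h
  · simp [h]
  · exact absurd ((List.pairwise_cons.1 hl).1 m h) (not_lt.2 (hmin a (by simp)))

theorem exists_sort (V : Type*) [LinearOrder V] : ∃ a : List V → Ch V, a [] = sg [] ∧
    (∀ l, B (a l) = lin a (bd l)) ∧
    (∀ l, a l ∈ Sup (fun l' => l'.length = l.length ∧ l'.Pairwise (· < ·) ∧ ∀ y ∈ l', y ∈ l)) := by
  obtain ⟨a, ha⟩ := exists_chain_rec (V := V) (W := V) (fun l c w =>
    (l = [] → w = sg []) ∧ B w = c ∧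
    w ∈ Sup (fun l' => l'.length = l.length ∧ l'.Pairwise (· < ·) ∧ ∀ y ∈ l', y ∈ l))
  have key : ∀ n, ∀ l : List V, l.length = n → (l = [] → a l = sg []) ∧ B (a l) = lin a (bd l) ∧
    a l ∈ Sup (fun l' => l'.length = l.length ∧ l'.Pairwise (· < ·) ∧ ∀ y ∈ l', y ∈ l) := by
    intro n
    induction n with
    | zero =>
      intro l hl
      obtain rfl := List.eq_nil_of_length_eq_zero hl
      apply ha
      exact ⟨sg [], fun _ => rfl, by simp [bd], sg_mem (by simp)⟩
    | succ n ih =>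
      intro l hl
      apply ha
      have hz : lin a (bd l) ∈ Sup (fun l' => l'.length = n ∧ l'.Pairwise (· < ·) ∧
          ∀ y ∈ l', y ∈ {y | y ∈ l}) := by
        refine lin_mem _ (fun l' hl' => ?_) (bd_mem l)
        refine Sup_mono (fun l'' hl'' => ?_) (ih l' (by omega)).2.2
        exact ⟨by omega, hl''.2.1, fun y hy => hl'.1.subset (hl''.2.2 y hy)⟩
      have hB : B (lin a (bd l)) = 0 := by
        have h2 : (B ∘ₗ lin a) (bd l) = (lin a ∘ₗ B) (bd l) :=
          Sup_eq _ _ (fun l' hl' => by simp [(ih l' (by omega)).2.1]) (bd_mem l)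
        simpa [B_bd] using h2
      obtain ⟨m, hm, hmin⟩ : ∃ m ∈ l, ∀ x ∈ l, m ≤ x := by
        have hne : l.toFinset.Nonempty := by
          obtain ⟨x, hx⟩ : ∃ x, x ∈ l := List.exists_mem_of_length_pos (by omega)
          exact ⟨x, by simpa using hx⟩
        obtain ⟨m, hm, h⟩ := Finset.exists_min_image l.toFinset id hne
        exact ⟨m, by simpa using hm, fun x hx => h x (by simpa using hx)⟩
      refine ⟨lin (sc m) (lin a (bd l)), fun h => by simp [h] at hl, ?_, ?_⟩
      · have h2 : (B ∘ₗ lin (sc m)) (lin a (bd l)) =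
            (LinearMap.id - lin (sc m) ∘ₗ B : Ch V →ₗ[ℤ] Ch V) (lin a (bd l)) :=
          Sup_eq _ _ (fun l' hl' => by
            simp only [LinearMap.comp_apply, LinearMap.sub_apply, LinearMap.id_apply, B_sg, lin_sg]
            exact B_sc m l' (head_of_min hl'.2.1 (fun x hx => hmin x (hl'.2.2 x hx)))
              (hl'.2.1.imp (fun h => ne_of_lt h))) hz
        simp only [LinearMap.comp_apply, LinearMap.sub_apply, LinearMap.id_apply, hB,
          map_zero, sub_zero] at h2
        exact h2
      · rw [hl]
        exact lin_mem _ (fun l' hl' => sc_mem m {y | y ∈ l} hm hmin n l' hl') hz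
  exact ⟨a, (key 0 [] rfl).1 rfl, fun l => (key _ l rfl).2.1, fun l => (key _ l rfl).2.2⟩

theorem sort_dup {V : Type*} [LinearOrder V] {a : List V → Ch V}
    (ha : ∀ l, a l ∈ Sup (fun l' => l'.length = l.length ∧ l'.Pairwise (· < ·) ∧ ∀ y ∈ l', y ∈ l))
    {l : List V} (hl : ¬ l.Nodup) : a l = 0 := by
  have h : a l ∈ Sup (fun _ : List V => False) := by
    refine Sup_mono (fun l' hl' => ?_) (ha l)
    apply hl
    have hn : l'.Nodup := hl'.2.1.imp (fun h => ne_of_lt h)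
    have h1 : l'.toFinset ⊆ l.toFinset := fun x hx => by
      simp only [List.mem_toFinset] at hx ⊢
      exact hl'.2.2 x hx
    have h2 := Finset.card_le_card h1
    rw [List.toFinset_card_of_nodup hn, hl'.1] at h2
    have := List.toFinset_card_le l
    rw [← Multiset.coe_nodup, ← Multiset.toFinset_card_eq_card_iff_nodup]
    simp only [Multiset.coe_card]
    exact le_antisymm this h2
  have := Sup_eq LinearMap.id 0 (fun l hl => hl.elim) h
  simpa using this

/-- The sorting chain map, with homotopy. -/
theorem exists_sortmap (V : Type*) : ∃ a D : List V → Ch V,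
    (∀ l, B (a l) = lin a (bd l)) ∧
    (∀ l, a l ∈ Sup (fun l' => l'.length = l.length ∧ l'.Nodup ∧ ∀ y ∈ l', y ∈ l)) ∧
    (∀ l, ¬ l.Nodup → a l = 0) ∧
    (∀ l, B (D l) = sg l - a l - lin D (bd l)) ∧
    (∀ l, D l ∈ Sup (fun l' => l'.length = l.length + 1 ∧ ∀ y ∈ l', y ∈ l)) := by
  classical
  let _ : LinearOrder V := linearOrderOfSTO WellOrderingRel
  obtain ⟨a, h0, h1, h2⟩ := exists_sort V
  obtain ⟨D, hD1, hD2⟩ := exists_Dhom a h0 h1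
    (fun l => Sup_mono (fun l' hl' => ⟨hl'.1, hl'.2.2⟩) (h2 l))
  refine ⟨a, D, h1, fun l => Sup_mono (fun l' hl' => ⟨hl'.1, ?_, hl'.2.2⟩) (h2 l),
    fun l hl => sort_dup h2 hl, hD1, hD2⟩
  exact hl'.2.1.imp (fun h => ne_of_lt h)

end NW

namespace NW
open CategoryTheory groupCohomology

theorem π_zero_iff {G : Type} [Group G] (A : Rep.{0} ℤ G) (k : ℕ) (x : cocycles A (k+1)) 
    (hx : π A (k+1) x = 0) : ∃ y : (Fin k → G) → A, inhomogeneousCochains.d A k y = iCocycles A (k+1) x := by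
  have hex : (ShortComplex.mk _ _ ((inhomogeneousCochains A).toCycles_comp_homologyπ k (k+1))).Exact :=
    ShortComplex.exact_of_g_is_cokernel _ ((inhomogeneousCochains A).homologyIsCokernel k (k+1) (by simp))
  rw [ShortComplex.moduleCat_exact_iff] at hex
  obtain ⟨y, hy⟩ := hex x hx
  refine ⟨y, ?_⟩
  have hy : toCocycles A k (k+1) y = x := hy
  rw [← hy, ← ConcreteCategory.comp_apply, HomologicalComplex.toCycles_i, inhomogeneousCochains.d_def]

theorem π_zero_of {G : Type} [Group G] (A : Rep.{0} ℤ G) (k : ℕ) (x : cocycles A (k+1)) 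
    (y : (Fin k → G) → A) (h : inhomogeneousCochains.d A k y = iCocycles A (k+1) x) : π A (k+1) x = 0 := by
  have : toCocycles A k (k+1) y = x := by
    apply (ModuleCat.mono_iff_injective (iCocycles A (k+1))).1 inferInstance
    rw [← ConcreteCategory.comp_apply, HomologicalComplex.toCycles_i, inhomogeneousCochains.d_def]
    exact h
  have h2 := (inhomogeneousCochains A).toCycles_comp_homologyπ k (k+1)
  have h3 := ConcreteCategory.congr_hom h2 y
  rw [← this]
  exact h3

theorem gc_zero {G : Type} [Group G] (A : Rep.{0} ℤ G) (k : ℕ) [Subsingleton (groupCohomology A (k+1))]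
    (f : (Fin (k+1) → G) → A) (hf : inhomogeneousCochains.d A (k+1) f = 0) :
    ∃ y : (Fin k → G) → A, inhomogeneousCochains.d A k y = f := by
  obtain ⟨y, hy⟩ := π_zero_iff A k (cocyclesMk f hf) (Subsingleton.elim _ _)
  exact ⟨y, by rw [hy, iCocycles_mk]⟩

theorem πsurj {G : Type} [Group G] (A : Rep.{0} ℤ G) (k : ℕ) (x : groupCohomology A k) :
    ∃ y, π A k y = x := groupCohomology_induction_on x (fun y => ⟨y, rfl⟩)

theorem gc_one {G : Type} [Group G] (A : Rep.{0} ℤ G) (k : ℕ) (φ : groupCohomology A (k+1) ≃ₗ[ℤ] ℤ) :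
    ∃ f0 : (Fin (k+1) → G) → A, inhomogeneousCochains.d A (k+1) f0 = 0 ∧
      (∀ f : (Fin (k+1) → G) → A, inhomogeneousCochains.d A (k+1) f = 0 → ∃ (j : ℤ) (y : (Fin k → G) → A),
        f = j • f0 + inhomogeneousCochains.d A k y) ∧
      (∀ (j : ℤ) (y : (Fin k → G) → A), j • f0 = inhomogeneousCochains.d A k y → j = 0) := by
  have hd : ∀ x, inhomogeneousCochains.d A (k+1) (iCocycles A (k+1) x) = 0 := by
    intro x
    rw [← inhomogeneousCochains.d_def, ← ConcreteCategory.comp_apply, HomologicalComplex.iCycles_d]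
    rfl
  obtain ⟨x0, hx0⟩ := πsurj A (k+1) (φ.symm 1)
  refine ⟨iCocycles A (k+1) x0, hd x0, fun f hf => ?_, fun j y h => ?_⟩
  · refine ⟨φ (π A (k+1) (cocyclesMk f hf)), ?_⟩
    obtain ⟨y, hy⟩ := π_zero_iff A k (cocyclesMk f hf - φ (π A (k+1) (cocyclesMk f hf)) • x0) (by
      rw [map_sub, map_zsmul, hx0, ← map_zsmul, zsmul_one, Int.cast_id, LinearEquiv.symm_apply_apply, sub_self])
    refine ⟨y, ?_⟩
    rw [hy, map_sub, map_zsmul, iCocycles_mk]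
    abel
  · have h1 := π_zero_of A k (j • x0) y (by rw [map_zsmul, h])
    rw [map_zsmul, hx0, ← map_zsmul] at h1
    simpa using h1

end NW

namespace NW
open CategoryTheory groupCohomology

section
variable {G : Type} [Group G]

/-- homogeneous list -/
def Lst {k : ℕ} (y : G) (g : Fin k → G) : List G := List.ofFn (fun i => y⁻¹ * Fin.partialProd g i)

theorem Lst_length {k : ℕ} (y : G) (g : Fin k → G) : (Lst y g).length = k + 1 := by simp [Lst]

theorem Lst_inj {k : ℕ} {y y' : G} {g g' : Fin k → G} (h : Lst y g = Lst y' g') : y = y' ∧ g = g' := by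
  have h1 := List.ofFn_injective h
  have h2 := congrFun h1 0
  simp only [Fin.partialProd_zero, mul_one, inv_inj] at h2
  subst h2
  refine ⟨rfl, funext fun i => ?_⟩
  have e : ∀ j, Fin.partialProd g j = Fin.partialProd g' j := fun j => mul_left_cancel (congrFun h1 j)
  rw [← Fin.partialProd_right_inv g i, ← Fin.partialProd_right_inv g' i, e, e]

theorem Lst_surj {k : ℕ} (l : List G) (hl : l.length = k + 1) : ∃ (y : G) (g : Fin k → G),
    l = Lst y g ∧ ∀ i, ∃ a ∈ l, ∃ b ∈ l, g i = a⁻¹ * b := by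
  obtain ⟨f, rfl⟩ : ∃ f : Fin (k+1) → G, l = List.ofFn f := by
    refine ⟨fun i => l.get (i.cast hl.symm), ?_⟩
    apply List.ext_get
    · simp [hl]
    · intro n h1 h2
      simp [-List.ofFn_succ]
  refine ⟨(f 0)⁻¹, fun i => (f i.castSucc)⁻¹ * f i.succ, ?_, ?_⟩
  · have := Fin.partialProd_left_inv f
    unfold Lst
    congr 1
    funext i
    have h2 := congrFun this i
    rw [Pi.smul_apply, smul_eq_mul] at h2
    rw [inv_inv, h2]
  · exact fun i => ⟨f i.castSucc, List.mem_ofFn.2 ⟨_, rfl⟩, f i.succ, List.mem_ofFn.2 ⟨_, rfl⟩, rfl⟩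

theorem eraseIdx_ofFn {V : Type*} {k : ℕ} (f : Fin (k+1) → V) (i : Fin (k+1)) :
    (List.ofFn f).eraseIdx i = List.ofFn (fun j => f (i.succAbove j)) := by
  apply List.ext_getElem
  · rw [List.length_eraseIdx_of_lt (by simp; omega)]; simp
  · intro m h1 h2
    rw [List.getElem_eraseIdx]
    simp only [List.length_ofFn] at h2
    split_ifs with h
    · simp only [List.getElem_ofFn]
      congr 1
      rw [Fin.succAbove_of_castSucc_lt _ _ (by simpa [Fin.lt_def] using h)]
      rfl
    · simp only [List.getElem_ofFn]
      congr 1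
      rw [Fin.succAbove_of_le_castSucc _ _ (by simpa [Fin.le_def] using h)]
      rfl

abbrev RG (G : Type) [Group G] : Rep.{0} ℤ G := Rep.ofMulAction ℤ G G

/-- coefficients -/
def cf (x : RG G) (y : G) : ℤ := MonoidAlgebra.coeff (R := ℤ) (M := G) x y

theorem cf_ext {x x' : RG G} (h : ∀ y, cf x y = cf x' y) : x = x' := 
  MonoidAlgebra.ext (R := ℤ) (M := G) (Finsupp.ext h)

theorem cf_add (x x' : RG G) (y) : cf (x + x') y = cf x y + cf x' y := rfl
theorem cf_zero (y) : cf (0 : RG G) y = 0 := rfl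
theorem cf_smul (j : ℤ) (x : RG G) (y) : cf (j • x) y = j * cf x y := by
  let φ : RG G →+ ℤ := ⟨⟨fun x => cf x y, rfl⟩, fun _ _ => rfl⟩
  have h := map_zsmul φ j x
  rw [smul_eq_mul] at h
  exact h
theorem cf_sum {ι : Type*} (s : Finset ι) (x : ι → RG G) (y) : 
    cf (∑ i ∈ s, x i) y = ∑ i ∈ s, cf (x i) y := by
  let φ : RG G →+ ℤ := ⟨⟨fun x => cf x y, rfl⟩, fun _ _ => rfl⟩
  exact map_sum φ x s

theorem cf_rho (g : G) (x : RG G) (y) : cf ((RG G).ρ g x) y = cf x (g⁻¹ * y) :=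
  Representation.coeff_ofMulAction g x y

theorem cf_fin (x : RG G) : {y | cf x y ≠ 0}.Finite := Finsupp.hasFiniteSupport _

theorem cf_exists (c : G → ℤ) (hc : {y | c y ≠ 0}.Finite) : ∃ x : RG G, ∀ y, cf x y = c y :=
  ⟨MonoidAlgebra.ofCoeff (Finsupp.ofSupportFinite c hc), fun _ => rfl⟩

/-- correspondence -/
def Rl {k : ℕ} (f : (Fin k → G) → RG G) (c : List G → ℤ) : Prop := ∀ g y, cf (f g) y = c (Lst y g)

theorem Rl_d {k : ℕ} {f : (Fin k → G) → RG G} {c : List G → ℤ} (h : Rl f c) :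
    Rl (inhomogeneousCochains.d (RG G) k f) (cob c) := by
  intro g y
  have e1 : inhomogeneousCochains.d (RG G) k f g = (RG G).ρ (g 0) (f fun i => g i.succ) +
    ∑ j : Fin (k+1), (-1 : ℤ) ^ ((j : ℕ) + 1) • f (Fin.contractNth j (· * ·) g) := rfl
  rw [e1, cf_add, cf_rho, cf_sum, cob_eq_sum, Lst_length, Finset.sum_range_succ', add_comm]
  congr 1
  · rw [Finset.sum_range]
    refine Finset.sum_congr rfl fun j _ => ?_
    rw [cf_smul, h]
    congr 2
    have := eraseIdx_ofFn (fun i => y⁻¹ * Fin.partialProd g i) j.succ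
    rw [Fin.val_succ] at this
    rw [Lst, Lst, this, Fin.partialProd_contractNth]
    rfl
  · rw [h, pow_zero, one_mul]
    congr 1
    have := eraseIdx_ofFn (fun i => y⁻¹ * Fin.partialProd g i) 0
    rw [Lst, Lst]
    refine Eq.trans ?_ this.symm
    congr 1
    funext i
    rw [Fin.succAbove_zero, Fin.partialProd_succ', mul_inv_rev, inv_inv, mul_assoc]
    rfl

theorem Rl_uniq {k : ℕ} {f : (Fin k → G) → RG G} {c c' : List G → ℤ} (h : Rl f c) (h' : Rl f c')
    (l : List G) (hl : l.length = k + 1) : c l = c' l := by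
  obtain ⟨y, g, rfl, -⟩ := Lst_surj l hl
  rw [← h, ← h']

theorem Rl_zero {k : ℕ} {f : (Fin k → G) → RG G} {c : List G → ℤ} (h : Rl f c)
    (hc : ∀ l : List G, l.length = k + 1 → c l = 0) : f = 0 := by
  funext g
  apply cf_ext
  intro y
  rw [h, hc _ (Lst_length y g)]
  rfl

variable (Γ : Geo G)

theorem Rl_of_SF {k : ℕ} {c : List G → ℤ} (hc : Γ.SF c (k+1)) : ∃ f : (Fin k → G) → RG G, Rl f c := by
  have : ∀ g : Fin k → G, ∃ x : RG G, ∀ y, cf x y = c (Lst y g) := by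
    intro g
    apply cf_exists
    obtain ⟨r, hr, -⟩ := Γ.exists_Dm (Lst 1 g)
    refine Set.Finite.of_finite_image ((hc r).subset ?_) (f := fun y => Lst y g)
      (fun y _ y' _ h => (Lst_inj h).1)
    rintro _ ⟨y, hy, rfl⟩
    refine ⟨Lst_length y g, ?_, hy⟩
    intro a ha b hb
    simp only [Lst, List.mem_ofFn] at ha hb
    obtain ⟨i, rfl⟩ := ha
    obtain ⟨j, rfl⟩ := hb
    rw [Γ.inv]
    apply hr
    · exact List.mem_ofFn.2 ⟨i, by simp⟩
    · exact List.mem_ofFn.2 ⟨j, by simp⟩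
  choose f hf using this
  exact ⟨f, hf⟩

theorem SF_of_Rl {k : ℕ} (f : (Fin k → G) → RG G) : ∃ c : List G → ℤ, Rl f c ∧ Γ.SF c (k+1) := by
  classical
  have h0 : ∀ l : List G, ∃ m : ℤ, ∀ y g, l = Lst y g → m = cf (f g) y := by
    intro l
    by_cases h : ∃ (y : G) (g : Fin k → G), l = Lst y g
    · obtain ⟨y, g, rfl⟩ := h
      refine ⟨cf (f g) y, fun y' g' h' => ?_⟩
      obtain ⟨rfl, rfl⟩ := Lst_inj h'
      rfl
    · exact ⟨0, fun y g h' => absurd ⟨y, g, h'⟩ h⟩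
  choose c hc using h0
  refine ⟨c, fun g y => (hc _ y g rfl).symm, ?_⟩
  intro r
  have hF : {g : Fin k → G | ∀ i, g i ∈ {x | Γ.D 1 x ≤ r}}.Finite := by
    have := Set.Finite.pi' (fun _ : Fin k => Γ.fin r)
    exact this
  refine (hF.biUnion (t := fun g => (fun y => Lst y g) '' {y | cf (f g) y ≠ 0})
    (fun g _ => (cf_fin (f g)).image _)).subset ?_
  rintro l ⟨hl, hD, hne⟩
  obtain ⟨y, g, rfl, hg⟩ := Lst_surj l hl
  simp only [Set.mem_iUnion]
  refine ⟨g, fun i => ?_, y, ?_, rfl⟩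
  · obtain ⟨a, ha, b, hb, e⟩ := hg i
    rw [e]
    have h1 := hD a ha b hb
    have h2 := Γ.inv a⁻¹ a b
    rw [inv_mul_cancel] at h2
    show Γ.D 1 (a⁻¹ * b) ≤ r
    rw [h2]; exact h1
  · rw [hc _ y g rfl] at hne
    exact hne

/-- The cohomological package. -/
structure GCp (n : ℕ) (c0 : List G → ℤ) : Prop where
  hn : 1 ≤ n
  sf : Γ.SF c0 (n + 1)
  coc : ∀ l : List G, l.length = n + 2 → cob c0 l = 0
  gen : ∀ c : List G → ℤ, Γ.SF c (n + 1) → (∀ l : List G, l.length = n + 2 → cob c l = 0) →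
    ∃ (k : ℤ) (b : List G → ℤ), Γ.SF b n ∧ ∀ l : List G, l.length = n + 1 → c l = k * c0 l + cob b l
  tors : ∀ (j : ℤ) (b : List G → ℤ), Γ.SF b n →
    (∀ l : List G, l.length = n + 1 → j * c0 l = cob b l) → j = 0
  high : ∀ k, n + 1 ≤ k → ∀ c : List G → ℤ, Γ.SF c (k + 1) →
    (∀ l : List G, l.length = k + 2 → cob c l = 0) →
    ∃ b : List G → ℤ, Γ.SF b k ∧ ∀ l : List G, l.length = k + 1 → c l = cob b l

theorem rg_inv_zero [Infinite G] (x : RG G) (h : ∀ g, (RG G).ρ g x = x) : x = 0 := by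
  apply cf_ext
  intro y
  by_contra hne
  refine Set.infinite_univ (α := G) ((cf_fin x).subset fun y' _ => ?_)
  have := cf_rho (y' * y⁻¹) x y'
  rw [h] at this
  simp only [mul_inv_rev, inv_inv, inv_mul_cancel_right] at this
  rw [Set.mem_ofPred_eq, this]
  exact hne

theorem exists_GCp [Infinite G] (n : ℕ) (h1 : ∀ k : ℕ, k ≠ n → Subsingleton (groupCohomology (RG G) k))
    (φ : groupCohomology (RG G) n ≃ₗ[ℤ] ℤ) : ∃ c0, GCp Γ n c0 := by
  have hn : n ≠ 0 := by
    rintro rfl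
    have hs : Subsingleton (groupCohomology (RG G) 0) := by
      have e := (groupCohomology.H0Iso (RG G)).toLinearEquiv
      have : Subsingleton (RG G).ρ.invariants := ⟨fun x y => by
        ext1
        rw [rg_inv_zero x.1 x.2, rg_inv_zero y.1 y.2]⟩
      exact e.toEquiv.subsingleton
    have := φ.symm.toEquiv.subsingleton
    exact absurd (Subsingleton.elim (0 : ℤ) 1) (by norm_num)
  obtain ⟨m, rfl⟩ := Nat.exists_eq_succ_of_ne_zero hn
  obtain ⟨f0, hf0, hgen, htor⟩ := gc_one (RG G) m φ
  obtain ⟨c0, hc0, hsf⟩ := SF_of_Rl Γ f0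
  refine ⟨c0, by omega, hsf, ?_, ?_, ?_, ?_⟩
  · refine Rl_uniq (Rl_d hc0) (c' := fun _ => 0) ?_
    rw [hf0]
    exact fun _ _ => rfl
  · intro c hc hcoc
    obtain ⟨f, hf⟩ := Rl_of_SF Γ hc
    obtain ⟨j, y, hy⟩ := hgen f (Rl_zero (Rl_d hf) hcoc)
    obtain ⟨b, hb, hsb⟩ := SF_of_Rl Γ y
    refine ⟨j, b, hsb, ?_⟩
    refine Rl_uniq hf ?_
    intro g y'
    rw [hy]
    show cf (j • f0 g + inhomogeneousCochains.d (RG G) m y g) y' = _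
    rw [cf_add, cf_smul, hc0, Rl_d hb]
  · intro j b hb h
    obtain ⟨y, hy⟩ := Rl_of_SF Γ (k := m) hb
    refine htor j y ?_
    funext g
    apply cf_ext
    intro y'
    rw [Rl_d hy, ← h _ (Lst_length _ _), ← hc0]
    exact cf_smul _ _ _
  · intro k hk c hc hcoc
    obtain ⟨k, rfl⟩ : ∃ k', k = k' + 1 := ⟨k - 1, by omega⟩
    obtain ⟨f, hf⟩ := Rl_of_SF Γ hc
    have := h1 (k + 1) (by omega)
    obtain ⟨y, hy⟩ := gc_zero (RG G) k f (Rl_zero (Rl_d hf) hcoc)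
    obtain ⟨b, hb, hsb⟩ := SF_of_Rl Γ y
    refine ⟨b, hsb, Rl_uniq hf ?_⟩
    rw [← hy]
    exact Rl_d hb

end
end NW

namespace NW
section
variable {G : Type} [Group G] {Γ : Geo G}

theorem Geo.SF.comb {c c' : List G → ℤ} {N : ℕ} (h : Γ.SF c N) (h' : Γ.SF c' N) (j j' : ℤ) :
    Γ.SF (fun l => j * c l + j' * c' l) N := by
  intro r
  refine ((h r).union (h' r)).subset ?_
  rintro l ⟨h1, h2, h3⟩
  by_cases hc : c l = 0
  · refine Or.inr ⟨h1, h2, fun h => h3 ?_⟩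
    simp [hc, h]
  · exact Or.inl ⟨h1, h2, hc⟩

theorem Geo.SF.carrier {c : List G → ℤ} {N M : ℕ} (hN : 1 ≤ N) (hM : 1 ≤ M) (h : Γ.SF c M)
    (T : List G → Ch G) (hT : ∀ l, l.length = N → T l ∈ Sup (fun l' => l'.length = M ∧ ∀ y ∈ l', y ∈ l)) :
    Γ.SF (fun l => ev c (T l)) N := by
  refine Γ.SF_pull hN hM h T id (fun l r hl hr a ha => ?_)
  exact Sup_mono (fun l' hl' => ⟨hl'.1, fun y hy =>
    hr a (List.mem_of_mem_head? ha) y (hl'.2 y hy)⟩) (hT l hl)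

theorem GCp.nodup {n : ℕ} {c0 : List G → ℤ} (H : GCp Γ n c0) :
    ∃ c1, GCp Γ n c1 ∧ ∀ l, ¬ l.Nodup → c1 l = 0 := by
  obtain ⟨a, D, ha1, ha2, ha3, hD1, hD2⟩ := exists_sortmap G
  have hn := H.hn
  have key : ∀ l : List G, l.length = n + 1 → c0 l = ev c0 (a l) + cob (fun l => ev c0 (D l)) l := by
    intro l hl
    have h1 := congrArg (ev c0) (hD1 l)
    rw [ev_B, ev_zero_of_Sup (cob c0) (fun l' hl' => H.coc l' (by omega)) (hD2 l), map_sub, map_sub,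
      ev_sg, ← cob_pull] at h1
    linarith
  have hsD : Γ.SF (fun l => ev c0 (D l)) n := H.sf.carrier hn (by omega) D
    (fun l hl => Sup_mono (fun l' hl' => ⟨by omega, hl'.2⟩) (hD2 l))
  refine ⟨fun l => ev c0 (a l), ⟨hn, ?_, ?_, ?_, ?_, H.high⟩, fun l hl => by simp [ha3 l hl]⟩
  · exact H.sf.carrier (by omega) (by omega) a
      (fun l hl => Sup_mono (fun l' hl' => ⟨by omega, hl'.2.2⟩) (ha2 l))
  · intro l hl
    rw [cob_pull, ← ha1, ev_B]
    exact ev_zero_of_Sup _ (fun l' hl' => H.coc l' (by omega)) (ha2 l)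
  · intro c hc hcoc
    obtain ⟨k, b, hb, h⟩ := H.gen c hc hcoc
    refine ⟨k, fun l => k * ev c0 (D l) + 1 * b l, hsD.comb hb k 1, fun l hl => ?_⟩
    rw [h l hl, key l hl, cob_add, cob_mul, cob_mul]
    ring
  · intro j b hb h
    refine H.tors j (fun l => j * ev c0 (D l) + 1 * b l) (hsD.comb hb j 1) (fun l hl => ?_)
    rw [cob_add, cob_mul, cob_mul, ← h l hl, key l hl]
    ring

theorem Geo.SF.trans {c : List G → ℤ} {N : ℕ} (h : Γ.SF c N) (g : G) :
    Γ.SF (fun l => c (l.map (g * ·))) N := by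
  intro r
  have hi : Function.Injective (List.map (fun x : G => g * x)) :=
    List.map_injective_iff.2 (mul_right_injective g)
  refine Set.Finite.of_finite_image ((h r).subset ?_) (hi.injOn)
  rintro _ ⟨l, ⟨h1, h2, h3⟩, rfl⟩
  refine ⟨by simp [h1], ?_, h3⟩
  intro x hx y hy
  obtain ⟨x', hx', rfl⟩ := List.mem_map.1 hx
  obtain ⟨y', hy', rfl⟩ := List.mem_map.1 hy
  rw [Γ.inv]
  exact h2 x' hx' y' hy'

theorem map_mul_inv (g : G) (l : List G) : (l.map (g⁻¹ * ·)).map (g * ·) = l := by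
  simp [Function.comp_def]

theorem GCp.trans {n : ℕ} {c0 : List G → ℤ} (H : GCp Γ n c0) (g : G) :
    GCp Γ n (fun l => c0 (l.map (g * ·))) := by
  refine ⟨H.hn, H.sf.trans g, ?_, ?_, ?_, H.high⟩
  · intro l hl
    rw [cob_map]
    exact H.coc _ (by simpa using hl)
  · intro c hc hcoc
    obtain ⟨k, b, hb, h⟩ := H.gen (fun l => c (l.map (g⁻¹ * ·))) (hc.trans g⁻¹) (fun l hl => by
      rw [cob_map]; exact hcoc _ (by simpa using hl))
    refine ⟨k, fun l => b (l.map (g * ·)), hb.trans g, fun l hl => ?_⟩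
    rw [cob_map, ← h _ (by simpa using hl)]
    have := map_mul_inv g⁻¹ l
    rw [inv_inv] at this
    rw [this]
  · intro j b hb h
    refine H.tors j (fun l => b (l.map (g⁻¹ * ·))) (hb.trans g⁻¹) (fun l hl => ?_)
    rw [cob_map, ← h _ (by simpa using hl), map_mul_inv]

/-- Finite support on the Rips complex. -/
def FP (Γ : Geo G) (d k : ℕ) (u : List G → ℤ) : Prop := {l | Γ.PD d Set.univ k l ∧ u l ≠ 0}.Finite

open Classical in
/-- restriction -/
def cut (Γ : Geo G) (d k : ℕ) (u : List G → ℤ) : List G → ℤ :=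
  fun l => if Γ.PD d Set.univ k l then u l else 0

theorem cut_eq {d k : ℕ} {u : List G → ℤ} {l : List G} (h : Γ.PD d Set.univ k l) : cut Γ d k u l = u l :=
  if_pos h

theorem FP.sf {d k : ℕ} {u : List G → ℤ} (h : FP Γ d k u) : Γ.SF (cut Γ d k u) k := by
  intro r
  refine h.subset ?_
  rintro l ⟨h1, h2, h3⟩
  unfold cut at h3
  split_ifs at h3 with h4
  · exact ⟨h4, h3⟩
  · exact absurd rfl h3

theorem FP.of_sf {d k : ℕ} {u : List G → ℤ} (h : Γ.SF u k) : FP Γ d k u :=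
  (h d).subset (fun l hl => ⟨hl.1.1, hl.1.2.2, hl.2⟩)

theorem PD_sub {d k : ℕ} {l l' : List G} (h : Γ.PD d Set.univ (k + 1) l) (hs : l'.Sublist l)
    (hl : l'.length + 1 = l.length) : Γ.PD d Set.univ k l' := by
  have := h.sub hs
  have e : l'.length = k := by have := h.1; omega
  rwa [e] at this

theorem cob_cut {d k : ℕ} {u : List G → ℤ} {l : List G} (h : Γ.PD d Set.univ (k + 1) l) :
    cob (cut Γ d k u) l = cob u l :=
  cob_congr _ _ l (fun l' h1 h2 => cut_eq (PD_sub h h1 h2))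

theorem psi_pull {d k : ℕ} (hd : 4 * Γ.δ + 2 ≤ d) : ∃ Ψ : List G → Ch G,
    (∀ l, Γ.Dm d l → Ψ l = sg l) ∧ (∀ l, B (Ψ l) = lin Ψ (bd l)) ∧
    (∀ l, l.length = k + 1 → Ψ l ∈ Sup (Γ.PD d Set.univ (k + 1))) ∧
    (∀ u, FP Γ d (k + 1) u → Γ.SF (fun l => ev (cut Γ d (k + 1) u) (Ψ l)) (k + 1)) := by
  obtain ⟨Ψ, h1, h2, h3⟩ := Γ.exists_Psi hd
  refine ⟨Ψ, h1, h2, ?_, ?_⟩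
  · intro l hl
    cases l with
    | nil => simp at hl
    | cons a l =>
    obtain ⟨r, hr, -⟩ := Γ.exists_Dm (a :: l)
    exact Sup_mono (fun l' hl' => ⟨by rw [hl'.1, hl], fun _ _ => trivial, hl'.2.2⟩) (h3 (a :: l) r hr a (by simp))
  · intro u hu
    refine Γ.SF_pull (by omega) (by omega) hu.sf Ψ (fun r => (k + 1) * r) (fun l r hl hr a ha => ?_)
    have := h3 l r hr a ha
    rw [hl] at this
    exact Sup_mono (fun l' hl' => ⟨hl'.1, hl'.2.1⟩) this

/-- Extension of a finitely supported cocycle on the Rips complex to all lists. -/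
theorem ext_cocycle {d k : ℕ} (hd : 4 * Γ.δ + 2 ≤ d) (z : List G → ℤ) (hz : FP Γ d (k + 1) z)
    (hc : ∀ l, Γ.PD d Set.univ (k + 2) l → cob z l = 0) :
    ∃ c, Γ.SF c (k + 1) ∧ (∀ l : List G, l.length = k + 2 → cob c l = 0) ∧
      ∀ l, Γ.PD d Set.univ (k + 1) l → c l = z l := by
  obtain ⟨Ψ, h1, h2, h3⟩ := Γ.exists_Psi hd
  have h4 : ∀ l, l.length = k + 2 → Ψ l ∈ Sup (Γ.PD d Set.univ (k + 2)) := by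
    intro l hl
    cases l with
    | nil => simp at hl
    | cons a l =>
    obtain ⟨r, hr, -⟩ := Γ.exists_Dm (a :: l)
    exact Sup_mono (fun l' hl' => ⟨by rw [hl'.1, hl], fun _ _ => trivial, hl'.2.2⟩) (h3 (a :: l) r hr a (by simp))
  refine ⟨fun l => ev (cut Γ d (k + 1) z) (Ψ l), ?_, ?_, ?_⟩
  · refine Γ.SF_pull (by omega) (by omega) hz.sf Ψ (fun r => (k + 1) * r) (fun l r hl hr a ha => ?_)
    have := h3 l r hr a ha
    rw [hl] at this
    exact Sup_mono (fun l' hl' => ⟨hl'.1, hl'.2.1⟩) this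
  · intro l hl
    rw [cob_pull, ← h2, ev_B]
    refine ev_zero_of_Sup _ (fun l' hl' => ?_) (h4 l hl)
    rw [cob_cut hl', hc l' hl']
  · intro l hl
    show ev (cut Γ d (k + 1) z) (Ψ l) = z l
    rw [h1 l hl.2.2, ev_sg, cut_eq hl]

theorem F1high {n d : ℕ} {c0 : List G → ℤ} (H : GCp Γ n c0) (hd : 4 * Γ.δ + 2 ≤ d) {k : ℕ} (hk : n + 1 ≤ k)
    (z : List G → ℤ) (hz : FP Γ d (k + 1) z) (hc : ∀ l, Γ.PD d Set.univ (k + 2) l → cob z l = 0) :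
    ∃ u, FP Γ d k u ∧ ∀ l, Γ.PD d Set.univ (k + 1) l → z l = cob u l := by
  obtain ⟨c, h1, h2, h3⟩ := ext_cocycle hd z hz hc
  obtain ⟨b, hb, h⟩ := H.high k hk c h1 h2
  exact ⟨b, FP.of_sf hb, fun l hl => by rw [← h3 l hl, h l hl.1]⟩

theorem F1gen {n d : ℕ} {c0 : List G → ℤ} (H : GCp Γ n c0) (hd : 4 * Γ.δ + 2 ≤ d)
    (z : List G → ℤ) (hz : FP Γ d (n + 1) z) (hc : ∀ l, Γ.PD d Set.univ (n + 2) l → cob z l = 0) :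
    ∃ (j : ℤ) (u : List G → ℤ), FP Γ d n u ∧ ∀ l, Γ.PD d Set.univ (n + 1) l → z l = j * c0 l + cob u l := by
  obtain ⟨c, h1, h2, h3⟩ := ext_cocycle hd z hz hc
  obtain ⟨j, b, hb, h⟩ := H.gen c h1 h2
  exact ⟨j, b, FP.of_sf hb, fun l hl => by rw [← h3 l hl, h l hl.1]⟩

theorem F1tors {n d : ℕ} {c0 : List G → ℤ} (H : GCp Γ n c0) (hd : 4 * Γ.δ + 2 ≤ d) (j : ℤ)
    (u : List G → ℤ) (hu : FP Γ d n u) (h : ∀ l, Γ.PD d Set.univ (n + 1) l → j * c0 l = cob u l) : j = 0 := by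
  obtain ⟨m, rfl⟩ : ∃ m, n = m + 1 := ⟨n - 1, by have := H.hn; omega⟩
  obtain ⟨Ψ, h1, h2, h3⟩ := Γ.exists_Psi hd
  obtain ⟨E, hE1, hE2⟩ := Γ.exists_E Ψ (h1 [] (fun x hx => by simp at hx)) h2
    (fun l r hr a ha => Sup_mono (fun l' hl' => ⟨hl'.1, hl'.2.1⟩) (h3 l r hr a ha))
  have hp : ∀ l, l.length = m + 2 → Ψ l ∈ Sup (Γ.PD d Set.univ (m + 2)) := by
    intro l hl
    cases l with
    | nil => simp at hl
    | cons a l =>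
    obtain ⟨r, hr, -⟩ := Γ.exists_Dm (a :: l)
    exact Sup_mono (fun l' hl' => ⟨by rw [hl'.1, hl], fun _ _ => trivial, hl'.2.2⟩) (h3 (a :: l) r hr a (by simp))
  have hs1 : Γ.SF (fun l => ev (cut Γ d (m + 1) u) (Ψ l)) (m + 1) := by
    refine Γ.SF_pull (by omega) (by omega) hu.sf Ψ (fun r => (m + 1) * r) (fun l r hl hr a ha => ?_)
    have := h3 l r hr a ha
    rw [hl] at this
    exact Sup_mono (fun l' hl' => ⟨hl'.1, hl'.2.1⟩) this
  have hs2 : Γ.SF (fun l => ev c0 (E l)) (m + 1) := by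
    refine Γ.SF_pull (by omega) (by omega) H.sf E (fun r => (m + 1) * r) (fun l r hl hr a ha => ?_)
    have := hE2 l r hr a ha
    rw [hl] at this
    exact this
  refine H.tors j _ (hs1.comb hs2 1 j) (fun l hl => ?_)
  rw [cob_add, cob_mul, cob_mul, cob_pull, cob_pull, ← h2, ev_B]
  have e1 := congrArg (ev c0) (hE1 l)
  have hEl : E l ∈ Sup (fun l' => l'.length = m + 1 + 2) := by
    cases l with
    | nil => simp at hl
    | cons a l =>
    obtain ⟨r, hr, -⟩ := Γ.exists_Dm (a :: l)
    exact Sup_mono (fun l' hl' => by rw [hl'.1, hl]) (hE2 (a :: l) r hr a (by simp))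
  rw [ev_B, ev_zero_of_Sup (cob c0) (fun l' hl' => H.coc l' hl') hEl, map_sub, map_sub, ev_sg] at e1
  have e2 : ev (cob (cut Γ d (m + 1) u)) (Ψ l) = ev (fun l => j * c0 l) (Ψ l) :=
    ev_congr_of_Sup _ _ (fun l' hl' => by rw [cob_cut hl', h l' hl']) (hp l hl)
  rw [e2, ev_mul]
  linear_combination (-j) * e1

/-! ### uniform primitives -/

open Classical in
theorem U1 {d k : ℕ} (hk : 1 ≤ k)
    (HF : ∀ z : List G → ℤ, FP Γ d (k + 1) z → (∀ l, Γ.PD d Set.univ (k + 2) l → cob z l = 0) →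
      ∃ u, FP Γ d k u ∧ ∀ l, Γ.PD d Set.univ (k + 1) l → z l = cob u l) (R1 : ℕ) :
    ∃ R2, ∀ z : List G → ℤ, (∀ l, z l ≠ 0 → Γ.PD d {y | Γ.D 1 y ≤ R1} (k + 1) l) →
      (∀ l, Γ.PD d Set.univ (k + 2) l → cob z l = 0) →
      ∃ u : List G → ℤ, (∀ l, u l ≠ 0 → Γ.PD d {y | Γ.D 1 y ≤ R2} k l) ∧
        ∀ l, Γ.PD d Set.univ (k + 1) l → z l = cob u l := by
  let S : Set (List G) := {l | Γ.PD d {y | Γ.D 1 y ≤ R1} (k + 1) l}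
  have hS : S.Finite := (lists_finite (Γ.fin R1) (k + 1)).subset (fun l hl => ⟨hl.1, hl.2.1⟩)
  have := hS.to_subtype
  let N : ℕ → Submodule ℤ (S → ℤ) := fun R =>
    { carrier := {w | ∃ u : List G → ℤ, (∀ l, u l ≠ 0 → Γ.PD d {y | Γ.D 1 y ≤ R} k l) ∧
        ∀ l, Γ.PD d Set.univ (k + 1) l → (if h : l ∈ S then w ⟨l, h⟩ else 0) = cob u l}
      zero_mem' := ⟨fun _ => 0, fun l hl => absurd rfl hl, fun l _ => by simp [cob_zero]⟩
      add_mem' := by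
        rintro w w' ⟨u, h1, h2⟩ ⟨u', h1', h2'⟩
        refine ⟨fun l => u l + u' l, fun l hl => ?_, fun l hl => ?_⟩
        · by_cases h : u l = 0
          · exact h1' l (fun h' => hl (by simp [h, h']))
          · exact h1 l h
        · rw [cob_add, ← h2 l hl, ← h2' l hl]
          split_ifs <;> simp
      smul_mem' := by
        rintro j w ⟨u, h1, h2⟩
        refine ⟨fun l => j * u l, fun l hl => h1 l (fun h => hl (by simp [h])), fun l hl => ?_⟩
        rw [cob_mul, ← h2 l hl]
        split_ifs <;> simp }
  have hN : Monotone N := by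
    rintro R R' h w ⟨u, h1, h2⟩
    exact ⟨u, fun l hl => ⟨(h1 l hl).1, fun y hy => ((h1 l hl).2.1 y hy).trans h, (h1 l hl).2.2⟩, h2⟩
  obtain ⟨R0, hR0⟩ := monotone_stabilizes_iff_noetherian.2 (inferInstance : IsNoetherian ℤ (S → ℤ)) ⟨N, hN⟩
  refine ⟨R0, fun z hz hc => ?_⟩
  have hzf : FP Γ d (k + 1) z := hS.subset (fun l hl => hz l hl.2)
  obtain ⟨u, hu, huz⟩ := HF z hzf hc
  have hext : ∀ l, (if h : l ∈ S then (fun s : S => z s.1) ⟨l, h⟩ else 0) = z l := by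
    intro l
    split_ifs with h
    · rfl
    · by_contra h'
      exact h (hz l (Ne.symm h'))
  have hex : ∃ R, R0 ≤ R ∧ (fun s : S => z s.1) ∈ N R := by
    obtain ⟨R, hR⟩ := ((Geo.verts_finite hu).image (fun g => Γ.D 1 g)).bddAbove
    refine ⟨max R0 R, le_max_left _ _, cut Γ d k u, fun l hl => ?_, fun l hl => ?_⟩
    · unfold cut at hl
      split_ifs at hl with h
      · refine ⟨h.1, fun y hy => ?_, h.2.2⟩
        have : Γ.D 1 y ≤ R := hR ⟨y, ⟨l, ⟨h, hl⟩, hy⟩, rfl⟩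
        exact this.trans (le_max_right _ _)
      · exact absurd rfl hl
    · rw [hext, cob_cut hl, huz l hl]
  obtain ⟨R, hR, hmem⟩ := hex
  have h2 : N R0 = N R := hR0 R hR
  rw [← h2] at hmem
  obtain ⟨u', h1', h2'⟩ := hmem
  refine ⟨u', h1', fun l hl => ?_⟩
  rw [← h2' l hl, hext]

theorem PD_map {d k : ℕ} {g : G} {R : ℕ} {l : List G} :
    Γ.PD d {y | Γ.D 1 y ≤ R} k (l.map (g⁻¹ * ·)) ↔ Γ.PD d {y | Γ.D g y ≤ R} k l := by
  unfold Geo.PD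
  have e : ∀ x, Γ.D 1 (g⁻¹ * x) = Γ.D g x := fun x => by
    have := Γ.inv g⁻¹ g x
    rwa [inv_mul_cancel] at this
  simp only [List.length_map, List.mem_map, forall_exists_index, and_imp, forall_apply_eq_imp_iff₂,
    Set.mem_ofPred_eq, e, Γ.inv]

theorem PD_mapu {d k : ℕ} {g : G} {l : List G} :
    Γ.PD d Set.univ k (l.map (g * ·)) ↔ Γ.PD d Set.univ k l := by
  unfold Geo.PD
  simp only [List.length_map, List.mem_map, forall_exists_index, and_imp, forall_apply_eq_imp_iff₂,
    Set.mem_univ, Γ.inv]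

theorem U2 {d k : ℕ} (hk : 1 ≤ k)
    (HF : ∀ z : List G → ℤ, FP Γ d (k + 1) z → (∀ l, Γ.PD d Set.univ (k + 2) l → cob z l = 0) →
      ∃ u, FP Γ d k u ∧ ∀ l, Γ.PD d Set.univ (k + 1) l → z l = cob u l) (R1 : ℕ) :
    ∃ R2, ∀ (g : G) (z : List G → ℤ), (∀ l, z l ≠ 0 → Γ.PD d {y | Γ.D g y ≤ R1} (k + 1) l) →
      (∀ l, Γ.PD d Set.univ (k + 2) l → cob z l = 0) →
      ∃ u : List G → ℤ, (∀ l, u l ≠ 0 → Γ.PD d {y | Γ.D g y ≤ R2} k l) ∧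
        ∀ l, Γ.PD d Set.univ (k + 1) l → z l = cob u l := by
  obtain ⟨R2, h⟩ := U1 hk HF R1
  refine ⟨R2, fun g z hz hc => ?_⟩
  obtain ⟨u, hu1, hu2⟩ := h (fun l => z (l.map (g * ·))) (fun l hl => by
    have := hz _ hl
    rw [← PD_map] at this
    have e := map_mul_inv g⁻¹ l
    rw [inv_inv] at e
    rwa [e] at this) (fun l hl => by
      rw [cob_map]; exact hc _ (PD_mapu.2 hl))
  refine ⟨fun l => u (l.map (g⁻¹ * ·)), fun l hl => PD_map.1 (hu1 _ hl), fun l hl => ?_⟩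
  rw [cob_map, ← hu2 _ (PD_mapu.2 hl), map_mul_inv]

/-- vertices uniformly near -/
def Nr (Γ : Geo G) (R : ℕ) (l l' : List G) : Prop := ∀ a ∈ l, ∀ b ∈ l', Γ.D a b ≤ R

/-- controlled contraction in one degree -/
def F2 (Γ : Geo G) (d k : ℕ) : Prop := ∃ (R : ℕ) (K K' : List G → Ch G),
  (∀ l, Γ.PD d Set.univ k l → K l ∈ Sup (fun l' => Γ.PD d Set.univ (k + 1) l' ∧ Nr Γ R l l')) ∧
  (∀ l, Γ.PD d Set.univ (k + 1) l → K' l ∈ Sup (fun l' => Γ.PD d Set.univ (k + 2) l' ∧ Nr Γ R l l')) ∧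
  (∀ l, Γ.PD d Set.univ (k + 1) l → sg l = B (K' l) + lin K (bd l))

theorem F2top (d : ℕ) : ∃ k0, ∀ k, k0 ≤ k → F2 Γ d k := by
  obtain ⟨a, D, ha1, ha2, ha3, hD1, hD2⟩ := exists_sortmap G
  classical
  refine ⟨(Γ.fin d).toFinset.card + 1, fun k hk => ⟨d, D, D, ?_, ?_, ?_⟩⟩
  · intro l hl
    exact Sup_mono (fun l' hl' => ⟨⟨by rw [hl'.1, hl.1], fun _ _ => trivial, fun x hx y hy =>
      hl.2.2 x (hl'.2 x hx) y (hl'.2 y hy)⟩, fun x hx y hy => hl.2.2 x hx y (hl'.2 y hy)⟩) (hD2 l)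
  · intro l hl
    exact Sup_mono (fun l' hl' => ⟨⟨by rw [hl'.1, hl.1], fun _ _ => trivial, fun x hx y hy =>
      hl.2.2 x (hl'.2 x hx) y (hl'.2 y hy)⟩, fun x hx y hy => hl.2.2 x hx y (hl'.2 y hy)⟩) (hD2 l)
  · intro l hl
    have hnd : ¬ l.Nodup := by
      intro hn
      cases l with
      | nil => have := hl.1; simp at this
      | cons x l =>
      have h1 : ((x :: l).map (x⁻¹ * ·)).Nodup := hn.map (mul_right_injective x⁻¹)
      have h2 : ((x :: l).map (x⁻¹ * ·)).toFinset ⊆ (Γ.fin d).toFinset := by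
        intro y hy
        simp only [List.mem_toFinset, List.mem_map] at hy
        obtain ⟨y', hy', rfl⟩ := hy
        simp only [Set.Finite.mem_toFinset, Set.mem_ofPred_eq]
        have e := Γ.inv x⁻¹ x y'
        rw [inv_mul_cancel] at e
        rw [e]
        exact hl.2.2 x (by simp) y' hy'
      have h3 := Finset.card_le_card h2
      rw [List.toFinset_card_of_nodup h1, List.length_map, hl.1] at h3
      omega
    rw [hD1 l, ha3 l hnd]
    abel

open Classical in
theorem F2step {d k : ℕ} (hk : 1 ≤ k)
    (HF : ∀ z : List G → ℤ, FP Γ d (k + 1) z → (∀ l, Γ.PD d Set.univ (k + 2) l → cob z l = 0) →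
      ∃ u, FP Γ d k u ∧ ∀ l, Γ.PD d Set.univ (k + 1) l → z l = cob u l)
    (h : F2 Γ d (k + 1)) : F2 Γ d k := by
  obtain ⟨R, K1, K2, hK1, hK2, hK⟩ := h
  obtain ⟨R2, hU⟩ := U2 hk HF (R + d)
  let φ : List G → Ch G := fun l => sg l - B (K1 l)
  have hφ : ∀ l, Γ.PD d Set.univ (k + 1) l → φ l ∈ Sup (fun l' => Γ.PD d Set.univ (k + 1) l' ∧
      Nr Γ (R + d) l l') := by
    intro l hl
    refine Submodule.sub_mem _ (sg_mem ⟨hl, fun a ha b hb => (hl.2.2 a ha b hb).trans (by omega)⟩) ?_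
    refine B_mem (fun l' hl' l'' h1 h2 => ⟨PD_sub hl'.1 h1 h2, fun a ha b hb => ?_⟩) (hK1 l hl)
    exact (hl'.2 a ha b (h1.subset hb)).trans (by omega)
  have hφB : ∀ l, Γ.PD d Set.univ (k + 2) l → lin φ (bd l) = 0 := by
    intro l hl
    have e : lin φ (bd l) = (LinearMap.id - B ∘ₗ lin K1 : Ch G →ₗ[ℤ] Ch G) (bd l) :=
      lhom_ext_apply (lin φ) (LinearMap.id - B ∘ₗ lin K1 : Ch G →ₗ[ℤ] Ch G) (fun l => by simp [φ]) _
    have e2 : lin K1 (bd l) = sg l - B (K2 l) := by rw [hK l hl]; abel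
    rw [e]
    simp only [LinearMap.sub_apply, LinearMap.comp_apply, LinearMap.id_apply, e2, map_sub, B_B, B_sg]
    abel
  let zz : List G → List G → ℤ := fun τ => cut Γ d (k + 1) (fun l => φ l τ)
  have hex : ∀ τ : List G, ∃ u : List G → ℤ, (¬ Γ.PD d Set.univ (k + 1) τ → ∀ l, u l = 0) ∧
      (∀ l, u l ≠ 0 → Γ.PD d Set.univ k l ∧ Nr Γ (R2 + d) l τ) ∧
      (Γ.PD d Set.univ (k + 1) τ → ∀ l, Γ.PD d Set.univ (k + 1) l → φ l τ = cob u l) := by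
    intro τ
    by_cases hτ : Γ.PD d Set.univ (k + 1) τ
    · cases τ with
      | nil => have := hτ.1; simp at this
      | cons g τ =>
      obtain ⟨u, hu1, hu2⟩ := hU g (zz (g :: τ)) (fun l hl => by
        simp only [zz] at hl
        unfold cut at hl
        split_ifs at hl with h
        · refine ⟨h.1, fun y hy => ?_, h.2.2⟩
          have h3 := hφ l h
          rw [Finsupp.mem_supported] at h3
          have h4 := h3 (Finsupp.mem_support_iff.2 hl)
          have := h4.2 y hy g (by simp)
          rw [Γ.symm] at this
          exact this
        · exact absurd rfl hl) (fun l hl => by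
          simp only [zz]
          rw [cob_cut hl]
          have h5 := congrArg (Finsupp.lapply (g :: τ) : Ch G →ₗ[ℤ] ℤ) (hφB l hl)
          rw [map_zero] at h5
          rw [← h5, cob_eq_ev]
          exact lhom_ext_apply (ev (fun l => φ l (g :: τ)))
            ((Finsupp.lapply (g :: τ) : Ch G →ₗ[ℤ] ℤ) ∘ₗ lin φ) (fun l => by simp) _)
      refine ⟨u, fun h => absurd hτ h, fun l hl => ⟨⟨(hu1 l hl).1, fun _ _ => trivial, (hu1 l hl).2.2⟩,
        fun a ha b hb => ?_⟩, fun _ l hl => ?_⟩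
      · have h1 : Γ.D g a ≤ R2 := (hu1 l hl).2.1 a ha
        have h2 := hτ.2.2 g (by simp) b hb
        have h3 := Γ.tri a g b
        rw [Γ.symm a g] at h3
        omega
      · rw [← hu2 l hl]
        simp only [zz]
        rw [cut_eq hl]
    · exact ⟨fun _ => 0, fun _ _ => rfl, fun l hl => absurd rfl hl, fun h => absurd h hτ⟩
  choose u hu0 hu1 hu2 using hex
  have hfin : ∀ l, {τ | u τ l ≠ 0}.Finite := by
    intro l
    by_cases hl : Γ.PD d Set.univ k l
    · obtain ⟨x, hx⟩ : ∃ x, x ∈ l := List.exists_mem_of_length_pos (by have := hl.1; omega)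
      refine (lists_finite (Γ.ball_finite x (R2 + d)) (k + 1)).subset (fun τ hτ => ?_)
      by_cases h : Γ.PD d Set.univ (k + 1) τ
      · exact ⟨h.1, fun y hy => (hu1 τ l hτ).2 x hx y hy⟩
      · exact absurd (hu0 τ h l) hτ
    · refine Set.finite_empty.subset (fun τ hτ => hl (hu1 τ l hτ).1)
  let K : List G → Ch G := fun l => Finsupp.ofSupportFinite (fun τ => u τ l) (hfin l)
  have hKτ : ∀ l τ, K l τ = u τ l := fun l τ => rfl
  refine ⟨max R (R2 + d), K, K1, ?_, ?_, ?_⟩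
  · intro l hl
    rw [Finsupp.mem_supported]
    intro τ hτ
    have hτ : u τ l ≠ 0 := by
      have := Finsupp.mem_support_iff.1 hτ
      rwa [hKτ] at this
    by_cases h : Γ.PD d Set.univ (k + 1) τ
    · exact ⟨h, fun a ha b hb => ((hu1 τ l hτ).2 a ha b hb).trans (le_max_right _ _)⟩
    · exact absurd (hu0 τ h l) hτ
  · intro l hl
    exact Sup_mono (fun l' hl' => ⟨hl'.1, fun a ha b hb => (hl'.2 a ha b hb).trans (le_max_left _ _)⟩)
      (hK1 l hl)
  · intro l hl
    have e : lin K (bd l) = φ l := by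
      ext τ
      have h1 : lin K (bd l) τ = cob (u τ) l := by
        rw [cob_eq_ev]
        exact (lhom_ext_apply (ev (u τ))
            ((Finsupp.lapply τ : Ch G →ₗ[ℤ] ℤ) ∘ₗ lin K) (fun l => by simp [hKτ]) _).symm
      rw [h1]
      by_cases h : Γ.PD d Set.univ (k + 1) τ
      · rw [hu2 τ h l hl]
      · rw [show u τ = fun _ => 0 from funext (hu0 τ h), cob_zero]
        have h3 := hφ l hl
        rw [Finsupp.mem_supported] at h3
        by_contra h4
        exact h (h3 (Finsupp.mem_support_iff.2 (Ne.symm h4))).1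
    rw [e]
    simp [φ]

theorem F2main {n d : ℕ} {c0 : List G → ℤ} (H : GCp Γ n c0) (hd : 4 * Γ.δ + 2 ≤ d) {k : ℕ} (hk : n + 1 ≤ k) :
    F2 Γ d k := by
  obtain ⟨k0, hk0⟩ := F2top (Γ := Γ) d
  have : ∀ j k, n + 1 ≤ k → k0 ≤ k + j → F2 Γ d k := by
    intro j
    induction j with
    | zero => exact fun k _ h => hk0 k h
    | succ j ih =>
      intro k hk h
      exact F2step (by omega) (fun z hz hc => F1high H hd hk z hz hc) (ih (k + 1) (by omega) (by omega))
  exact this k0 k hk (by omega)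

end
end NW

namespace NW
variable {G : Type} [Group G] {Γ : Geo G}

theorem FP_of_far {d k : ℕ} (hk : 1 ≤ k) (u : List G → ℤ) (M : ℕ)
    (h : ∀ l, Γ.PD d Set.univ k l → (∀ x ∈ l, M ≤ Γ.nm x) → u l = 0) : FP Γ d k u := by
  refine (lists_finite (Γ.fin (M + d)) k).subset ?_
  rintro l ⟨h1, h2⟩
  refine ⟨h1.1, fun x hx => ?_⟩
  by_contra hc
  refine h2 (h l h1 (fun y hy => ?_))
  have a := Γ.nm_le x y
  have b := h1.2.2 x hx y hy
  have c : ¬ Γ.nm x ≤ M + d := hc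
  omega

theorem finite_far {S : Set (List G)} (hS : S.Finite) : ∃ M, ∀ l ∈ S, ∀ x ∈ l, Γ.nm x < M := by
  obtain ⟨M, hM⟩ := ((Geo.verts_finite hS).image Γ.nm).bddAbove
  refine ⟨M + 1, fun l hl x hx => ?_⟩
  have := hM ⟨x, ⟨l, hl, hx⟩, rfl⟩
  omega

theorem FP.far {d k : ℕ} {u : List G → ℤ} (hu : FP Γ d k u) :
    ∃ M, ∀ l, Γ.PD d Set.univ k l → (∃ x ∈ l, M ≤ Γ.nm x) → u l = 0 := by
  obtain ⟨M, hM⟩ := finite_far (Γ := Γ) hu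
  refine ⟨M, fun l hl ⟨x, hx, h⟩ => ?_⟩
  by_contra hc
  have := hM l ⟨hl, hc⟩ x hx
  omega

theorem SF_far {N : ℕ} {c : List G → ℤ} (hc : Γ.SF c N) (r : ℕ) :
    ∃ M, ∀ l : List G, l.length = N → Γ.Dm r l → (∃ x ∈ l, M ≤ Γ.nm x) → c l = 0 := by
  obtain ⟨M, hM⟩ := finite_far (Γ := Γ) (hc r)
  refine ⟨M, fun l hl hr ⟨x, hx, h⟩ => ?_⟩
  by_contra hc
  have := hM l ⟨hl, hr, hc⟩ x hx
  omega

theorem FP.comb {d k : ℕ} {u v : List G → ℤ} (hu : FP Γ d k u) (hv : FP Γ d k v) (i j : ℤ) :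
    FP Γ d k (fun l => i * u l + j * v l) := by
  refine (Set.Finite.union hu hv).subset ?_
  rintro l ⟨h1, h2⟩
  by_cases h : u l = 0
  · right
    refine ⟨h1, fun h' => h2 ?_⟩
    simp [h, h']
  · exact Or.inl ⟨h1, h⟩

/-- Boundary data. -/
structure Bdy (Γ : Geo G) (X : Type*) [MetricSpace X] where
  ray : X → ℕ → G
  zero : ∀ ξ, ray ξ 0 = 1
  par : ∀ ξ t, Γ.par (ray ξ (t + 1)) = ray ξ t
  nm : ∀ ξ t, Γ.nm (ray ξ t) = t
  κ : ℕ
  D0 : ℕ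
  V1 : ∀ T, ∃ ε > 0, ∀ ξ η, dist ξ η < ε → Γ.D (ray ξ T) (ray η T) ≤ κ
  V2 : ∀ (R : ℕ) (ε : ℝ), 0 < ε → ∃ T, ∀ ξ η s t, T ≤ s → Γ.D (ray ξ s) (ray η t) ≤ R → dist ξ η < ε
  shadow : ∀ g, ∃ ξ, Γ.D (ray ξ (Γ.nm g)) g ≤ D0

namespace Bdy
variable {X : Type*} [MetricSpace X] (β : Bdy Γ X)

theorem anc (ξ : X) (t i : ℕ) : Γ.par^[i] (β.ray ξ (t + i)) = β.ray ξ t := by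
  induction i generalizing t with
  | zero => rfl
  | succ i ih =>
    rw [Function.iterate_succ_apply', show t + (i + 1) = (t + 1) + i by ring, ih, β.par]

theorem trunc (ξ η : X) (s t T : ℕ) :
    Γ.D (β.ray ξ (min s T)) (β.ray η (min t T)) ≤ Γ.D (β.ray ξ s) (β.ray η t) + 4 * Γ.δ := by
  have key : ∀ (ξ : X) (s : ℕ) (w : G), Γ.D (β.ray ξ (min s T)) w + s ≤
      max (s - min s T + Γ.nm w) (min s T + Γ.D (β.ray ξ s) w) + 2 * Γ.δ := by
    intro ξ s w
    have := Γ.push (s - min s T) (β.ray ξ s) w (by rw [β.nm]; omega)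
    have e : β.ray ξ s = β.ray ξ (min s T + (s - min s T)) := by congr 1; omega
    rw [e, β.anc, β.nm, ← e] at this
    omega
  have h1 := key ξ s (β.ray η t)
  have h2 := key η t (β.ray ξ (min s T))
  rw [β.nm] at h1 h2
  rw [Γ.symm (β.ray η (min t T)), Γ.symm (β.ray η t)] at h2
  have h3 := Γ.nm_le (β.ray ξ s) (β.ray η t)
  have h4 := Γ.nm_le (β.ray η t) (β.ray ξ s)
  rw [β.nm, β.nm] at h3 h4
  rw [Γ.symm] at h4
  omega

/-- union of rays -/
def Y (A : Set X) : Set G := {g | ∃ ζ ∈ A, ∃ t, β.ray ζ t = g}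

theorem Cl_Y {A : Set X} (hA : A.Nonempty) : Γ.Cl (β.Y A) := by
  constructor
  · obtain ⟨ζ, hζ⟩ := hA
    exact ⟨ζ, hζ, 0, β.zero ζ⟩
  · rintro _ ⟨ζ, hζ, t, rfl⟩
    cases t with
    | zero => exact ⟨ζ, hζ, 0, by rw [β.zero, Γ.par_one]⟩
    | succ t => exact ⟨ζ, hζ, t, (β.par ζ t).symm⟩

/-- sections of a set of rays -/
theorem exists_sec {A : Set X} (hA : A.Nonempty) (R : ℕ) : ∃ s : G → X, (∀ g, s g ∈ A) ∧
    (∀ g ∈ β.Y A, β.ray (s g) (Γ.nm g) = g) ∧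
    ∀ g y, y ∈ β.Y A → Γ.D y g ≤ R → ∃ t, Γ.D (β.ray (s g) t) g ≤ R := by
  classical
  obtain ⟨ζ0, hζ0⟩ := hA
  have : ∀ g, ∃ ξ ∈ A, (g ∈ β.Y A → β.ray ξ (Γ.nm g) = g) ∧
      ∀ y, y ∈ β.Y A → Γ.D y g ≤ R → ∃ t, Γ.D (β.ray ξ t) g ≤ R := by
    intro g
    by_cases h : g ∈ β.Y A
    · obtain ⟨ζ, hζ, t, rfl⟩ := h
      exact ⟨ζ, hζ, fun _ => by rw [β.nm], fun y _ _ => ⟨t, by rw [Γ.self]; omega⟩⟩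
    · by_cases h' : ∃ y, y ∈ β.Y A ∧ Γ.D y g ≤ R
      · obtain ⟨y, ⟨ζ, hζ, t, rfl⟩, hy⟩ := h'
        exact ⟨ζ, hζ, fun h2 => absurd h2 h, fun _ _ _ => ⟨t, hy⟩⟩
      · exact ⟨ζ0, hζ0, fun h2 => absurd h2 h, fun y h1 h2 => absurd ⟨y, h1, h2⟩ h'⟩
  choose s h1 h2 using this
  exact ⟨s, h1, fun g => (h2 g).1, fun g => (h2 g).2⟩

variable {n d : ℕ} {c0 : List G → ℤ}

theorem ext (H : GCp Γ n c0) (hd : 4 * Γ.δ + 2 ≤ d) {A : Set X} (hA : A.Nonempty)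
    (f : List X → ℤ) {ε : ℝ} (hε : 0 < ε) (hf : Van A ε (n + 1) (cob f)) :
    ∃ s : G → X, (∀ g, s g ∈ A) ∧ (∀ g ∈ β.Y A, β.ray (s g) (Γ.nm g) = g) ∧
      ∃ z, FP Γ d (n + 1) z ∧ (∀ l, Γ.PD d Set.univ (n + 2) l → cob z l = 0) ∧
      ∀ l, Γ.PD d (β.Y A) (n + 1) l → z l = cob f (l.map s) := by
  classical
  obtain ⟨R, K, K', hK, hK', hKK⟩ := F2main H hd (le_refl (n + 1))
  obtain ⟨s, hs1, hs2, hs3⟩ := β.exists_sec hA R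
  refine ⟨s, hs1, hs2, ?_⟩
  let N : Set G := {g | ∃ y ∈ β.Y A, Γ.D y g ≤ R}
  let c1 : List G → ℤ := fun l => if ∀ x ∈ l, x ∈ N then cob f (l.map s) else 0
  have hc1 : FP Γ d (n + 1) c1 := by
    obtain ⟨T, hT⟩ := β.V2 (2 * R + d) ε hε
    refine FP_of_far (by omega) _ (T + R) (fun l hl hM => ?_)
    by_cases hN : ∀ x ∈ l, x ∈ N
    · simp only [c1]
      rw [if_pos hN]
      refine hf _ (by simp [hl.1]) ?_ ?_
      · intro x hx
        obtain ⟨y, -, rfl⟩ := List.mem_map.1 hx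
        exact hs1 y
      · intro x hx y hy
        obtain ⟨x, hx', rfl⟩ := List.mem_map.1 hx
        obtain ⟨y, hy', rfl⟩ := List.mem_map.1 hy
        clear hx hy
        rename' hx' => hx, hy' => hy
        obtain ⟨x', hx1, hx2⟩ := hN x hx
        obtain ⟨y', hy1, hy2⟩ := hN y hy
        obtain ⟨t1, h1⟩ := hs3 x x' hx1 hx2
        obtain ⟨t2, h2⟩ := hs3 y y' hy1 hy2
        refine hT _ _ t1 t2 ?_ ?_
        · have a := Γ.nm_le x (β.ray (s x) t1)
          rw [β.nm, Γ.symm] at a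
          have := hM x hx
          omega
        · have a := Γ.tri (β.ray (s x) t1) x (β.ray (s y) t2)
          have b := Γ.tri x y (β.ray (s y) t2)
          rw [Γ.symm y] at b
          have := hl.2.2 x hx y hy
          omega
    · simp only [c1]
      rw [if_neg hN]
  have hdc1 : ∀ l', (∀ x ∈ l', x ∈ N) → cob c1 l' = 0 := by
    intro l' hN
    rw [cob_congr c1 (fun l => cob f (l.map s)) l' (fun l'' hs'' _ => ?_)]
    · rw [cob_map (cob f) s, cob_cob]
    · simp only [c1]
      rw [if_pos (fun x hx => hN x (hs''.subset hx))]
  let e : List G → ℤ := fun l => ev (cob c1) (K l)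
  have he : FP Γ d (n + 1) e := by
    obtain ⟨M, hM⟩ := hc1.far
    refine FP_of_far (by omega) _ (M + R) (fun l hl hn => ?_)
    refine ev_zero_of_Sup _ (fun l' hl' => ?_) (hK l hl)
    refine cob_eq_zero _ _ (fun l'' hs'' hl'' => hM l'' (PD_sub hl'.1 hs'' hl'') ?_)
    have h2 := hl'.1.1
    obtain ⟨x, hx⟩ := List.exists_mem_of_length_pos (l := l'') (by omega)
    have h1 := hl.1
    obtain ⟨y, hy⟩ := List.exists_mem_of_length_pos (l := l) (by omega)
    refine ⟨x, hx, ?_⟩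
    have a := hl'.2 y hy x (hs''.subset hx)
    have b := hn y hy
    have c := Γ.nm_le y x
    omega
  refine ⟨fun l => 1 * c1 l + (-1) * e l, hc1.comb he 1 (-1), ?_, ?_⟩
  · intro l hl
    have h1 : cob e l = cob c1 l := by
      rw [cob_pull, show lin K (bd l) = sg l - B (K' l) by rw [hKK l hl]; abel, map_sub, ev_sg, ev_B]
      rw [ev_zero_of_Sup (P := fun _ => True) (cob (cob c1)) (fun l _ => cob_cob c1 l)
        (Sup_mono (fun _ _ => trivial) (hK' l hl)), sub_zero]
    rw [cob_add, cob_mul, cob_mul, h1]; ring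
  · intro l hl
    have hY : ∀ x ∈ l, x ∈ N := fun x hx => ⟨x, hl.2.1 x hx, by rw [Γ.self]; omega⟩
    have h1 : e l = 0 := by
      refine ev_zero_of_Sup _ (fun l' hl' => hdc1 l' (fun x hx => ?_)) (hK l ⟨hl.1, fun _ _ => trivial, hl.2.2⟩)
      have h1 := hl.1
      obtain ⟨y, hy⟩ := List.exists_mem_of_length_pos (l := l) (by omega)
      exact ⟨y, hl.2.1 y hy, hl'.2 y hy x hx⟩
    have h2 : c1 l = cob f (l.map s) := if_pos hY
    simp only [h1, h2]; ring

theorem T1 (hd : 4 * Γ.δ + 2 ≤ d) (hκ : β.κ ≤ d) {A : Set X} (hA : A.Nonempty) (hn : 1 ≤ n)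
    (f : List X → ℤ) {ε : ℝ} (hε : 0 < ε) (hf : Van A ε (n + 1) (cob f))
    (s : G → X) (hs1 : ∀ g, s g ∈ A) (hs2 : ∀ g ∈ β.Y A, β.ray (s g) (Γ.nm g) = g)
    (u : List G → ℤ) (hu : FP Γ d n u)
    (h : ∀ l, Γ.PD d (β.Y A) (n + 1) l → cob f (l.map s) = cob u l) : Tr n A f := by
  obtain ⟨v, hv⟩ := Γ.fill_cocycle hd (β.Cl_Y hA) n (fun l => f (l.map s) - u l) (fun l hl => by
    rw [cob_sub, cob_map, h l hl, sub_self])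
  obtain ⟨M, hM⟩ := hu.far
  obtain ⟨T, hT⟩ := β.V2 0 (ε / 3) (by positivity)
  obtain ⟨ε1, hε1, hV⟩ := β.V1 (M + T)
  let q : X → X := fun ζ => s (β.ray ζ (M + T))
  have hq : ∀ ζ ∈ A, dist ζ (q ζ) < ε / 3 := by
    intro ζ hζ
    refine hT ζ _ (M + T) (M + T) (by omega) ?_
    have := hs2 (β.ray ζ (M + T)) ⟨ζ, hζ, _, rfl⟩
    rw [β.nm] at this
    rw [this, Γ.self]
  refine ⟨fun l => v (l.map (β.ray · (M + T))) - prh id q f l, min ε1 (ε / 3), by positivity, ?_⟩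
  intro l hl hlA hsm
  have h1 : Γ.PD d (β.Y A) n (l.map (β.ray · (M + T))) := by
    refine ⟨by simp [hl], ?_, ?_⟩
    · intro x hx
      obtain ⟨y, hy, rfl⟩ := List.mem_map.1 hx
      exact ⟨y, hlA y hy, _, rfl⟩
    · intro x hx y hy
      obtain ⟨x, hx', rfl⟩ := List.mem_map.1 hx
      obtain ⟨y, hy', rfl⟩ := List.mem_map.1 hy
      exact (hV x y ((hsm x hx' y hy').trans_le (min_le_left _ _))).trans hκ
  have h2 := hv _ h1
  have h3 : u (l.map (β.ray · (M + T))) = 0 := by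
    refine hM _ ⟨h1.1, fun _ _ => trivial, h1.2.2⟩ ?_
    obtain ⟨y, hy⟩ := List.exists_mem_of_length_pos (l := l) (by omega)
    exact ⟨_, List.mem_map_of_mem hy, by rw [β.nm]; omega⟩
  have h4 := prh_formula id q f l
  have h5 : prh id q (cob f) l = 0 := by
    refine prh_zero _ _ _ _ (fun l' hl' hx => hf l' (by omega) ?_ ?_)
    · intro x hx'
      rcases hx x hx' with ⟨y, hy, e⟩ | ⟨y, hy, e⟩
      · rw [e]; exact hlA y hy
      · rw [e]; exact hs1 _
    · have key : ∀ x ∈ l', ∃ y ∈ l, dist x y < ε / 3 := by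
        intro x hx'
        rcases hx x hx' with ⟨y, hy, e⟩ | ⟨y, hy, e⟩
        · exact ⟨y, hy, by rw [e]; simpa using by positivity⟩
        · exact ⟨y, hy, by rw [e, dist_comm]; exact hq y (hlA y hy)⟩
      intro x hx' y hy'
      obtain ⟨x1, a1, b1⟩ := key x hx'
      obtain ⟨y1, a2, b2⟩ := key y hy'
      have b3 := (hsm x1 a1 y1 a2).trans_le (min_le_right _ _)
      rw [dist_comm] at b2
      have := dist_triangle x x1 y
      have := dist_triangle x1 y1 y
      linarith
  have h6 : (l.map (β.ray · (M + T))).map s = l.map q := by simp [q, Function.comp_def]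
  simp only [h6, h3, sub_zero] at h2
  show f l - cob (fun l => v (l.map (β.ray · (M + T))) - prh id q f l) l = 0
  rw [cob_sub, cob_map]
  simp only [List.map_id, h5, add_zero] at h4
  linarith

end Bdy
end NW

namespace NW
variable {G : Type} [Group G] {Γ : Geo G}

theorem pr_dup {V W : Type*} (p q : V → W) (l : List V) (h : ∀ x ∈ l, p x = q x) :
    pr p q l ∈ Sup (fun l' : List W => ¬ l'.Nodup) := by
  induction l with
  | nil => exact Submodule.zero_mem _
  | cons a l ih =>
    refine Submodule.sub_mem _ (sg_mem ?_) (cone_mem _ (fun l' hl' => ?_) (ih (fun x hx => h x (by simp [hx]))))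
    · rw [h a (by simp)]; simp
    · exact fun hc => hl' (List.nodup_cons.1 hc).2

theorem prh_dup {V W : Type*} (p q : V → W) (c : List W → ℤ) (hc : ∀ l, ¬ l.Nodup → c l = 0)
    (l : List V) (h : ∀ x ∈ l, p x = q x) : prh p q c l = 0 :=
  ev_zero_of_Sup _ hc (pr_dup p q l h)

namespace Bdy
variable {X : Type*} [MetricSpace X] (β : Bdy Γ X) {n d : ℕ} {c0 : List G → ℤ}

/-- fundamental cocycle on the boundary -/
def al (c0 : List G → ℤ) (T : ℕ) : List X → ℤ := fun l => c0 (1 :: l.map (β.ray · T))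

theorem cob_al (H : GCp Γ n c0) (T : ℕ) (l : List X) (hl : l.length = n + 1) :
    cob (β.al c0 T) l = c0 (l.map (β.ray · T)) := by
  have h1 := H.coc (1 :: l.map (β.ray · T)) (by simp [hl])
  rw [cob] at h1
  unfold al
  rw [cob_map (fun l => c0 (1 :: l)) (β.ray · T)]
  linarith

theorem T3 (H : GCp Γ n c0) (hnd : ∀ l, ¬ l.Nodup → c0 l = 0) {M0 : ℕ}
    (hM0 : ∀ l : List G, l.length = n + 1 → Γ.Dm (d + 2 * β.D0 + 4 * Γ.δ) l →
      (∃ x ∈ l, M0 ≤ Γ.nm x) → c0 l = 0) (Y : Set G) (s : G → X)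
    (hs : ∀ v ∈ Y, Γ.D (β.ray (s v) (Γ.nm v)) v ≤ β.D0) :
    ∃ u, FP Γ d n u ∧ ∀ l, Γ.PD d Y (n + 1) l → cob (β.al c0 (M0 + d)) (l.map s) = c0 l + cob u l := by
  classical
  have hn := H.hn
  set T := M0 + d with hT
  let τ : G → G := fun v => β.ray (s v) (Γ.nm v)
  let qτ : G → G := fun v => β.ray (s v) (min (Γ.nm v) T)
  let pT : G → G := fun v => β.ray (s v) T
  let u1 : List G → ℤ := fun l => if ∀ x ∈ l, x ∈ Y then prh id τ c0 l else 0
  let u2 : List G → ℤ := fun l => if ∀ x ∈ l, x ∈ Y then prh qτ pT c0 l else 0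
  have hτd : ∀ v ∈ Y, ∀ w ∈ Y, Γ.D v w ≤ d → Γ.D (τ v) (τ w) ≤ d + 2 * β.D0 := by
    intro v hv w hw h
    have a := Γ.tri (τ v) v (τ w)
    have b := Γ.tri v w (τ w)
    rw [Γ.symm w] at b
    have := hs v hv
    have := hs w hw
    simp only [τ] at *
    omega
  have hu1 : FP Γ d n u1 := by
    refine FP_of_far hn _ M0 (fun l hl hM => ?_)
    simp only [u1]
    split_ifs with hY
    · refine prh_zero _ _ _ _ (fun l' hl' hx => ?_)
      refine hM0 l' (by rw [hl', hl.1]) ?_ ?_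
      · have key : ∀ x ∈ l', ∃ y ∈ l, Γ.D x y ≤ β.D0 := by
          intro x hx'
          rcases hx x hx' with ⟨y, hy, e⟩ | ⟨y, hy, e⟩
          · exact ⟨y, hy, by rw [e]; simp [Γ.self]⟩
          · exact ⟨y, hy, by rw [e]; exact hs y (hY y hy)⟩
        intro x hx' y hy'
        obtain ⟨x1, a1, b1⟩ := key x hx'
        obtain ⟨y1, a2, b2⟩ := key y hy'
        have b3 := hl.2.2 x1 a1 y1 a2
        rw [Γ.symm] at b2
        have := Γ.tri x x1 y
        have := Γ.tri x1 y1 y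
        omega
      · obtain ⟨x, hx'⟩ := List.exists_mem_of_length_pos (l := l') (by omega)
        refine ⟨x, hx', ?_⟩
        rcases hx x hx' with ⟨y, hy, e⟩ | ⟨y, hy, e⟩
        · rw [e]; exact hM y hy
        · rw [e]; simp only [τ]; rw [β.nm]; exact hM y hy
    · rfl
  have hu2 : FP Γ d n u2 := by
    refine FP_of_far hn _ T (fun l hl hM => ?_)
    simp only [u2]
    split_ifs with hY
    · refine prh_dup _ _ _ hnd l (fun x hx => ?_)
      simp only [qτ, pT]
      rw [min_eq_right (hM x hx)]
    · rfl
  refine ⟨fun l => 1 * u1 l + 1 * u2 l, hu1.comb hu2 1 1, fun l hl => ?_⟩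
  have e1 : cob u1 l = cob (prh id τ c0) l := cob_congr _ _ _ (fun l' h _ =>
    if_pos (fun x hx => hl.2.1 x (h.subset hx)))
  have e2 : cob u2 l = cob (prh qτ pT c0) l := cob_congr _ _ _ (fun l' h _ =>
    if_pos (fun x hx => hl.2.1 x (h.subset hx)))
  have z : ∀ p q : G → G, prh p q (cob c0) l = 0 := fun p q =>
    prh_zero _ _ _ _ (fun l' hl' _ => H.coc l' (by rw [hl', hl.1]))
  have f1 := prh_formula id τ c0 l
  have f2 := prh_formula qτ pT c0 l
  rw [z, add_zero] at f1 f2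
  have f3 : c0 (l.map qτ) = c0 (l.map τ) := by
    by_cases hc : ∀ x ∈ l, M0 ≤ Γ.nm x
    · obtain ⟨y, hy⟩ := List.exists_mem_of_length_pos (l := l) (by rw [hl.1]; omega)
      rw [hM0 (l.map qτ) (by simp [hl.1]) ?_ ⟨qτ y, List.mem_map_of_mem hy, ?_⟩,
        hM0 (l.map τ) (by simp [hl.1]) ?_ ⟨τ y, List.mem_map_of_mem hy, ?_⟩]
      · intro a ha b hb
        obtain ⟨x, hx, rfl⟩ := List.mem_map.1 ha
        obtain ⟨y, hy, rfl⟩ := List.mem_map.1 hb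
        have := hτd x (hl.2.1 x hx) y (hl.2.1 y hy) (hl.2.2 x hx y hy)
        omega
      · simp only [τ]; rw [β.nm]; exact hc y hy
      · intro a ha b hb
        obtain ⟨x, hx, rfl⟩ := List.mem_map.1 ha
        obtain ⟨y, hy, rfl⟩ := List.mem_map.1 hb
        have h1 := hτd x (hl.2.1 x hx) y (hl.2.1 y hy) (hl.2.2 x hx y hy)
        have h2 := β.trunc (s x) (s y) (Γ.nm x) (Γ.nm y) T
        simp only [τ, qτ] at *
        omega
      · simp only [qτ]; rw [β.nm]; have := hc y hy; omega
    · push Not at hc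
      obtain ⟨y, hy, hlt⟩ := hc
      congr 1
      refine List.map_congr_left (fun x hx => ?_)
      have a := Γ.nm_le x y
      have b := hl.2.2 x hx y hy
      simp only [qτ, τ]
      rw [min_eq_left (by omega)]
  have f4 : cob (β.al c0 T) (l.map s) = c0 (l.map pT) := by
    rw [β.cob_al H T _ (by simp [hl.1]), List.map_map]; rfl
  rw [f4, cob_add, cob_mul, cob_mul, e1, e2]
  simp only [List.map_id] at f1
  linarith

theorem pp (β : Bdy Γ X) [Nonempty X] (H : GCp Γ n c0) (hnd : ∀ l, ¬ l.Nodup → c0 l = 0) :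
    ∃ α : List X → ℤ, ∃ ε0, PP X n α ε0 := by
  have hn := H.hn
  obtain ⟨d, hd, hκ⟩ : ∃ d, 4 * Γ.δ + 2 ≤ d ∧ β.κ ≤ d := ⟨max (4 * Γ.δ + 2) β.κ, by simp, by simp⟩
  obtain ⟨M0, hM0⟩ := SF_far H.sf (d + 2 * β.D0 + 4 * Γ.δ)
  obtain ⟨ε0, hε0, hV⟩ := β.V1 (M0 + d)
  have P1 : Van Set.univ ε0 (n + 1) (cob (β.al c0 (M0 + d))) := by
    intro l hl _ hsm
    rw [β.cob_al H _ l hl]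
    obtain ⟨y, hy⟩ := List.exists_mem_of_length_pos (l := l) (by omega)
    refine hM0 _ (by simp [hl]) ?_ ⟨_, List.mem_map_of_mem hy, by rw [β.nm]; omega⟩
    intro a ha b hb
    obtain ⟨x, hx, rfl⟩ := List.mem_map.1 ha
    obtain ⟨y, hy, rfl⟩ := List.mem_map.1 hb
    have := hV x y (hsm x hx y hy)
    omega
  refine ⟨β.al c0 (M0 + d), ε0, hε0, hn, P1, ?_, ?_, ?_⟩
  · intro γ ε hε hγ
    obtain ⟨s, hs1, hs2, z, hz, hz', hzf⟩ := β.ext H hd Set.univ_nonempty γ hε hγ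
    obtain ⟨j, u, hu, hj⟩ := F1gen H hd z hz hz'
    obtain ⟨u', hu', h3⟩ := β.T3 H hnd hM0 (β.Y Set.univ) s (fun v hv => by rw [hs2 v hv, Γ.self]; omega)
    refine ⟨j, β.T1 hd hκ Set.univ_nonempty hn _ (lt_min hε hε0) ?_ s hs1 hs2
      (fun l => 1 * u l + (-j) * u' l) (hu.comb hu' _ _) ?_⟩
    · intro l h1 h2 h4
      rw [cob_sub, cob_mul, hγ l h1 h2 (h4.mono (min_le_left _ _)), P1 l h1 h2 (h4.mono (min_le_right _ _))]
      simp
    · intro l hl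
      have a := hj l ⟨hl.1, fun _ _ => trivial, hl.2.2⟩
      rw [hzf l hl] at a
      rw [cob_sub, cob_mul, cob_add, cob_mul, cob_mul, a, h3 l hl]
      ring
  · intro j ⟨ν, ε, hε, hν⟩
    choose ξ hξ using β.shadow
    obtain ⟨u', hu', h3⟩ := β.T3 H hnd hM0 Set.univ ξ (fun v _ => hξ v)
    obtain ⟨T, hT⟩ := β.V2 (d + 2 * β.D0) ε hε
    have hu0 : FP Γ d n (fun l => j * β.al c0 (M0 + d) (l.map ξ) - cob ν (l.map ξ)) := by
      refine FP_of_far hn _ T (fun l hl hM => hν _ (by simp [hl.1]) (fun _ _ => trivial) ?_)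
      intro a ha b hb
      obtain ⟨x, hx, rfl⟩ := List.mem_map.1 ha
      obtain ⟨y, hy, rfl⟩ := List.mem_map.1 hb
      refine hT _ _ (Γ.nm x) (Γ.nm y) (hM x hx) ?_
      have a := Γ.tri (β.ray (ξ x) (Γ.nm x)) x (β.ray (ξ y) (Γ.nm y))
      have b := Γ.tri x y (β.ray (ξ y) (Γ.nm y))
      rw [Γ.symm y] at b
      have := hξ x
      have := hξ y
      have := hl.2.2 x hx y hy
      omega
    refine F1tors H hd j _ (hu0.comb hu' 1 (-j)) (fun l hl => ?_)
    rw [cob_add, cob_mul, cob_mul, cob_sub, cob_mul, cob_map, cob_map, cob_cob, h3 l hl]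
    ring
  · intro A hA f ε hε hf
    rcases A.eq_empty_or_nonempty with rfl | hne
    · refine Tr.of_van one_pos (fun l hl hl2 _ => ?_)
      obtain ⟨y, hy⟩ := List.exists_mem_of_length_pos (l := l) (by omega)
      exact absurd (hl2 y hy) (by simp)
    obtain ⟨η, hη⟩ : ∃ η, η ∉ closure A := by
      by_contra hc
      push Not at hc
      exact hA hc
    obtain ⟨e1, he1, hball⟩ := Metric.isOpen_iff.1 isClosed_closure.isOpen_compl η hη
    obtain ⟨M, hM⟩ := SF_far H.sf d
    obtain ⟨T, hT⟩ := β.V2 M e1 he1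
    let h := β.ray η T
    have Hh := H.trans h⁻¹
    obtain ⟨s, hs1, hs2, z, hz, hz', hzf⟩ := β.ext H hd hne f hε hf
    obtain ⟨j, u, hu, hj⟩ := F1gen Hh hd z hz hz'
    refine β.T1 hd hκ hne hn f hε hf s hs1 hs2 u hu (fun l hl => ?_)
    rw [← hzf l hl, hj l ⟨hl.1, fun _ _ => trivial, hl.2.2⟩]
    have : c0 (l.map (h⁻¹ * ·)) = 0 := by
      obtain ⟨y, hy⟩ := List.exists_mem_of_length_pos (l := l) (by rw [hl.1]; omega)
      refine hM _ (by simp [hl.1]) ?_ ⟨h⁻¹ * y, List.mem_map_of_mem hy, ?_⟩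
      · intro a ha b hb
        obtain ⟨x, hx, rfl⟩ := List.mem_map.1 ha
        obtain ⟨y, hy, rfl⟩ := List.mem_map.1 hb
        rw [Γ.inv]
        exact hl.2.2 x hx y hy
      · by_contra hc
        obtain ⟨ζ, hζ, t, rfl⟩ := hl.2.1 y hy
        have h1 : Γ.D h (β.ray ζ t) ≤ M := by
          rw [← Γ.inv h⁻¹ h, inv_mul_cancel]
          unfold Geo.nm at hc
          omega
        have h2 := hT η ζ T t le_rfl h1
        exact hball (by rw [Metric.mem_ball, dist_comm]; exact h2) (subset_closure hζ)
    rw [this]; ring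

end Bdy
end NW

namespace NW
section
variable {G : Type} [Group G] (S : Set G)

theorem cay_adj (x y : G) : (cayleyGraph G S).Adj x y ↔ x ≠ y ∧ (x⁻¹ * y ∈ S ∨ y⁻¹ * x ∈ S) := by
  unfold cayleyGraph
  rw [SimpleGraph.fromRel_adj]

/-- left translation -/
def cayHom (h : G) : cayleyGraph G S →g cayleyGraph G S where
  toFun x := h * x
  map_rel' := by
    intro a b hab
    rw [cay_adj] at hab ⊢
    refine ⟨fun hc => hab.1 (mul_left_cancel hc), ?_⟩
    have e1 : (h * a)⁻¹ * (h * b) = a⁻¹ * b := by group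
    have e2 : (h * b)⁻¹ * (h * a) = b⁻¹ * a := by group
    rw [e1, e2]
    exact hab.2

theorem cay_reach (hS : Subgroup.closure S = ⊤) (x : G) : (cayleyGraph G S).Reachable 1 x := by
  have step : ∀ a b : G, (a⁻¹ * b ∈ S ∨ b⁻¹ * a ∈ S) → (cayleyGraph G S).Reachable 1 a →
      (cayleyGraph G S).Reachable 1 b := by
    intro a b h ha
    by_cases e : a = b
    · rw [← e]; exact ha
    · exact ha.trans (SimpleGraph.Adj.reachable ((cay_adj S a b).2 ⟨e, h⟩))
  have hx : x ∈ Subgroup.closure S := by rw [hS]; trivial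
  induction hx using Subgroup.closure_induction_right with
  | one => exact SimpleGraph.Reachable.refl _
  | mul_right a _ s hs ih => exact step a _ (Or.inl (by simpa using hs)) ih
  | mul_inv_cancel a _ s hs ih => exact step a _ (Or.inr (by simpa using hs)) ih

theorem cay_conn (hS : Subgroup.closure S = ⊤) : (cayleyGraph G S).Connected :=
  { preconnected := fun x y => (cay_reach S hS x).symm.trans (cay_reach S hS y)
    nonempty := ⟨1⟩ }

theorem cay_inv_le (hS : Subgroup.closure S = ⊤) (h x y : G) :
    (cayleyGraph G S).dist (h * x) (h * y) ≤ (cayleyGraph G S).dist x y := by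
  obtain ⟨p, hp⟩ := (cay_conn S hS).exists_walk_length_eq_dist x y
  rw [← hp, ← SimpleGraph.Walk.length_map (cayHom S h)]
  exact SimpleGraph.dist_le _

theorem cay_inv (hS : Subgroup.closure S = ⊤) (h x y : G) :
    (cayleyGraph G S).dist (h * x) (h * y) = (cayleyGraph G S).dist x y := by
  refine le_antisymm (cay_inv_le S hS h x y) ?_
  have := cay_inv_le S hS h⁻¹ (h * x) (h * y)
  simpa using this

theorem cay_par (hS : Subgroup.closure S = ⊤) (g : G) : ∃ g', (g = 1 → g' = 1) ∧
    (g ≠ 1 → (cayleyGraph G S).dist 1 g' + 1 = (cayleyGraph G S).dist 1 g ∧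
      (cayleyGraph G S).Adj g' g) := by
  have hc := cay_conn S hS
  by_cases h : g = 1
  · exact ⟨1, fun _ => rfl, fun h' => absurd h h'⟩
  · obtain ⟨p, hp⟩ := hc.exists_walk_length_eq_dist g 1
    cases p with
    | nil => exact absurd rfl h
    | @cons _ v _ hadj q =>
      refine ⟨v, fun h' => absurd h' h, fun _ => ⟨?_, hadj.symm⟩⟩
      have h1 := SimpleGraph.dist_le q
      rw [SimpleGraph.Walk.length_cons] at hp
      have h2 := hc.dist_triangle (u := g) (v := v) (w := 1)
      rw [SimpleGraph.dist_eq_one_iff_adj.2 hadj] at h2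
      rw [SimpleGraph.dist_comm, SimpleGraph.dist_comm (u := 1) (v := g)]
      omega

theorem cay_fin (hSf : S.Finite) (hS : Subgroup.closure S = ⊤) (r : ℕ) :
    {g | (cayleyGraph G S).dist 1 g ≤ r}.Finite := by
  induction r with
  | zero =>
    refine (Set.finite_singleton (1 : G)).subset (fun g hg => ?_)
    have : (cayleyGraph G S).dist 1 g = 0 := Nat.le_zero.1 hg
    exact ((cay_conn S hS).dist_eq_zero_iff.1 this).symm
  | succ r ih =>
    have hf : (S ∪ S⁻¹).Finite := hSf.union hSf.inv
    refine (ih.union (Set.Finite.image2 (fun a b => a * b) ih hf)).subset (fun g hg => ?_)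
    by_cases h1 : g = 1
    · left; rw [h1]; simp
    · right
      obtain ⟨v, -, hv⟩ := cay_par S hS g
      obtain ⟨h2, h3⟩ := hv h1
      have hg' : (cayleyGraph G S).dist 1 g ≤ r + 1 := hg
      refine ⟨v, show (cayleyGraph G S).dist 1 v ≤ r by omega, v⁻¹ * g, ?_, by simp⟩
      rcases ((cay_adj S v g).1 h3).2 with h | h
      · exact Or.inl h
      · right
        rw [Set.mem_inv]
        simpa using h

/-- real valued distance -/
def dR (Γ : Geo G) (x y : G) : ℝ := (Γ.D x y : ℝ)

theorem exists_Geo (hSf : S.Finite) (hS : Subgroup.closure S = ⊤) (δ : ℝ)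
    (hyp : IsGromovHyperbolicDist (wordDist G S) δ) : ∃ Γ : Geo G, wordDist G S = dR Γ := by
  have hc := cay_conn S hS
  choose par hp1 hp2 using cay_par S hS
  refine ⟨{ D := (cayleyGraph G S).dist
            δ := ⌈δ⌉₊
            self := fun x => SimpleGraph.dist_self
            eq_of := fun x y h => hc.dist_eq_zero_iff.1 h
            symm := fun x y => SimpleGraph.dist_comm
            tri := fun x y z => hc.dist_triangle
            inv := cay_inv S hS
            fin := cay_fin S hSf hS
            hyp := ?_
            par := par
            par_one := hp1 1 rfl
            par_len := fun g hg => (hp2 g hg).1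
            par_adj := fun g hg => SimpleGraph.dist_eq_one_iff_adj.2 (hp2 g hg).2 }, rfl⟩
  intro x y z w
  have h := hyp x y z w
  unfold gromovProd wordDist at h
  have hd : δ ≤ (⌈δ⌉₊ : ℝ) := Nat.le_ceil δ
  have e1 := SimpleGraph.dist_comm (G := cayleyGraph G S) (u := z) (v := y)
  rw [e1] at h
  set Γ := cayleyGraph G S
  have : ((Γ.dist x y + Γ.dist z w : ℕ) : ℝ) ≤ ((max (Γ.dist x z + Γ.dist y w) (Γ.dist x w + Γ.dist y z) + 2 * ⌈δ⌉₊ : ℕ) : ℝ) := by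
    push_cast
    rcases min_choice (((Γ.dist x w : ℝ) + Γ.dist z w - Γ.dist x z) / 2) (((Γ.dist z w : ℝ) + Γ.dist y w - Γ.dist y z) / 2) with e | e
    · rw [e] at h
      have := le_max_left ((Γ.dist x z : ℝ) + Γ.dist y w) (Γ.dist x w + Γ.dist y z)
      linarith
    · rw [e] at h
      have := le_max_right ((Γ.dist x z : ℝ) + Γ.dist y w) (Γ.dist x w + Γ.dist y z)
      linarith
  exact_mod_cast this

end
end NW

namespace NW
section
variable {G : Type} [Group G] {Γ : Geo G}
open Filter

/-- Gromov product at the identity -/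
def gp (Γ : Geo G) (x y : G) : ℝ := ((Γ.nm x : ℝ) + Γ.nm y - Γ.D x y) / 2

theorem gp_eq (x y : G) : gromovProd (dR Γ) x y 1 = gp Γ x y := by
  unfold gromovProd dR gp Geo.nm
  rw [Γ.symm x 1, Γ.symm y 1]

theorem gp_symm (x y : G) : gp Γ x y = gp Γ y x := by
  unfold gp; rw [Γ.symm x y]; ring

theorem gp_nonneg (x y : G) : 0 ≤ gp Γ x y := by
  unfold gp
  have h := Γ.tri x 1 y
  rw [Γ.symm x 1] at h
  have : (Γ.D x y : ℝ) ≤ Γ.nm x + Γ.nm y := by exact_mod_cast h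
  linarith

theorem gp_tri (x y z : G) {M : ℝ} (h1 : M ≤ gp Γ x z) (h2 : M ≤ gp Γ z y) : M - Γ.δ ≤ gp Γ x y := by
  have h := Γ.hyp x y z 1
  rw [Γ.symm z 1, Γ.symm y 1, Γ.symm x 1] at h
  unfold gp at *
  have h' : (Γ.D x y : ℝ) + Γ.nm z ≤ max ((Γ.D x z : ℝ) + Γ.nm y) (Γ.nm x + Γ.D y z) + 2 * Γ.δ := by
    exact_mod_cast h
  rw [Γ.symm z y] at h2
  rcases max_choice ((Γ.D x z : ℝ) + Γ.nm y) (Γ.nm x + Γ.D y z) with e | e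
  · rw [e] at h'; linarith
  · rw [e] at h'; linarith

theorem gp_self (x : G) : gp Γ x x = Γ.nm x := by
  unfold gp; rw [Γ.self]; push_cast; ring

/-- the ancestor at a given level -/
def tr' (Γ : Geo G) (t : ℕ) (v : G) : G := Γ.par^[Γ.nm v - t] v

theorem nm_tr' {t : ℕ} {v : G} (h : t ≤ Γ.nm v) : Γ.nm (tr' Γ t v) = t := by
  unfold tr'; rw [Γ.nm_anc]; omega

theorem gp_tr' {t : ℕ} {v : G} (h : t ≤ Γ.nm v) : (t : ℝ) ≤ gp Γ (tr' Γ t v) v := by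
  unfold gp
  rw [nm_tr' h]
  have := Γ.D_anc (Γ.nm v - t) v
  have h2 : Γ.D (tr' Γ t v) v + t ≤ Γ.nm v := by unfold tr'; omega
  have : (Γ.D (tr' Γ t v) v : ℝ) + t ≤ Γ.nm v := by exact_mod_cast h2
  linarith

theorem par_tr' {t : ℕ} {v : G} (h : t + 1 ≤ Γ.nm v) : Γ.par (tr' Γ (t + 1) v) = tr' Γ t v := by
  unfold tr'
  rw [← Function.iterate_succ_apply' Γ.par]
  congr 2
  omega

/-- tree rays -/
structure TRay (Γ : Geo G) (γ : ℕ → G) : Prop where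
  nm : ∀ t, Γ.nm (γ t) = t
  par : ∀ t, Γ.par (γ (t + 1)) = γ t

theorem TRay.zero {γ : ℕ → G} (h : TRay Γ γ) : γ 0 = 1 := (Γ.eq_of _ _ (h.nm 0)).symm

theorem TRay.gp_le {γ : ℕ → G} (h : TRay Γ γ) (s i : ℕ) : (s : ℝ) ≤ gp Γ (γ s) (γ (s + i)) := by
  have e : γ s = tr' Γ s (γ (s + i)) := by
    unfold tr'
    rw [h.nm, Nat.add_sub_cancel_left]
    induction i with
    | zero => rfl
    | succ i ih => rw [Function.iterate_succ_apply, ← add_assoc, h.par]; exact ih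
  conv_rhs => rw [e]
  exact gp_tr' (by rw [h.nm]; omega)

theorem TRay.gp {γ : ℕ → G} (h : TRay Γ γ) {M : ℝ} {s t : ℕ} (hs : M ≤ s) (ht : M ≤ t) :
    M ≤ gp Γ (γ s) (γ t) := by
  rcases le_total s t with h' | h'
  · obtain ⟨i, rfl⟩ := Nat.exists_eq_add_of_le h'
    exact hs.trans (h.gp_le s i)
  · obtain ⟨i, rfl⟩ := Nat.exists_eq_add_of_le h'
    rw [gp_symm]
    exact ht.trans (h.gp_le t i)

theorem koenig {ι : Type*} (F : Ultrafilter ι) (u : ι → G) (hu : ∀ t, ∀ᶠ i in (F : Filter ι), t ≤ Γ.nm (u i)) :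
    ∃ γ, TRay Γ γ ∧ ∀ t, ∀ᶠ i in (F : Filter ι), t ≤ Γ.nm (u i) ∧ tr' Γ t (u i) = γ t := by
  have h : ∀ t, ∃ g, ∀ᶠ i in (F : Filter ι), t ≤ Γ.nm (u i) ∧ tr' Γ t (u i) = g := by
    intro t
    have h1 : ∀ᶠ i in (F : Filter ι), ∃ g ∈ {g | Γ.D 1 g ≤ t}, t ≤ Γ.nm (u i) ∧ tr' Γ t (u i) = g := by
      filter_upwards [hu t] with i hi
      exact ⟨tr' Γ t (u i), (nm_tr' hi).le, hi, rfl⟩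
    obtain ⟨g, -, hg⟩ := (Ultrafilter.eventually_exists_mem_iff (Γ.fin t)).1 h1
    exact ⟨g, hg⟩
  choose γ hγ using h
  refine ⟨γ, ⟨fun t => ?_, fun t => ?_⟩, hγ⟩
  · obtain ⟨i, h1, h2⟩ := (hγ t).exists
    rw [← h2, nm_tr' h1]
  · obtain ⟨i, ⟨h1, h2⟩, h3, h4⟩ := ((hγ (t + 1)).and (hγ t)).exists
    rw [← h2, ← h4, par_tr' h1]

theorem TRay.conv {γ : ℕ → G} (h : TRay Γ γ) : ConvergesAtInfinity (dR Γ) 1 γ := by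
  unfold ConvergesAtInfinity
  rw [tendsto_atTop]
  intro M
  filter_upwards [eventually_ge_atTop ((⌈M⌉₊, ⌈M⌉₊) : ℕ × ℕ)] with p hp
  rw [gp_eq]
  exact h.gp (Nat.ceil_le.1 hp.1) (Nat.ceil_le.1 hp.2)

theorem ev_prod {P : ℕ × ℕ → Prop} (h : ∀ᶠ p in atTop, P p) : ∃ N, ∀ i j, N ≤ i → N ≤ j → P (i, j) := by
  obtain ⟨⟨a, b⟩, hab⟩ := eventually_atTop.1 h
  exact ⟨max a b, fun i j hi hj => hab (i, j) ⟨(le_max_left a b).trans hi, (le_max_right a b).trans hj⟩⟩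

theorem bs_nm (u : BoundarySeq (dR Γ) 1) (M : ℝ) : ∃ N, ∀ i j, N ≤ i → N ≤ j → M ≤ gp Γ (u.seq i) (u.seq j) := by
  obtain ⟨N, hN⟩ := ev_prod ((tendsto_atTop.1 u.conv) M)
  refine ⟨N, fun i j hi hj => ?_⟩
  have := hN i j hi hj
  rw [gp_eq] at this
  exact this

theorem bs_ray (u : BoundarySeq (dR Γ) 1) : ∃ γ, ∃ h : TRay Γ γ, boundaryRel (dR Γ) 1 u ⟨γ, h.conv⟩ := by
  have hnm : ∀ t, ∀ᶠ i in ((hyperfilter ℕ : Ultrafilter ℕ) : Filter ℕ), t ≤ Γ.nm (u.seq i) := by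
    intro t
    refine Nat.hyperfilter_le_atTop ?_
    obtain ⟨N, hN⟩ := bs_nm u t
    filter_upwards [eventually_ge_atTop N] with i hi
    have := hN i i hi hi
    rw [gp_self] at this
    exact_mod_cast this
  obtain ⟨γ, h, hγ⟩ := koenig (hyperfilter ℕ) u.seq hnm
  refine ⟨γ, h, ?_⟩
  unfold boundaryRel
  rw [tendsto_atTop]
  intro M
  obtain ⟨N, hN⟩ := bs_nm u (M + 2 * Γ.δ)
  set t := ⌈M + 2 * Γ.δ⌉₊ with ht
  have htM : M + 2 * Γ.δ ≤ t := Nat.le_ceil _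
  obtain ⟨i, hi, h1, h2⟩ := ((Filter.Eventually.filter_mono Nat.hyperfilter_le_atTop (eventually_ge_atTop N)).and (hγ t)).exists
  filter_upwards [eventually_ge_atTop ((N, t) : ℕ × ℕ)] with p hp
  rw [gp_eq]
  have a1 := hN p.1 i hp.1 hi
  have a2 : M + 2 * Γ.δ ≤ gp Γ (γ t) (u.seq i) := htM.trans (h2 ▸ gp_tr' h1)
  have a3 : M + 2 * Γ.δ ≤ gp Γ (γ t) (γ p.2) := h.gp htM (htM.trans (by exact_mod_cast hp.2))
  rw [gp_symm] at a2
  have b1 := gp_tri _ _ _ a1 a2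
  have b2 := gp_tri _ _ _ b1 (by have : (0 : ℝ) ≤ Γ.δ := by positivity
                                 linarith)
  show M ≤ gp Γ (u.seq p.1) (γ p.2)
  linarith

section vis
variable {Z : Type} [MetricSpace Z] (e : GromovBoundary (dR Γ) 1 ≃ Z)

/-- endpoint of a tree ray -/
def pt {γ : ℕ → G} (h : TRay Γ γ) : Z := e (Quot.mk _ ⟨γ, h.conv⟩)

theorem pt_surj (ξ : Z) : ∃ γ, ∃ h : TRay Γ γ, pt e h = ξ := by
  obtain ⟨q, rfl⟩ := e.surjective ξ
  induction q using Quot.ind with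
  | mk u =>
    obtain ⟨γ, h, hr⟩ := bs_ray u
    exact ⟨γ, h, congrArg e (Quot.sound hr).symm⟩

variable {a C : ℝ}

theorem vis2 (hv : IsVisualMetric (dR Γ) 1 e a C) (R : ℕ) (ε : ℝ) (hε : 0 < ε) : ∃ T, ∀ (γ γ' : ℕ → G) (h : TRay Γ γ) (h' : TRay Γ γ') (s t : ℕ),
    T ≤ s → Γ.D (γ s) (γ' t) ≤ R → dist (pt e h) (pt e h') < ε := by
  obtain ⟨ha, hC, hv⟩ := hv
  have hlim : Tendsto (fun T : ℕ => C * a ^ (-((T : ℝ) - R - 2 * Γ.δ))) atTop (nhds 0) := by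
    have h1 : Tendsto (fun T : ℕ => (a⁻¹) ^ T) atTop (nhds 0) :=
      tendsto_pow_atTop_nhds_zero_of_lt_one (by positivity) (inv_lt_one_of_one_lt₀ ha)
    have h2 := h1.const_mul (C * a ^ ((R : ℝ) + 2 * Γ.δ))
    rw [mul_zero] at h2
    refine h2.congr (fun T => ?_)
    rw [mul_assoc]
    congr 1
    rw [show -((T : ℝ) - R - 2 * Γ.δ) = ((R : ℝ) + 2 * Γ.δ) + -(T : ℝ) by ring,
      Real.rpow_add (by linarith) ((R : ℝ) + 2 * Γ.δ) (-(T : ℝ)), Real.rpow_neg (by linarith), Real.rpow_natCast, inv_pow]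
  obtain ⟨T, hT⟩ := ((hlim.eventually (gt_mem_nhds hε)).exists)
  refine ⟨T, fun γ γ' h h' s t hs hD => ?_⟩
  by_cases hr : boundaryRel (dR Γ) 1 ⟨γ, h.conv⟩ ⟨γ', h'.conv⟩
  · have : pt e h = pt e h' := congrArg e (Quot.sound hr)
    rw [this, dist_self]; exact hε
  · have h1 := (hv _ _ hr).2
    refine lt_of_le_of_lt h1 (lt_of_le_of_lt ?_ hT)
    refine mul_le_mul_of_nonneg_left ?_ (by linarith)
    refine Real.rpow_le_rpow_of_exponent_le ha.le (neg_le_neg ?_)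
    refine le_liminf_of_le ?_ ?_
    · unfold boundaryRel at hr
      rw [tendsto_atTop] at hr
      push Not at hr
      obtain ⟨M, hM⟩ := hr
      refine IsCoboundedUnder.of_frequently_le (a := M) ?_
      refine (hM.mono fun p hp => ?_)
      exact hp.le
    · filter_upwards [eventually_ge_atTop ((s, t) : ℕ × ℕ)] with p hp
      rw [gp_eq]
      have n1 := Γ.nm_le (γ s) (γ' t)
      rw [h.nm, h'.nm] at n1
      have n2 : s ≤ t + R := by omega
      have n3 : (s : ℝ) ≤ t + R := by exact_mod_cast n2
      have n4 : (T : ℝ) ≤ s := by exact_mod_cast hs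
      have n5 : (Γ.D (γ s) (γ' t) : ℝ) ≤ R := by exact_mod_cast hD
      have n6 : (0 : ℝ) ≤ R := by positivity
      have n7 : (0 : ℝ) ≤ Γ.δ := by positivity
      have c1 : (T : ℝ) - R ≤ gp Γ (γ p.1) (γ s) :=
        h.gp (by have : (s : ℝ) ≤ p.1 := by exact_mod_cast hp.1
                 linarith) (by linarith)
      have c2 : (T : ℝ) - R ≤ gp Γ (γ s) (γ' t) := by
        unfold NW.gp
        rw [h.nm, h'.nm]
        linarith
      have c3 : (T : ℝ) - R ≤ gp Γ (γ' t) (γ' p.2) :=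
        h'.gp (by linarith) (by have : (t : ℝ) ≤ p.2 := by exact_mod_cast hp.2
                                linarith)
      have b1 := gp_tri _ _ _ c1 c2
      have b2 := gp_tri _ _ _ b1 (by linarith : (T : ℝ) - R - Γ.δ ≤ gp Γ (γ' t) (γ' p.2))
      show (T : ℝ) - R - 2 * Γ.δ ≤ gp Γ (γ p.1) (γ' p.2)
      linarith

theorem vis1 (hv : IsVisualMetric (dR Γ) 1 e a C) (T : ℕ) : ∃ ε > 0, ∀ (γ γ' : ℕ → G) (h : TRay Γ γ) (h' : TRay Γ γ'),
    dist (pt e h) (pt e h') < ε → Γ.D (γ T) (γ' T) ≤ 4 * Γ.δ := by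
  obtain ⟨ha, hC, hv⟩ := hv
  refine ⟨C⁻¹ * a ^ (-((T : ℝ) + 1)), by positivity, fun γ γ' h h' hd => ?_⟩
  have key : ∀ᶠ p : ℕ × ℕ in atTop, (T : ℝ) ≤ gromovProd (dR Γ) (γ p.1) (γ' p.2) 1 := by
    by_cases hr : boundaryRel (dR Γ) 1 ⟨γ, h.conv⟩ ⟨γ', h'.conv⟩
    · exact tendsto_atTop.1 hr T
    · have h1 := (hv _ _ hr).1
      have h2 := lt_of_le_of_lt h1 hd
      have h3 := lt_of_mul_lt_mul_left h2 (by positivity)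
      rw [Real.rpow_lt_rpow_left_iff ha] at h3
      have h4 : (T : ℝ) + 1 < bSeqProd (dR Γ) 1 ⟨γ, h.conv⟩ ⟨γ', h'.conv⟩ := by linarith
      have h5 := eventually_lt_of_lt_liminf h4 (isBoundedUnder_of ⟨0, fun p => by
        rw [gp_eq]; exact gp_nonneg _ _⟩)
      filter_upwards [h5] with p hp
      linarith
  obtain ⟨N, hN⟩ := ev_prod key
  have h1 := hN (max N T) (max N T) (le_max_left _ _) (le_max_left _ _)
  rw [gp_eq] at h1
  simp only at h1
  have hm : (T : ℝ) ≤ ((max N T : ℕ) : ℝ) := by exact_mod_cast le_max_right N T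
  have c1 : (T : ℝ) ≤ gp Γ (γ T) (γ (max N T)) := h.gp le_rfl hm
  have c3 : (T : ℝ) ≤ gp Γ (γ' (max N T)) (γ' T) := h'.gp hm le_rfl
  have n7 : (0 : ℝ) ≤ Γ.δ := by positivity
  have b1 := gp_tri _ _ _ c1 h1
  have b2 := gp_tri _ _ _ b1 (by linarith : (T : ℝ) - Γ.δ ≤ gp Γ (γ' (max N T)) (γ' T))
  unfold NW.gp at b2
  rw [h.nm, h'.nm] at b2
  have : (Γ.D (γ T) (γ' T) : ℝ) ≤ ((4 * Γ.δ : ℕ) : ℝ) := by push_cast; linarith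
  exact_mod_cast this

end vis
end
end NW

namespace NW
section
variable {G : Type} [Group G] {Γ : Geo G}
open Filter

theorem exists_long [Infinite G] (m : ℕ) : ∃ w, Γ.nm w = m := by
  have h : ∃ v, m ≤ Γ.nm v := by
    by_contra hc
    push Not at hc
    exact Set.infinite_univ ((Γ.fin m).subset (fun v _ => (hc v).le))
  obtain ⟨v, hv⟩ := h
  exact ⟨tr' Γ m v, nm_tr' hv⟩

theorem exists_pair [Infinite G] (m : ℕ) : ∃ y1 y2, Γ.nm y1 = m ∧ m ≤ Γ.nm y2 ∧ gp Γ y1 y2 ≤ 0 := by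
  obtain ⟨w, hw⟩ := exists_long (Γ := Γ) (2 * m)
  have hm : m ≤ Γ.nm w := by omega
  set h := tr' Γ m w with hh
  have h1 : Γ.nm h = m := nm_tr' hm
  have h2 : Γ.D h w ≤ m := by
    have := Γ.D_anc (Γ.nm w - m) w
    have e : Γ.par^[Γ.nm w - m] w = h := rfl
    rw [e] at this
    omega
  have h3 : Γ.nm (h⁻¹ * 1) = m := by
    unfold Geo.nm
    rw [← Γ.inv h 1 (h⁻¹ * 1)]
    rw [mul_one, mul_one, mul_inv_cancel, Γ.symm]; exact h1
  have h4 : Γ.nm (h⁻¹ * w) = Γ.D h w := by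
    unfold Geo.nm
    rw [← Γ.inv h 1 (h⁻¹ * w), mul_one, mul_inv_cancel_left]
  have h5 : Γ.D (h⁻¹ * 1) (h⁻¹ * w) = 2 * m := by rw [Γ.inv]; exact hw
  refine ⟨h⁻¹ * 1, h⁻¹ * w, h3, ?_, ?_⟩
  · have := Γ.tri 1 h w
    have e1 : Γ.D 1 w = 2 * m := hw
    have e2 : Γ.D 1 h = m := h1
    omega
  · unfold gp
    rw [h3, h4, h5]
    have : (Γ.D h w : ℝ) ≤ m := by exact_mod_cast h2
    push_cast
    linarith

theorem exists_beyond [Infinite G] (g : G) (m : ℕ) :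
    ∃ x, m ≤ Γ.nm x ∧ (Γ.nm g : ℝ) - Γ.δ ≤ gp Γ g x := by
  obtain ⟨y1, y2, h1, h2, h3⟩ := exists_pair (Γ := Γ) (m + Γ.nm g)
  have hg : Γ.nm g⁻¹ = Γ.nm g := by
    unfold Geo.nm
    rw [← Γ.inv g 1 g⁻¹, mul_one, mul_inv_cancel, Γ.symm]
  have key : ∃ y, m + Γ.nm g ≤ Γ.nm y ∧ gp Γ g⁻¹ y ≤ Γ.δ := by
    by_contra hc
    push Not at hc
    have a1 := hc y1 h1.ge
    have a2 := hc y2 h2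
    rw [gp_symm] at a1
    have := gp_tri (M := min (gp Γ y1 g⁻¹) (gp Γ g⁻¹ y2)) y1 y2 g⁻¹ (min_le_left _ _) (min_le_right _ _)
    have := lt_min a1 a2
    linarith
  obtain ⟨y, hy1, hy2⟩ := key
  have e1 : Γ.D g⁻¹ y = Γ.nm (g * y) := by
    unfold Geo.nm
    rw [← Γ.inv g g⁻¹ y, mul_inv_cancel]
  have e2 : Γ.D g (g * y) = Γ.nm y := by
    have := Γ.inv g 1 y
    rw [mul_one] at this
    exact this
  refine ⟨g * y, ?_, ?_⟩
  · have := Γ.nm_le y g⁻¹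
    rw [Γ.symm, e1, hg] at this
    omega
  · unfold gp at hy2 ⊢
    rw [e1, hg] at hy2
    rw [e2]
    linarith

theorem exists_shadow [Infinite G] (g : G) : ∃ γ, ∃ _ : TRay Γ γ, Γ.D (γ (Γ.nm g)) g ≤ 4 * Γ.δ := by
  choose x hx1 hx2 using exists_beyond (Γ := Γ) g
  obtain ⟨γ, h, hγ⟩ := koenig (Γ := Γ) (hyperfilter ℕ) x (fun t =>
    Filter.Eventually.filter_mono Nat.hyperfilter_le_atTop (by
      filter_upwards [eventually_ge_atTop t] with i hi
      exact hi.trans (hx1 i)))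
  refine ⟨γ, h, ?_⟩
  obtain ⟨i, h1, h2⟩ := (hγ (Γ.nm g)).exists
  have a1 := gp_tr' h1
  rw [h2] at a1
  have a2 := hx2 i
  rw [gp_symm] at a2
  have n7 : (0 : ℝ) ≤ Γ.δ := by positivity
  have b := gp_tri _ _ _ (by linarith : (Γ.nm g : ℝ) - Γ.δ ≤ gp Γ (γ (Γ.nm g)) (x i)) a2
  unfold gp at b
  rw [h.nm] at b
  have : (Γ.D (γ (Γ.nm g)) g : ℝ) ≤ ((4 * Γ.δ : ℕ) : ℝ) := by push_cast; linarith
  exact_mod_cast this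

variable {Z : Type} [MetricSpace Z]

theorem exists_Bdy [Infinite G] (e : GromovBoundary (dR Γ) 1 ≃ Z) {a C : ℝ}
    (hv : IsVisualMetric (dR Γ) 1 e a C) : Nonempty (Bdy Γ Z) ∧ Nonempty Z ∧ CompactSpace Z := by
  choose ray hray hpt using pt_surj e
  refine ⟨⟨{ ray := ray
             zero := fun ξ => (hray ξ).zero
             par := fun ξ => (hray ξ).par
             nm := fun ξ => (hray ξ).nm
             κ := 4 * Γ.δ
             D0 := 8 * Γ.δ
             V1 := ?_
             V2 := ?_
             shadow := ?_ }⟩, ?_, ?_⟩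
  · intro T
    obtain ⟨ε, hε, h⟩ := vis1 e hv T
    refine ⟨ε, hε, fun ξ η hd => h _ _ (hray ξ) (hray η) ?_⟩
    rw [hpt, hpt]; exact hd
  · intro R ε hε
    obtain ⟨T, h⟩ := vis2 e hv R ε hε
    refine ⟨T, fun ξ η s t hs hD => ?_⟩
    have := h _ _ (hray ξ) (hray η) s t hs hD
    rw [hpt, hpt] at this
    exact this
  · intro g
    obtain ⟨γ, h, hg⟩ := exists_shadow (Γ := Γ) g
    refine ⟨pt e h, ?_⟩
    obtain ⟨ε, hε, h1⟩ := vis1 e hv (Γ.nm g)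
    have h2 := h1 _ _ (hray (pt e h)) h (by rw [hpt, dist_self]; exact hε)
    have h3 := Γ.tri (ray (pt e h) (Γ.nm g)) (γ (Γ.nm g)) g
    omega
  · obtain ⟨γ, h, -⟩ := exists_shadow (Γ := Γ) 1
    exact ⟨pt e h⟩
  · refine ⟨isCompact_iff_ultrafilter_le_nhds.2 (fun F _ => ?_)⟩
    have h : ∀ t, ∃ g, ∀ᶠ ξ in (F : Filter Z), ray ξ t = g := by
      intro t
      have h1 : ∀ᶠ ξ in (F : Filter Z), ∃ g ∈ {g | Γ.D 1 g ≤ t}, ray ξ t = g :=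
        Filter.Eventually.of_forall (fun ξ => ⟨_, ((hray ξ).nm t).le, rfl⟩)
      obtain ⟨g, -, hg⟩ := (Ultrafilter.eventually_exists_mem_iff (Γ.fin t)).1 h1
      exact ⟨g, hg⟩
    choose γ hγ using h
    have hγr : TRay Γ γ := by
      refine ⟨fun t => ?_, fun t => ?_⟩
      · obtain ⟨ξ, hξ⟩ := (hγ t).exists
        rw [← hξ, (hray ξ).nm]
      · obtain ⟨ξ, h1, h2⟩ := ((hγ (t + 1)).and (hγ t)).exists
        rw [← h1, ← h2, (hray ξ).par]
    refine ⟨pt e hγr, trivial, ?_⟩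
    rw [Metric.nhds_basis_ball.ge_iff]
    intro ε hε
    obtain ⟨T, hT⟩ := vis2 e hv 0 ε hε
    have : ∀ᶠ ξ in (F : Filter Z), dist ξ (pt e hγr) < ε := by
      filter_upwards [hγ T] with ξ hξ
      have := hT _ _ (hray ξ) hγr T T le_rfl (by rw [hξ, Γ.self])
      rw [hpt] at this
      exact this
    exact this

theorem Z_empty [Finite G] (e : GromovBoundary (dR Γ) 1 ≃ Z) : IsEmpty Z := by
  refine ⟨fun ξ => ?_⟩
  obtain ⟨γ, h, -⟩ := pt_surj e ξ
  refine not_injective_infinite_finite γ (fun s t hst => ?_)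
  rw [← h.nm s, ← h.nm t, hst]

theorem homeo_iter (f : Z ≃ₜ Z) (i : ℕ) (x : Z) : (⇑f)^[i] x = (f ^ i) x := by
  induction i generalizing x with
  | zero => rfl
  | succ i ih => rw [Function.iterate_succ_apply, ih, pow_succ]; rfl

theorem nhds_close (Q : Subgroup (Z ≃ₜ Z)) (ε : ℝ) (hε : 0 < ε) :
    {g : Q | ∀ x, dist ((g : Z ≃ₜ Z) x) x < ε} ∈ nhds (1 : Q) := by
  have h1 : {f : Z ≃ₜ Z | ∀ x, dist (f x) x < ε} ∈ nhds (1 : Z ≃ₜ Z) := by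
    rw [nhds_induced, mem_comap]
    refine ⟨_, (UniformFun.hasBasis_nhds Z Z (UniformFun.ofFun ((1 : Z ≃ₜ Z) : Z → Z))).mem_of_mem
      (Metric.dist_mem_uniformity hε), ?_⟩
    intro f hf x
    have := hf x
    rw [dist_comm]
    exact this
  have h2 : ContinuousAt (Subtype.val : Q → (Z ≃ₜ Z)) (1 : Q) := continuous_subtype_val.continuousAt
  exact h2.preimage_mem_nhds h1

theorem no_small (Q : Subgroup (Z ≃ₜ Z)) [CompactSpace Z] {N : ℕ} {α : List Z → ℤ} {ε0 : ℝ}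
    (H : PP Z N α ε0) : ¬ HasArbitrarilySmallTorsion Q := by
  intro hs
  obtain ⟨g, -, hg1, ⟨k, hk, hgk⟩, hpow⟩ := hs _ (nhds_close Q (ε0 / 4) (by have := H.pos; positivity))
  have hfin : IsOfFinOrder g := isOfFinOrder_iff_pow_eq_one.2 ⟨k, hk, hgk⟩
  have hm : orderOf g ≠ 1 := fun h => hg1 (orderOf_eq_one_iff.1 h)
  have hm0 : 0 < orderOf g := hfin.orderOf_pos
  obtain ⟨p, hp, r, hr⟩ := Nat.exists_prime_and_dvd hm
  have hr0 : 0 < r := Nat.pos_of_ne_zero (fun h => by rw [h] at hr; omega)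
  have hh1 : g ^ r ≠ 1 := by
    refine pow_ne_one_of_lt_orderOf hr0.ne' ?_
    rw [hr]
    nlinarith [hp.two_le]
  have hhp : (g ^ r) ^ p = 1 := by rw [← pow_mul, mul_comm r p, ← hr, pow_orderOf_eq_one]
  set f : Z ≃ₜ Z := ((g ^ r : Q) : Z ≃ₜ Z) with hf
  have hc : ∀ i, f ^ i = ((g ^ (r * i) : Q) : Z ≃ₜ Z) := fun i => by
    rw [hf, pow_mul]; rfl
  refine newman H f.continuous hp (T := ⇑f) ?_ ?_ ?_
  · intro x
    rw [homeo_iter]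
    have : f ^ p = 1 := by
      have := congrArg (fun q : Q => (q : Z ≃ₜ Z)) hhp
      exact this
    rw [this]; rfl
  · intro i x
    rw [homeo_iter, hc]
    rcases Nat.eq_zero_or_pos i with rfl | hi
    · show dist x x < _
      rw [dist_self]
      have := H.pos
      positivity
    · exact hpow (r * i) (Nat.mul_pos hr0 hi) x
  · by_contra hcon
    push Not at hcon
    exact hh1 (Subtype.ext (Homeomorph.ext hcon))

theorem main {S : Set G} (hSfin : S.Finite) (hSgen : Subgroup.closure S = ⊤)
    (δ : ℝ) (hhyp : IsGromovHyperbolicDist (wordDist G S) δ)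
    (n : ℕ) (hPD : IsPDGroup G n) (e : GromovBoundary (wordDist G S) 1 ≃ Z)
    (a C : ℝ) (hvis : IsVisualMetric (wordDist G S) 1 e a C)
    (Q : Subgroup (Z ≃ₜ Z)) : ¬ HasArbitrarilySmallTorsion Q := by
  obtain ⟨Γ, hΓ⟩ := exists_Geo S hSfin hSgen δ hhyp
  clear hhyp
  revert e
  rw [hΓ]
  intro e hvis
  rcases finite_or_infinite G with hG | hG
  · have := Z_empty e
    intro hs
    obtain ⟨g, -, hg1, -⟩ := hs Set.univ univ_mem
    exact hg1 (Subtype.ext (Homeomorph.ext (fun x => this.elim x)))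
  · obtain ⟨⟨β⟩, hne, hcomp⟩ := exists_Bdy e hvis
    obtain ⟨h1, ⟨φ⟩⟩ := hPD
    obtain ⟨c0, H0⟩ := exists_GCp Γ n h1 φ
    obtain ⟨c1, H, hnd⟩ := H0.nodup
    obtain ⟨α, ε0, HP⟩ := β.pp H hnd
    exact no_small Q HP

end
end NW

/-- For `G` a hyperbolic Poincaré duality group, a group of boundary values
of quasi-isometries of `G` (in particular the full group `QI(G)`), with the uniform topology,
cannot have arbitrarily small torsion elements. -/
theorem qi_group_of_pd_group_no_arbitrarily_small_torsion
    {G : Type} [Group G] (S : Set G) (hSfin : S.Finite) (hSgen : Subgroup.closure S = ⊤)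
    (δ : ℝ) (hδ : 0 ≤ δ) (hhyp : IsGromovHyperbolicDist (wordDist G S) δ)
    (n : ℕ) (hPD : IsPDGroup G n)
    {Z : Type} [MetricSpace Z] (e : GromovBoundary (wordDist G S) 1 ≃ Z)
    (a C : ℝ) (hvis : IsVisualMetric (wordDist G S) 1 e a C)
    (Q : Subgroup (Z ≃ₜ Z))
    (hQqi : ∀ q ∈ Q, ∃ (K ε : ℝ) (φ : G → G), 1 ≤ K ∧ 0 ≤ ε ∧
      IsQuasiIsometryDist (wordDist G S) (wordDist G S) K ε φ ∧
      BoundaryMapExtends (wordDist G S) 1 (wordDist G S) 1 e e (⇑q) φ) :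
    ¬ HasArbitrarilySmallTorsion Q := by
  exact NW.main hSfin hSgen δ hhyp n hPD e a C hvis Q
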